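/- arXiv:1111.6766 — 2 statements merged into one kernel-verified Lean document; each statement's English description precedes it below -/
import Mathlib

section
/- The number i_n of unlabelled interval orders on n points satisfies the asymptotic formula i_n / ( n! · √n · (6/π²)^n ) → C₀ as n → ∞, where C₀ = (12√3 / π^{5/2}) · e^{π²/12}. -/
open scoped Classical

/-- An interval order on `Fin n`: a strict partial order with no induced `2+2`. -/
def IntervalOrderRel (n : ℕ) : Type :=
  {r : Fin n → Fin n → Prop // IsStrictOrder (Fin n) r ∧
    ∀ a b c d, r a b → r c d → r a d ∨ r c b}

/-- Two interval orders on `Fin n` are isomorphic if some permutation of the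
ground set transforms one into the other. -/
def IntervalOrderIso {n : ℕ} (P Q : IntervalOrderRel n) : Prop :=
  ∃ e : Equiv.Perm (Fin n), ∀ a b, P.1 a b ↔ Q.1 (e a) (e b)

/-- `i n`: the number of unlabelled interval orders on `n` points, i.e. the number
of isomorphism classes of interval orders on an `n`-element set. -/
noncomputable def intervalOrderCount (n : ℕ) : ℕ :=
  Nat.card (Quot (IntervalOrderIso (n := n)))

/-- A poset is rigid if its only (order) automorphism is the identity. -/
def IsRigid {n : ℕ} (P : IntervalOrderRel n) : Prop :=
  ∀ e : Equiv.Perm (Fin n), (∀ a b, P.1 a b ↔ P.1 (e a) (e b)) → e = 1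

/-- `r n`: the number of unlabelled rigid interval orders on `n` points. -/
noncomputable def rigidIntervalOrderCount (n : ℕ) : ℕ :=
  Nat.card (Quot fun (P Q : {P : IntervalOrderRel n // IsRigid P}) =>
    IntervalOrderIso P.1 Q.1)

/-- `ℓ n`: the number of labelled interval orders on an `n`-element set. -/
noncomputable def labelledIntervalOrderCount (n : ℕ) : ℕ :=
  Nat.card (IntervalOrderRel n)

/-- `x` and `y` are distinct elements with duplicated holdings:
`D(x) = D(y)` and `U(x) = U(y)`. -/
def DupHoldings {n : ℕ} (P : IntervalOrderRel n) (x y : Fin n) : Prop :=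
  x ≠ y ∧ (∀ z, P.1 z x ↔ P.1 z y) ∧ (∀ z, P.1 x z ↔ P.1 y z)

/-- The number of unordered pairs `{x, y}` of distinct elements with duplicated
holdings. -/
noncomputable def dupPairCount {n : ℕ} (P : IntervalOrderRel n) : ℕ :=
  Nat.card {s : Finset (Fin n) // ∃ x y, DupHoldings P x y ∧ s = {x, y}}

/-- `P` has three distinct elements pairwise having duplicated holdings. -/
def HasDupTriple {n : ℕ} (P : IntervalOrderRel n) : Prop :=
  ∃ x y z : Fin n, x ≠ y ∧ x ≠ z ∧ y ≠ z ∧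
    DupHoldings P x y ∧ DupHoldings P x z ∧ DupHoldings P y z

/-- The Stirling number of the second kind `S(n, k)`: the number of partitions
of an `n`-element set into `k` non-empty parts. -/
noncomputable def stirling2 (n k : ℕ) : ℕ :=
  Nat.card {P : Finpartition (Finset.univ : Finset (Fin n)) // P.parts.card = k}

namespace IntervalOrder

open PowerSeries Finset

/-- The formal sum of a family of power series whose `k`-th member is divisible by `X ^ k`. -/
noncomputable def formalSum (u : ℕ → ℝ⟦X⟧) : ℝ⟦X⟧ :=
  PowerSeries.mk fun n => ∑ k ∈ range (n + 1), coeff n (u k)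

lemma coeff_formalSum {u : ℕ → ℝ⟦X⟧} (hu : ∀ k, (X : ℝ⟦X⟧) ^ k ∣ u k) {n K : ℕ} (h : n < K) :
    coeff n (formalSum u) = ∑ k ∈ range K, coeff n (u k) := by
  rw [formalSum, coeff_mk]
  refine sum_subset (range_mono h) fun k _ hk => ?_
  exact X_pow_dvd_iff.1 (hu k) n (by simpa using hk)

lemma formalSum_mul_left (f : ℝ⟦X⟧) {u : ℕ → ℝ⟦X⟧} (hu : ∀ k, (X : ℝ⟦X⟧) ^ k ∣ u k) :
    formalSum (fun k => f * u k) = f * formalSum u := by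
  ext n
  rw [formalSum, coeff_mk, coeff_mul]
  simp_rw [coeff_mul]
  rw [sum_comm]
  refine sum_congr rfl fun p hp => ?_
  rw [← mul_sum, coeff_formalSum hu (K := n + 1)]
  have := mem_antidiagonal.1 hp
  omega

lemma formalSum_sub (u v : ℕ → ℝ⟦X⟧) :
    formalSum (fun k => u k - v k) = formalSum u - formalSum v := by
  ext n
  simp [formalSum, sum_sub_distrib]

lemma formalSum_succ {u : ℕ → ℝ⟦X⟧} (hu : ∀ k, (X : ℝ⟦X⟧) ^ k ∣ u k) :
    formalSum u = u 0 + formalSum (fun k => u (k + 1)) := by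
  ext n
  rw [coeff_formalSum hu (K := n + 2) (by omega), sum_range_succ', map_add, add_comm]
  simp [formalSum]

/-- The power series `(1 - X) ^ z` for a real exponent `z`. -/
noncomputable def qpow (z : ℝ) : ℝ⟦X⟧ := rescale (-1) (binomialSeries ℝ z)

lemma qpow_add (z w : ℝ) : qpow (z + w) = qpow z * qpow w := by simp [qpow]

@[simp] lemma qpow_zero : qpow 0 = 1 := by simp [qpow]

lemma qpow_natCast (n : ℕ) : qpow n = (1 - X) ^ n := by
  rw [qpow, binomialSeries_nat, map_pow, map_add, map_one, rescale_X]
  simp [sub_eq_add_neg]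

@[simp] lemma constantCoeff_qpow (z : ℝ) : constantCoeff (qpow z) = 1 := by
  rw [← coeff_zero_eq_constantCoeff_apply, qpow, coeff_rescale]
  simp

lemma X_dvd_one_sub_qpow (z : ℝ) : (X : ℝ⟦X⟧) ∣ 1 - qpow z := by
  rw [X_dvd_iff]
  simp

/-- The polynomial in `z` giving the coefficient of `X ^ n` in `(1 - X) ^ z`. -/
noncomputable def qpowCoeff (n : ℕ) : Polynomial ℝ :=
  Polynomial.C ((n.factorial : ℝ)⁻¹) * ∏ i ∈ range n, (Polynomial.C (i : ℝ) - Polynomial.X)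

lemma coeff_qpow (n : ℕ) (z : ℝ) : coeff n (qpow z) = (qpowCoeff n).eval z := by
  have h := Ring.descPochhammer_eq_factorial_smul_choose z n
  rw [qpow, coeff_rescale, binomialSeries_coeff, qpowCoeff, Polynomial.eval_mul,
    Polynomial.eval_prod, Polynomial.eval_C]
  have h2 : (descPochhammer ℤ n).smeval z = (-1) ^ n * ∏ i ∈ range n, ((i : ℝ) - z) := by
    clear h
    induction n with
    | zero => simp
    | succ n ih =>
      rw [descPochhammer_succ_right, Polynomial.smeval_mul, ih, prod_range_succ]
      simp [Polynomial.smeval_sub, pow_succ, Polynomial.smeval_natCast]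
      ring
  rw [h2, nsmul_eq_mul] at h
  have hn : (n.factorial : ℝ) ≠ 0 := by positivity
  simp only [smul_eq_mul, mul_one, Polynomial.eval_sub, Polynomial.eval_C, Polynomial.eval_X]
  rw [← mul_right_inj' hn, mul_left_comm, ← h, mul_inv_cancel_left₀ hn, ← mul_assoc, ← mul_pow]
  simp

/-- The `q`-Pochhammer symbol `(q ^ z; q)_n` at `q = 1 - X`. -/
noncomputable def qPoch (z : ℝ) (n : ℕ) : ℝ⟦X⟧ := ∏ j ∈ range n, (1 - qpow (z + j))

lemma X_pow_dvd_qPoch (z : ℝ) (n : ℕ) : (X : ℝ⟦X⟧) ^ n ∣ qPoch z n := by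
  rw [qPoch]
  simpa using prod_dvd_prod_of_dvd (s := range n) (fun _ => (X : ℝ⟦X⟧)) _
    fun j _ => X_dvd_one_sub_qpow (z + j)

lemma qPoch_succ (z : ℝ) (n : ℕ) : qPoch z (n + 1) = qPoch z n * (1 - qpow (z + n)) := by
  rw [qPoch, prod_range_succ, qPoch]

lemma qPoch_succ' (z : ℝ) (n : ℕ) : qPoch z (n + 1) = (1 - qpow z) * qPoch (z + 1) n := by
  rw [qPoch, prod_range_succ', qPoch, mul_comm]
  simp [add_assoc, add_comm (1 : ℝ)]

/-- The series `∑ (xq; q)_n x ^ n` with `x = q ^ z` and `q = 1 - X`. -/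
noncomputable def fineSum (z : ℝ) : ℝ⟦X⟧ := formalSum fun n => qPoch (z + 1) n * qpow (n * z)

/-- The series `∑ (x; q)_{n+1} x ^ n` with `x = q ^ z` and `q = 1 - X`. -/
noncomputable def thetaSum (z : ℝ) : ℝ⟦X⟧ := (1 - qpow z) * fineSum z

lemma thetaSum_eq (z : ℝ) :
    thetaSum z = 1 - qpow (1 + 2 * z) - qpow (2 + 3 * z) * thetaSum (z + 1) := by
  set T := formalSum fun n => qPoch (z + 1) n * qpow (n * (z + 1)) with hT
  have dU : ∀ w k, (X : ℝ⟦X⟧) ^ k ∣ qPoch (z + 1) k * qpow w := fun w k =>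
    Dvd.dvd.mul_right (X_pow_dvd_qPoch _ _) _
  have h1 : fineSum z = 1 + qpow z * (fineSum z - qpow (z + 1) * T) := by
    conv_lhs => rw [fineSum, formalSum_succ (fun k => dU _ k)]
    rw [hT, fineSum, ← formalSum_mul_left _ (fun k => dU _ k), ← formalSum_sub,
      ← formalSum_mul_left]
    · congr 1
      · simp [qPoch]
      · congr 1
        ext1 n
        rw [qPoch_succ]
        have e1 : qpow ((n + 1 : ℕ) * z) = qpow z * qpow (n * z) := by
          rw [← qpow_add]; push_cast; ring_nf
        have e2 : qpow (z + 1 + n) * qpow (n * z) = qpow (z + 1) * qpow (n * (z + 1)) := by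
          rw [← qpow_add, ← qpow_add]; ring_nf
        rw [e1]
        linear_combination (-qPoch (z + 1) n * qpow z) * e2
    · intro k
      exact dvd_sub (dU _ k) (Dvd.dvd.mul_left (dU _ k) _)
  have h2 : T = 1 + qpow (z + 1) * thetaSum (z + 1) := by
    rw [hT, formalSum_succ (fun k => dU _ k), thetaSum, fineSum, ← mul_assoc,
      ← formalSum_mul_left]
    · congr 1
      · simp [qPoch]
      · congr 1
        ext1 n
        rw [qPoch_succ']
        have e1 : qpow ((n + 1 : ℕ) * (z + 1)) = qpow (z + 1) * qpow (n * (z + 1)) := by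
          rw [← qpow_add]; push_cast; ring_nf
        rw [e1]
        ring
    · exact fun k => Dvd.dvd.mul_right (X_pow_dvd_qPoch _ _) _
  have e3 : qpow (1 + 2 * z) = qpow z * qpow (z + 1) := by rw [← qpow_add]; ring_nf
  have e4 : qpow (2 + 3 * z) = qpow z * qpow (z + 1) * qpow (z + 1) := by
    rw [← qpow_add, ← qpow_add]; ring_nf
  rw [e3, e4]
  rw [h2] at h1
  conv_lhs => rw [thetaSum]
  linear_combination h1

/-- Every coefficient of the family `f` of power series depends polynomially on the parameter. -/
def PolyCoeff (f : ℝ → ℝ⟦X⟧) : Prop :=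
  ∀ N, ∃ p : Polynomial ℝ, ∀ z, coeff N (f z) = p.eval z

lemma PolyCoeff.mul {f g : ℝ → ℝ⟦X⟧} (hf : PolyCoeff f) (hg : PolyCoeff g) :
    PolyCoeff fun z => f z * g z := by
  intro N
  choose p hp using hf
  choose r hr using hg
  refine ⟨∑ x ∈ antidiagonal N, p x.1 * r x.2, fun z => ?_⟩
  simp [coeff_mul, hp, hr, Polynomial.eval_finsetSum]

lemma PolyCoeff.sub {f g : ℝ → ℝ⟦X⟧} (hf : PolyCoeff f) (hg : PolyCoeff g) :
    PolyCoeff fun z => f z - g z := by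
  intro N
  obtain ⟨p, hp⟩ := hf N
  obtain ⟨r, hr⟩ := hg N
  exact ⟨p - r, fun z => by simp [hp, hr]⟩

lemma polyCoeff_const (f : ℝ⟦X⟧) : PolyCoeff fun _ => f :=
  fun N => ⟨Polynomial.C (coeff N f), fun z => by simp⟩

lemma polyCoeff_qpow (a b : ℝ) : PolyCoeff fun z => qpow (a * z + b) := fun N =>
  ⟨(qpowCoeff N).comp (Polynomial.C a * Polynomial.X + Polynomial.C b), fun z => by
    simp [coeff_qpow]⟩

lemma polyCoeff_qPoch (n : ℕ) : PolyCoeff fun z => qPoch (z + 1) n := by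
  induction n with
  | zero => simpa [qPoch] using polyCoeff_const 1
  | succ n ih =>
    simp_rw [qPoch_succ]
    refine ih.mul ((polyCoeff_const 1).sub ?_)
    simpa [add_assoc] using polyCoeff_qpow 1 (1 + n)

lemma PolyCoeff.formalSum {f : ℕ → ℝ → ℝ⟦X⟧} (hf : ∀ n, PolyCoeff (f n)) :
    PolyCoeff fun z => formalSum fun n => f n z := by
  intro N
  choose p hp using fun n => hf n N
  exact ⟨∑ k ∈ range (N + 1), p k, fun z => by
    simp [IntervalOrder.formalSum, hp, Polynomial.eval_finsetSum]⟩

lemma polyCoeff_fineSum : PolyCoeff fineSum :=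
  PolyCoeff.formalSum fun n => (polyCoeff_qPoch n).mul (by simpa using polyCoeff_qpow n 0)

lemma polyCoeff_thetaSum : PolyCoeff thetaSum :=
  ((polyCoeff_const 1).sub (by simpa using polyCoeff_qpow 1 0)).mul polyCoeff_fineSum

/-- A right inverse of the forward difference operator on real polynomials. -/
noncomputable def antidiff : Polynomial ℝ →ₗ[ℝ] Polynomial ℝ :=
  (Polynomial.basisMonomials ℝ).constr ℝ fun k =>
    ((k : ℝ) + 1)⁻¹ • (Polynomial.bernoulli (k + 1)).map (algebraMap ℚ ℝ)

lemma antidiff_X_pow (k : ℕ) : antidiff (Polynomial.X ^ k) =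
    ((k : ℝ) + 1)⁻¹ • (Polynomial.bernoulli (k + 1)).map (algebraMap ℚ ℝ) := by
  rw [antidiff, Polynomial.X_pow_eq_monomial,
    ← congrFun (Polynomial.coe_basisMonomials (R := ℝ)) k, Module.Basis.constr_basis]

lemma eval_bernoulli_add_one (k : ℕ) (x : ℝ) :
    ((Polynomial.bernoulli (k + 1)).map (algebraMap ℚ ℝ)).eval (x + 1) =
      ((Polynomial.bernoulli (k + 1)).map (algebraMap ℚ ℝ)).eval x + (k + 1) * x ^ k := by
  have h : (Polynomial.bernoulli (k + 1)).comp (Polynomial.X + 1) =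
      Polynomial.bernoulli (k + 1) + Polynomial.C ((k : ℚ) + 1) * Polynomial.X ^ k := by
    refine Polynomial.funext fun r => ?_
    rw [Polynomial.eval_comp]
    simpa [add_comm] using Polynomial.bernoulli_eval_one_add (k + 1) r
  have h2 := congrArg (fun p => Polynomial.eval x (p.map (algebraMap ℚ ℝ))) h
  simpa [Polynomial.map_comp] using h2

lemma antidiff_eval_add_one (p : Polynomial ℝ) (x : ℝ) :
    (antidiff p).eval (x + 1) = (antidiff p).eval x + p.eval x := by
  induction p using Polynomial.induction_on' with
  | add p r hp hr => rw [map_add]; simp only [Polynomial.eval_add, hp, hr]; ring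
  | monomial k a =>
    rw [← Polynomial.C_mul_X_pow_eq_monomial, ← Polynomial.smul_eq_C_mul, map_smul,
      antidiff_X_pow]
    simp only [Polynomial.eval_smul, eval_bernoulli_add_one, smul_eq_mul, Polynomial.eval_pow,
      Polynomial.eval_X]
    field_simp

lemma eval_eq_of_periodic {p : Polynomial ℝ} (h : ∀ x, p.eval (x + 1) = p.eval x) (x y : ℝ) :
    p.eval x = p.eval y := by
  have hn : ∀ n : ℕ, p.eval (n : ℝ) = p.eval 0 := by
    intro n
    induction n with
    | zero => simp
    | succ n ih => rw [← ih, Nat.cast_succ, h]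
  have hp : p = Polynomial.C (p.eval 0) := by
    refine Polynomial.eq_of_infinite_eval_eq _ _ ?_
    refine (Set.infinite_range_of_injective (Nat.cast_injective (R := ℝ))).mono ?_
    rintro _ ⟨n, rfl⟩
    simp [hn]
  rw [hp]
  simp

lemma eq_zero_of_eval_add_one_eq_neg {p : Polynomial ℝ} (h : ∀ x, p.eval x + p.eval (x + 1) = 0)
    (x : ℝ) : p.eval x = 0 := by
  have h2 : ∀ y, (p.comp (2 * Polynomial.X)).eval (y + 1) = (p.comp (2 * Polynomial.X)).eval y := by
    intro y
    have h1 := h (2 * y)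
    have h3 := h (2 * y + 1)
    simp only [Polynomial.eval_comp, Polynomial.eval_mul, Polynomial.eval_X,
      Polynomial.eval_ofNat]
    rw [show 2 * (y + 1) = 2 * y + 1 + 1 by ring]
    linarith
  have h4 := eval_eq_of_periodic h2 (x / 2) ((x + 1) / 2)
  simp only [Polynomial.eval_comp, Polynomial.eval_mul, Polynomial.eval_X,
    Polynomial.eval_ofNat] at h4
  rw [mul_div_cancel₀ _ two_ne_zero, mul_div_cancel₀ _ two_ne_zero] at h4
  have := h x
  linarith

/-- The regularised sum `∑ χ(m) p(m)` over `m ≥ 1`, where `χ` is the even primitive character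
modulo `12`. -/
noncomputable def charSum (p : Polynomial ℝ) : ℝ :=
  -((antidiff (p.comp (12 * Polynomial.X))).eval (1 / 12)
    - (antidiff (p.comp (12 * Polynomial.X))).eval (5 / 12)
    - (antidiff (p.comp (12 * Polynomial.X))).eval (7 / 12)
    + (antidiff (p.comp (12 * Polynomial.X))).eval (11 / 12))

lemma charSum_add (p r : Polynomial ℝ) : charSum (p + r) = charSum p + charSum r := by
  simp only [charSum, Polynomial.add_comp, map_add, Polynomial.eval_add]
  ring

lemma charSum_C_mul (a : ℝ) (p : Polynomial ℝ) :
    charSum (Polynomial.C a * p) = a * charSum p := by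
  rw [← Polynomial.smul_eq_C_mul]
  simp only [charSum, Polynomial.smul_comp, map_smul, Polynomial.eval_smul, smul_eq_mul]
  ring

lemma charSum_sum {ι : Type*} (s : Finset ι) (p : ι → Polynomial ℝ) :
    charSum (∑ i ∈ s, p i) = ∑ i ∈ s, charSum (p i) :=
  map_sum (AddMonoidHom.mk' charSum charSum_add) p s

lemma charSum_add_shift (p : Polynomial ℝ) :
    charSum p + charSum (p.comp (Polynomial.X + 6)) = p.eval 1 - p.eval 5 := by
  set b := antidiff (p.comp (12 * Polynomial.X)) with hb
  set c := antidiff ((p.comp (Polynomial.X + 6)).comp (12 * Polynomial.X)) with hc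
  have hper : ∀ x, (c - b.comp (Polynomial.X + Polynomial.C (1 / 2))).eval (x + 1) =
      (c - b.comp (Polynomial.X + Polynomial.C (1 / 2))).eval x := by
    intro x
    simp only [Polynomial.eval_sub, Polynomial.eval_comp, Polynomial.eval_add, Polynomial.eval_X,
      Polynomial.eval_C]
    rw [add_right_comm, hb, hc, antidiff_eval_add_one, antidiff_eval_add_one]
    simp only [Polynomial.eval_comp, Polynomial.eval_add, Polynomial.eval_X,
      Polynomial.eval_mul, Polynomial.eval_ofNat]
    ring_nf
  have key : ∀ x, c.eval x = b.eval (x + 1 / 2) + (c.eval 0 - b.eval (1 / 2)) := by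
    intro x
    have := eval_eq_of_periodic hper x 0
    simp only [Polynomial.eval_sub, Polynomial.eval_comp, Polynomial.eval_add, Polynomial.eval_X,
      Polynomial.eval_C, zero_add] at this
    linarith
  have h1 := antidiff_eval_add_one (p.comp (12 * Polynomial.X)) (1 / 12)
  have h5 := antidiff_eval_add_one (p.comp (12 * Polynomial.X)) (5 / 12)
  rw [← hb] at h1 h5
  rw [charSum, charSum, ← hb, ← hc, key (1 / 12), key (5 / 12), key (7 / 12), key (11 / 12)]
  simp only [Polynomial.eval_comp, Polynomial.eval_X,
      Polynomial.eval_mul, Polynomial.eval_ofNat] at h1 h5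
  norm_num at h1 h5 ⊢
  linarith

/-- The exponent `(m² - 1) / 24 + z (m - 1) / 2` as a polynomial in `m`. -/
noncomputable def thetaExp (z : ℝ) : Polynomial ℝ :=
  Polynomial.C (1 / 24) * (Polynomial.X ^ 2 - 1) +
    Polynomial.C z * (Polynomial.C (1 / 2) * (Polynomial.X - 1))

/-- The regularised theta series `∑ χ(m) q ^ ((m² - 1) / 24) x ^ ((m - 1) / 2)` with
`x = q ^ z` and `q = 1 - X`. -/
noncomputable def regTheta (z : ℝ) : ℝ⟦X⟧ :=
  PowerSeries.mk fun N => charSum ((qpowCoeff N).comp (thetaExp z))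

lemma qpowCoeff_comp_add (N : ℕ) (p r : Polynomial ℝ) :
    (qpowCoeff N).comp (p + r) =
      ∑ x ∈ antidiagonal N, (qpowCoeff x.1).comp p * (qpowCoeff x.2).comp r := by
  refine Polynomial.funext fun y => ?_
  simp only [Polynomial.eval_comp, Polynomial.eval_add, Polynomial.eval_finsetSum,
    Polynomial.eval_mul, ← coeff_qpow]
  rw [qpow_add, coeff_mul]

lemma regTheta_eq (z : ℝ) :
    regTheta z = 1 - qpow (1 + 2 * z) - qpow (2 + 3 * z) * regTheta (z + 1) := by
  ext N
  have h := charSum_add_shift ((qpowCoeff N).comp (thetaExp z))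
  have e : (thetaExp z).comp (Polynomial.X + 6) =
      Polynomial.C (2 + 3 * z) + thetaExp (z + 1) := by
    refine Polynomial.funext fun y => ?_
    simp [thetaExp]
    ring
  rw [Polynomial.comp_assoc, e, qpowCoeff_comp_add, charSum_sum] at h
  simp_rw [Polynomial.comp_C, charSum_C_mul, ← coeff_qpow] at h
  have e1 : (thetaExp z).eval 1 = 0 := by simp [thetaExp]
  have e5 : (thetaExp z).eval 5 = 1 + 2 * z := by simp [thetaExp]; ring
  rw [Polynomial.eval_comp, Polynomial.eval_comp, e1, e5, ← coeff_qpow, ← coeff_qpow,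
    qpow_zero] at h
  rw [map_sub, map_sub, coeff_mul]
  simp only [regTheta, coeff_mk]
  linarith

lemma charSum_mul_comp (P B p : Polynomial ℝ) : ∃ r : Polynomial ℝ,
    (∀ z, charSum (P * p.comp (Polynomial.C z * B)) = r.eval z) ∧
      r.coeff 1 = p.coeff 1 * charSum (P * B) := by
  refine ⟨∑ k ∈ range (p.natDegree + 2),
    Polynomial.C (p.coeff k * charSum (P * B ^ k)) * Polynomial.X ^ k, fun z => ?_, ?_⟩
  · rw [Polynomial.comp, Polynomial.eval₂_eq_sum_range' _ (n := p.natDegree + 2) (by omega),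
      mul_sum, charSum_sum, Polynomial.eval_finsetSum]
    refine sum_congr rfl fun k _ => ?_
    rw [mul_pow, ← map_pow, mul_left_comm, charSum_C_mul, mul_left_comm, charSum_C_mul]
    simp
    ring
  · simp [Polynomial.finsetSum_coeff, Polynomial.coeff_X_pow, -map_mul]

lemma charSum_thetaExp (N : ℕ) : ∃ r : Polynomial ℝ,
    (∀ z, coeff N (regTheta z) = r.eval z) ∧
      r.coeff 1 = ∑ x ∈ antidiagonal N, (qpowCoeff x.2).coeff 1 *
        charSum ((qpowCoeff x.1).comp (Polynomial.C (1 / 24) * (Polynomial.X ^ 2 - 1)) *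
          (Polynomial.C (1 / 2) * (Polynomial.X - 1))) := by
  choose r hr hr' using fun x : ℕ × ℕ => charSum_mul_comp
    ((qpowCoeff x.1).comp (Polynomial.C (1 / 24) * (Polynomial.X ^ 2 - 1)))
    (Polynomial.C (1 / 2) * (Polynomial.X - 1)) (qpowCoeff x.2)
  refine ⟨∑ x ∈ antidiagonal N, r x, fun z => ?_, ?_⟩
  · simp [regTheta, thetaExp, qpowCoeff_comp_add, charSum_sum, Polynomial.eval_finsetSum, ← hr]
  · simp [Polynomial.finsetSum_coeff, hr']

lemma thetaSum_eq_regTheta (z : ℝ) : thetaSum z = regTheta z := by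
  ext N
  induction N using Nat.strong_induction_on generalizing z with
  | _ N ih =>
  obtain ⟨p, hp⟩ := polyCoeff_thetaSum N
  obtain ⟨r, hr, -⟩ := charSum_thetaExp N
  have h : ∀ x, (p - r).eval x + (p - r).eval (x + 1) = 0 := by
    intro x
    have h1 := congrArg (coeff N) (thetaSum_eq x)
    have h2 := congrArg (coeff N) (regTheta_eq x)
    have h3 : coeff N (qpow (2 + 3 * x) * (thetaSum (x + 1) - regTheta (x + 1))) =
        coeff N (thetaSum (x + 1) - regTheta (x + 1)) := by
      rw [coeff_mul, sum_eq_single (0, N)]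
      · simp
      · rintro ⟨i, j⟩ hij hne
        have hij' := mem_antidiagonal.1 hij
        have hj : j < N := by
          rcases Nat.eq_zero_or_pos i with h0 | h0
          · subst h0
            simp at hij'
            simp [hij'] at hne
          · simp at hij'
            omega
        simp [ih j hj]
      · simp
    rw [map_sub, map_sub] at h1 h2
    rw [mul_sub, map_sub, map_sub] at h3
    simp only [Polynomial.eval_sub, ← hp, ← hr]
    linarith
  have := eq_zero_of_eval_add_one_eq_neg h z
  rw [Polynomial.eval_sub, ← hp, ← hr] at this
  linarith

/-- Comparing the terms linear in `z` of `thetaSum z = regTheta z`. -/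
lemma coeff_fineSum_zero (N : ℕ) : coeff N (fineSum 0) =
    -charSum (Polynomial.C (1 / 2) * (Polynomial.X *
      (qpowCoeff N).comp (Polynomial.C (1 / 24) * (Polynomial.X ^ 2 - 1)))) := by
  set A : Polynomial ℝ := Polynomial.C (1 / 24) * (Polynomial.X ^ 2 - 1) with hA
  set lam : ℝ⟦X⟧ := PowerSeries.mk fun n => (qpowCoeff n).coeff 1 with hlam
  set G : ℝ⟦X⟧ := PowerSeries.mk fun n =>
    charSum ((qpowCoeff n).comp A * (Polynomial.C (1 / 2) * (Polynomial.X - 1))) with hG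
  have hprod : lam * fineSum 0 = lam * (-G) := by
    ext n
    choose p hp using polyCoeff_fineSum
    obtain ⟨r, hr, hr'⟩ := charSum_thetaExp n
    obtain ⟨e, he⟩ : ∃ e : ℕ → ℝ, ∀ i, coeff i (1 : ℝ⟦X⟧) = e i := ⟨_, fun _ => rfl⟩
    have hpoly : ∑ x ∈ antidiagonal n,
        (Polynomial.C (e x.1) - qpowCoeff x.1) * p x.2 = r := by
      refine Polynomial.funext fun z => ?_
      rw [← hr, ← thetaSum_eq_regTheta, thetaSum, coeff_mul]
      simp [Polynomial.eval_finsetSum, hp, coeff_qpow, he, -coeff_one]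
    have h0 : ∀ i, (Polynomial.C (e i) - qpowCoeff i).coeff 0 = 0 := by
      intro i
      rw [Polynomial.coeff_zero_eq_eval_zero, Polynomial.eval_sub, ← coeff_qpow, qpow_zero, he]
      simp
    have h1 : ∀ i, (Polynomial.C (e i) - qpowCoeff i).coeff 1 =
        -coeff i lam := by
      intro i
      simp [hlam]
    have h2 := congrArg (fun q => Polynomial.coeff q 1) hpoly
    simp only [Polynomial.finsetSum_coeff, Polynomial.mul_coeff_one, h0, h1, hr',
      Polynomial.coeff_zero_eq_eval_zero (p _), ← hp, zero_mul, zero_add] at h2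
    rw [mul_neg, map_neg, coeff_mul, coeff_mul]
    have h3 : ∑ x ∈ antidiagonal n, coeff x.1 lam * coeff x.2 G = ∑ x ∈ antidiagonal n,
        (qpowCoeff x.2).coeff 1 * charSum ((qpowCoeff x.1).comp A *
          (Polynomial.C (1 / 2) * (Polynomial.X - 1))) := by
      rw [← Finset.Nat.sum_antidiagonal_swap]
      simp [hlam, hG]
    rw [h3, hA, ← h2]
    simp
  have hne : lam ≠ 0 := by
    intro h
    have := congrArg (coeff 1) h
    simp [hlam, qpowCoeff] at this
  have hU := congrArg (coeff N) (mul_left_cancel₀ hne hprod)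
  have hz : charSum ((qpowCoeff N).comp A) = 0 := by
    have := congrArg (coeff N) (thetaSum_eq_regTheta 0)
    simpa [thetaSum, regTheta, thetaExp, hA] using this.symm
  rw [hU, map_neg, hG, coeff_mk]
  have e : (qpowCoeff N).comp A * (Polynomial.C (1 / 2) * (Polynomial.X - 1)) =
      Polynomial.C (1 / 2) * (Polynomial.X * (qpowCoeff N).comp A) +
        Polynomial.C (-(1 / 2)) * (qpowCoeff N).comp A := by
    rw [map_neg]; ring
  rw [e, charSum_add, charSum_C_mul (-(1 / 2)), hz, mul_zero, add_zero]

open Filter Topology in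
/-- The moments of `charSum` are asymptotically `(√3 / 3) (2 j + 1)! (6 / π) ^ (2 j + 2)`. -/
lemma exists_charSum_X_pow_odd : ∃ σ : ℕ → ℝ, ∃ M : ℝ, (∀ j, |σ j| ≤ M) ∧
    Tendsto σ atTop (𝓝 (√3 / 3)) ∧
    ∀ j, (-1) ^ (j + 1) * charSum (Polynomial.X ^ (2 * j + 1)) =
      (2 * j + 1).factorial * (6 / Real.pi) ^ (2 * j + 2) * σ j := by
  set κ : ℕ → ℝ := fun n => Real.cos (2 * Real.pi * n * (1 / 12))
    - Real.cos (2 * Real.pi * n * (5 / 12)) - Real.cos (2 * Real.pi * n * (7 / 12))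
    + Real.cos (2 * Real.pi * n * (11 / 12)) with hκ
  have hκ4 : ∀ n, |κ n| ≤ 4 := by
    intro n
    have h := fun x : ℝ => Real.abs_cos_le_one (2 * Real.pi * n * x)
    have h1 := abs_le.1 (h (1 / 12))
    have h2 := abs_le.1 (h (5 / 12))
    have h3 := abs_le.1 (h (7 / 12))
    have h4 := abs_le.1 (h (11 / 12))
    rw [abs_le]
    constructor <;> simp only [hκ] <;> linarith
  have hκ1 : κ 1 = 2 * √3 := by
    have e1 : 2 * Real.pi * ((1 : ℕ) : ℝ) * (1 / 12) = Real.pi / 6 := by push_cast; ring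
    have e2 : 2 * Real.pi * ((1 : ℕ) : ℝ) * (5 / 12) = Real.pi - Real.pi / 6 := by
      push_cast; ring
    have e3 : 2 * Real.pi * ((1 : ℕ) : ℝ) * (7 / 12) = Real.pi / 6 + Real.pi := by
      push_cast; ring
    have e4 : 2 * Real.pi * ((1 : ℕ) : ℝ) * (11 / 12) = 2 * Real.pi - Real.pi / 6 := by
      push_cast; ring
    simp only [hκ]
    rw [e1, e2, e3, e4, Real.cos_pi_sub, Real.cos_add_pi, Real.cos_two_pi_sub,
      Real.cos_pi_div_six]
    ring
  set t : ℕ → ℕ → ℝ := fun j n => 1 / (n : ℝ) ^ (2 * (j + 1)) * κ n with ht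
  set bd : ℕ → ℝ := fun n => 4 * (1 / (n : ℝ) ^ 2) with hbd
  have hbds : Summable bd := (Real.summable_one_div_nat_pow.2 one_lt_two).mul_left 4
  have htb : ∀ j n, ‖t j n‖ ≤ bd n := by
    intro j n
    simp only [ht, hbd]
    rw [Real.norm_eq_abs, abs_mul, mul_comm (4 : ℝ)]
    refine mul_le_mul ?_ (hκ4 n) (abs_nonneg _) (by positivity)
    rw [abs_of_nonneg (by positivity)]
    rcases Nat.eq_zero_or_pos n with h0 | h0
    · simp [h0]
    · refine one_div_le_one_div_of_le (by positivity) ?_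
      exact pow_le_pow_right₀ (by exact_mod_cast h0) (by omega)
  have hlim : Tendsto (fun j => ∑' n, t j n) atTop (𝓝 (2 * √3)) := by
    have := tendsto_tsum_of_dominated_convergence (𝓕 := atTop) (f := t)
      (g := fun n => if n = 1 then 2 * √3 else 0) hbds (fun n => ?_)
      (Eventually.of_forall htb)
    · simpa using this
    · by_cases h1 : n = 1
      · subst h1
        simp [ht, hκ1]
      · rcases Nat.eq_zero_or_pos n with h0 | h0
        · subst h0
          simp [ht]
        · have hn : (1 : ℝ) < n := by
            have : 1 < n := by omega
            exact_mod_cast this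
          have h2 : Tendsto (fun j : ℕ => ((1 / (n : ℝ)) ^ (2 * (j + 1)))) atTop (𝓝 0) := by
            refine (tendsto_pow_atTop_nhds_zero_of_lt_one (by positivity) ?_).comp
              (tendsto_atTop_mono (fun j => (by omega : j ≤ 2 * (j + 1))) tendsto_id)
            rw [div_lt_one (by positivity)]
            exact hn
          have h3 := h2.mul_const (κ n)
          simpa [ht, h1] using h3
  refine ⟨fun j => 1 / 6 * ∑' n, t j n, 1 / 6 * ∑' n, bd n, fun j => ?_, ?_, fun j => ?_⟩
  · rw [abs_mul, abs_of_pos (by norm_num : (0 : ℝ) < 1 / 6)]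
    exact mul_le_mul_of_nonneg_left (tsum_of_norm_bounded hbds.hasSum (htb j)) (by norm_num)
  · convert hlim.const_mul (1 / 6) using 2
    ring
  · have hs : ∀ x : ℝ, x ∈ Set.Icc (0 : ℝ) 1 → _ := fun x hx =>
      hasSum_one_div_nat_pow_mul_cos (k := j + 1) (by omega) hx
    have h1 := (((hs (1 / 12) (by norm_num)).sub (hs (5 / 12) (by norm_num))).sub
      (hs (7 / 12) (by norm_num))).add (hs (11 / 12) (by norm_num))
    have h2 := (tsum_congr fun n => (by simp only [ht, hκ]; ring : t j n = _)).trans h1.tsum_eq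
    have hX : ((Polynomial.X : Polynomial ℝ) ^ (2 * j + 1)).comp (12 * Polynomial.X) =
        ((12 : ℝ) ^ (2 * j + 1)) • Polynomial.X ^ (2 * j + 1) := by
      rw [Polynomial.X_pow_comp, mul_pow, Polynomial.smul_eq_C_mul, map_pow]
      rfl
    have hfac : ((2 * (j + 1)).factorial : ℝ) = (2 * j + 2) * (2 * j + 1).factorial := by
      rw [show 2 * (j + 1) = (2 * j + 1) + 1 by ring, Nat.factorial_succ]
      push_cast; ring
    beta_reduce
    rw [h2, charSum, hX, map_smul, antidiff_X_pow, hfac, show 2 * j + 1 + 1 = 2 * (j + 1) by ring]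
    simp only [Polynomial.eval_smul, smul_eq_mul]
    have hpi := Real.pi_ne_zero
    have hf : ((2 * j + 1).factorial : ℝ) ≠ 0 := by positivity
    have hj : (2 * (j : ℝ) + 2) ≠ 0 := by positivity
    have hj' : (((2 * j + 1 : ℕ) : ℝ) + 1) ≠ 0 := by positivity
    have e12 : (12 : ℝ) ^ (2 * j + 1) = 6 ^ (2 * j + 1) * 2 ^ (2 * j + 1) := by
      rw [← mul_pow]; norm_num
    have hsq : ((-1 : ℝ) ^ j) ^ 2 = 1 := by rw [← pow_mul, mul_comm, pow_mul]; simp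
    rw [e12, div_pow, mul_pow, mul_add 2 j 1, mul_one]
    push_cast
    field_simp
    ring

/-- The elementary symmetric functions of `24 i + 1`, `i < N`. -/
noncomputable def shiftedStirling : ℕ → ℕ → ℝ
  | _, 0 => 1
  | 0, _ + 1 => 0
  | N + 1, r + 1 => shiftedStirling N (r + 1) + (24 * N + 1) * shiftedStirling N r

lemma shiftedStirling_eq_zero {N r : ℕ} (h : N < r) : shiftedStirling N r = 0 := by
  induction N generalizing r with
  | zero =>
    obtain ⟨r, rfl⟩ := Nat.exists_eq_succ_of_ne_zero h.ne'
    simp [shiftedStirling]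
  | succ N ih =>
    obtain ⟨r, rfl⟩ := Nat.exists_eq_succ_of_ne_zero (by omega : r ≠ 0)
    rw [Nat.succ_eq_add_one, shiftedStirling, ih (by omega), ih (by omega)]
    simp

lemma shiftedStirling_zero_right (N : ℕ) : shiftedStirling N 0 = 1 := by
  cases N <;> simp [shiftedStirling]

lemma prod_add_eq_sum_shiftedStirling (Y : Polynomial ℝ) (N : ℕ) :
    ∏ i ∈ range N, (Polynomial.C (24 * (i : ℝ) + 1) + Y) =
      ∑ r ∈ range (N + 1), Polynomial.C (shiftedStirling N r) * Y ^ (N - r) := by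
  induction N with
  | zero => simp [shiftedStirling]
  | succ N ih =>
    have hY : (∑ r ∈ range (N + 1), Polynomial.C (shiftedStirling N r) * Y ^ (N - r)) * Y =
        ∑ r ∈ range (N + 1), Polynomial.C (shiftedStirling N (r + 1)) * Y ^ (N - r) +
          Y ^ (N + 1) := by
      have h := sum_range_succ' (fun r => Polynomial.C (shiftedStirling N r) * Y ^ (N + 1 - r))
        (N + 1)
      rw [sum_range_succ, shiftedStirling_eq_zero (Nat.lt_succ_self N), map_zero, zero_mul,
        add_zero, shiftedStirling_zero_right, map_one, one_mul, Nat.sub_zero] at h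
      simp only [Nat.add_sub_add_right] at h
      rw [← h, sum_mul]
      refine sum_congr rfl fun r hr => ?_
      have := mem_range.1 hr
      rw [mul_assoc, ← pow_succ]
      congr 2
      omega
    rw [prod_range_succ, ih, mul_add, hY, sum_range_succ' _ (N + 1)]
    simp only [shiftedStirling, Nat.add_sub_add_right, map_add (Polynomial.C) (shiftedStirling _ _),
      add_mul, sum_add_distrib, map_one, one_mul, Nat.sub_zero]
    rw [← add_assoc, add_comm (_ * _), sum_mul]
    congr 2
    refine sum_congr rfl fun r _ => ?_
    simp only [map_add, map_mul, map_one]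
    ring

lemma shiftedStirling_nonneg (N r : ℕ) : 0 ≤ shiftedStirling N r := by
  induction N generalizing r with
  | zero => cases r <;> simp [shiftedStirling]
  | succ N ih =>
    cases r with
    | zero => simp [shiftedStirling]
    | succ r =>
      rw [shiftedStirling]
      have := ih r
      have := ih (r + 1)
      positivity

lemma pow_succ_add_mul_le {a b : ℝ} (ha : 0 ≤ a) (hb : 0 ≤ b) (r : ℕ) :
    a ^ (r + 1) + (r + 1) * a ^ r * b ≤ (a + b) ^ (r + 1) := by
  induction r with
  | zero => simp
  | succ r ih =>
    rw [pow_succ (a + b)]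
    have h := mul_le_mul_of_nonneg_right ih (add_nonneg ha hb)
    refine le_trans ?_ h
    have : 0 ≤ (r + 1) * a ^ r * b * b := by positivity
    push_cast
    rw [pow_succ a (r + 1), pow_succ a r]
    nlinarith

lemma shiftedStirling_le (N r : ℕ) :
    shiftedStirling N r ≤ (12 * (N : ℝ) ^ 2) ^ r / r.factorial := by
  induction N generalizing r with
  | zero => cases r <;> simp [shiftedStirling]
  | succ N ih =>
    cases r with
    | zero => simp [shiftedStirling]
    | succ r =>
      rw [shiftedStirling]
      have h1 := ih r
      have h2 := ih (r + 1)
      have h3 := mul_le_mul_of_nonneg_left h1 (by positivity : (0 : ℝ) ≤ 24 * N + 1)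
      have h4 := pow_succ_add_mul_le (by positivity : (0 : ℝ) ≤ 12 * (N : ℝ) ^ 2)
        (by positivity : (0 : ℝ) ≤ 24 * N + 12) r
      refine (add_le_add h2 h3).trans ?_
      rw [Nat.factorial_succ, le_div_iff₀ (by positivity)]
      have hr : (r.factorial : ℝ) ≠ 0 := by positivity
      push_cast
      calc ((12 * (N : ℝ) ^ 2) ^ (r + 1) / ((r + 1) * r.factorial) +
            (24 * N + 1) * ((12 * (N : ℝ) ^ 2) ^ r / r.factorial)) * ((r + 1) * r.factorial)
          = (12 * (N : ℝ) ^ 2) ^ (r + 1) + (r + 1) * (12 * (N : ℝ) ^ 2) ^ r * (24 * N + 1) := by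
            field_simp
        _ ≤ (12 * (N : ℝ) ^ 2) ^ (r + 1) + (r + 1) * (12 * (N : ℝ) ^ 2) ^ r * (24 * N + 12) := by
            gcongr
            norm_num
        _ ≤ _ := h4.trans (le_of_eq (by ring))

lemma le_shiftedStirling (N r : ℕ) (h : r ≤ N) :
    (12 * ((N : ℝ) - r) ^ 2) ^ r / r.factorial ≤ shiftedStirling N r := by
  induction N generalizing r with
  | zero =>
    obtain rfl : r = 0 := by omega
    simp [shiftedStirling]
  | succ N ih =>
    cases r with
    | zero => simp [shiftedStirling]
    | succ r =>
      rw [shiftedStirling]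
      have h1 := ih r (by omega)
      have h0 := shiftedStirling_nonneg N (r + 1)
      have hrN : (r : ℝ) ≤ N := by exact_mod_cast (by omega : r ≤ N)
      set y : ℝ := (N : ℝ) - r with hy
      have hy0 : 0 ≤ y := by linarith
      have hyN : y ≤ N := by simp [hy]
      have e : ((N + 1 : ℕ) : ℝ) - ((r + 1 : ℕ) : ℝ) = y := by push_cast; simp [hy]
      rw [e]
      have h2 : (12 * (y - 1) ^ 2) ^ (r + 1) / (r + 1).factorial ≤ shiftedStirling N (r + 1) ∨
          y = 0 := by
        rcases Nat.lt_or_ge r N with hlt | hge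
        · left
          have := ih (r + 1) hlt
          push_cast at this
          rwa [show (N : ℝ) - (r + 1) = y - 1 by rw [hy]; ring] at this
        · right
          have : r = N := by omega
          simp [hy, this]
      rcases h2 with h2 | h2
      · have hy1 : 0 ≤ y := hy0
        have hB : y ^ (2 * r + 2) ≤ (y - 1) ^ (2 * r + 2) + (2 * r + 2) * y ^ (2 * r) * N := by
          rcases hy0.eq_or_lt with hz | hpos
          · rw [← hz]
            have : (0 : ℝ) ≤ (0 - 1) ^ (2 * r + 2) := Even.pow_nonneg (by simp [parity_simps]) _
            have h3 : (0 : ℝ) ≤ (2 * r + 2) * 0 ^ (2 * r) * N := by positivity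
            rw [zero_pow (by omega)]
            linarith
          · have hb := one_add_mul_sub_le_pow (a := (y - 1) / y) (n := 2 * r + 2) (by
              have h1y : 1 ≤ y := by
                have : r < N := by
                  have : (r : ℝ) < N := by linarith
                  exact_mod_cast this
                have : (r : ℝ) + 1 ≤ N := by exact_mod_cast this
                linarith
              rw [le_div_iff₀ hpos]; linarith)
            have h3 := mul_le_mul_of_nonneg_right hb (by positivity : 0 ≤ y ^ (2 * r + 2))
            rw [← mul_pow, div_mul_cancel₀ _ hpos.ne'] at h3
            have e2 : (1 + ((2 * r + 2 : ℕ) : ℝ) * ((y - 1) / y - 1)) * y ^ (2 * r + 2) =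
                y ^ (2 * r + 2) - (2 * r + 2) * y ^ (2 * r) * y := by
              push_cast
              field_simp
              ring
            rw [e2] at h3
            have : (2 * (r : ℝ) + 2) * y ^ (2 * r) * y ≤ (2 * r + 2) * y ^ (2 * r) * N := by
              gcongr
            linarith
        have h3 := mul_le_mul_of_nonneg_left h1 (by positivity : (0 : ℝ) ≤ 24 * N + 1)
        refine le_trans ?_ (add_le_add h2 h3)
        rw [Nat.factorial_succ, div_le_iff₀ (by positivity)]
        have hr : (r.factorial : ℝ) ≠ 0 := by positivity
        push_cast
        have e3 : ((12 * (y - 1) ^ 2) ^ (r + 1) / ((r + 1) * r.factorial) +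
            (24 * N + 1) * ((12 * y ^ 2) ^ r / r.factorial)) * ((r + 1) * r.factorial)
          = 12 ^ (r + 1) * ((y - 1) ^ (2 * r + 2) + (2 * r + 2) * y ^ (2 * r) * N) +
            (r + 1) * (12 * y ^ 2) ^ r := by
          simp only [mul_pow, ← pow_mul]
          field_simp
          ring
        rw [e3]
        have h4 := mul_le_mul_of_nonneg_left hB (by positivity : (0 : ℝ) ≤ 12 ^ (r + 1))
        have h5 : (0 : ℝ) ≤ (r + 1) * (12 * y ^ 2) ^ r := by positivity
        have e4 : (12 * y ^ 2) ^ (r + 1) = 12 ^ (r + 1) * y ^ (2 * r + 2) := by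
          rw [mul_pow, ← pow_mul]; ring
        linarith
      · rw [h2]
        have := shiftedStirling_nonneg N r
        have h5 : 0 ≤ (24 * (N : ℝ) + 1) * shiftedStirling N r := by positivity
        simp
        linarith

lemma coeff_fineSum_zero_eq_sum (N : ℕ) : coeff N (fineSum 0) =
    1 / (2 * N.factorial * 24 ^ N) * ∑ r ∈ range (N + 1), shiftedStirling N r *
      ((-1) ^ (N - r + 1) * charSum (Polynomial.X ^ (2 * (N - r) + 1))) := by
  rw [coeff_fineSum_zero]
  have h : Polynomial.C (1 / 2 : ℝ) * (Polynomial.X * (qpowCoeff N).comp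
      (Polynomial.C (1 / 24) * (Polynomial.X ^ 2 - 1))) =
      Polynomial.C (1 / (2 * (N.factorial : ℝ) * 24 ^ N)) * ∑ r ∈ range (N + 1),
        Polynomial.C (shiftedStirling N r * (-1) ^ (N - r)) *
          Polynomial.X ^ (2 * (N - r) + 1) := by
    have e : (qpowCoeff N).comp (Polynomial.C (1 / 24) * (Polynomial.X ^ 2 - 1)) =
        Polynomial.C ((N.factorial : ℝ)⁻¹ * (1 / 24) ^ N) *
          ∏ i ∈ range N, (Polynomial.C (24 * (i : ℝ) + 1) + -Polynomial.X ^ 2) := by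
      refine Polynomial.funext fun y => ?_
      simp only [qpowCoeff, Polynomial.eval_comp, Polynomial.eval_mul, Polynomial.eval_prod,
        Polynomial.eval_C, Polynomial.eval_sub, Polynomial.eval_X, Polynomial.eval_pow,
        Polynomial.eval_one, Polynomial.eval_add, Polynomial.eval_neg]
      rw [mul_assoc]
      congr 1
      have : ((1 : ℝ) / 24) ^ N = ∏ _i ∈ range N, (1 / 24 : ℝ) := by simp
      rw [this, ← prod_mul_distrib]
      refine prod_congr rfl fun i _ => ?_
      ring
    rw [e, prod_add_eq_sum_shiftedStirling, mul_sum, mul_sum, mul_sum, mul_sum]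
    refine sum_congr rfl fun r _ => ?_
    refine Polynomial.funext fun y => ?_
    simp only [Polynomial.eval_mul, Polynomial.eval_C, Polynomial.eval_X, Polynomial.eval_pow,
      Polynomial.eval_neg]
    rw [neg_pow (y ^ 2), ← pow_mul, one_div_pow 24 N]
    field_simp
    ring
  rw [h, charSum_C_mul, charSum_sum, ← mul_neg, ← sum_neg_distrib]
  congr 1
  refine sum_congr rfl fun r _ => ?_
  rw [charSum_C_mul]
  ring

lemma div_exp_pow_le_descFactorial {m k : ℕ} (h : k ≤ m) :
    (m / Real.exp 1) ^ k ≤ (m.descFactorial k : ℝ) := by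
  induction m generalizing k with
  | zero =>
    obtain rfl : k = 0 := by omega
    simp
  | succ m ih =>
    cases k with
    | zero => simp
    | succ k =>
      have hk : k ≤ m := by omega
      rw [Nat.succ_descFactorial_succ]
      have h1 : ((m : ℝ) + 1) ^ k ≤ Real.exp 1 * m ^ k := by
        rcases Nat.eq_zero_or_pos m with rfl | hm
        · obtain rfl : k = 0 := by omega
          simp
        · have hm' : (0 : ℝ) < m := by exact_mod_cast hm
          have h2 : (1 + 1 / (m : ℝ)) ^ k ≤ Real.exp 1 := by
            calc (1 + 1 / (m : ℝ)) ^ k ≤ Real.exp (1 / m) ^ k := by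
                  gcongr
                  rw [add_comm]
                  exact Real.add_one_le_exp _
              _ = Real.exp (k * (1 / m)) := (Real.exp_nat_mul _ _).symm
              _ ≤ _ := by
                  rw [Real.exp_le_exp, mul_one_div, div_le_one hm']
                  exact_mod_cast hk
          calc ((m : ℝ) + 1) ^ k = (1 + 1 / (m : ℝ)) ^ k * m ^ k := by
                rw [← mul_pow]
                congr 1
                field_simp
            _ ≤ _ := by gcongr
      have h3 := ih hk
      push_cast
      calc (((m : ℝ) + 1) / Real.exp 1) ^ (k + 1)
          = ((m : ℝ) + 1) * (((m : ℝ) + 1) ^ k / (Real.exp 1 * Real.exp 1 ^ k)) := by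
            rw [div_pow, pow_succ, pow_succ]
            field_simp
        _ ≤ ((m : ℝ) + 1) * (Real.exp 1 * m ^ k / (Real.exp 1 * Real.exp 1 ^ k)) := by gcongr
        _ = ((m : ℝ) + 1) * (m / Real.exp 1) ^ k := by
            rw [div_pow, mul_div_mul_left _ _ (Real.exp_ne_zero 1)]
        _ ≤ _ := by gcongr

section

open Filter Topology

lemma tendsto_natCast_sub_div (k : ℕ) :
    Tendsto (fun N : ℕ => ((N : ℝ) - k) / N) atTop (𝓝 1) := by
  have h := (tendsto_const_div_atTop_nhds_zero_nat (k : ℝ)).const_sub 1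
  rw [sub_zero] at h
  refine h.congr' ?_
  filter_upwards [eventually_gt_atTop 0] with N hN
  have : (N : ℝ) ≠ 0 := by positivity
  field_simp

lemma tendsto_descFactorial_div (k : ℕ) :
    Tendsto (fun N : ℕ => ((2 * N + 1).descFactorial k : ℝ) / (N : ℝ) ^ k) atTop
      (𝓝 (2 ^ k)) := by
  induction k with
  | zero => simp
  | succ k ih =>
    have h1 : Tendsto (fun N : ℕ => ((2 * N + 1 - k : ℕ) : ℝ) / N) atTop (𝓝 2) := by
      have h := ((tendsto_const_div_atTop_nhds_zero_nat (1 - k : ℝ)).const_add 2)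
      rw [add_zero] at h
      refine h.congr' ?_
      filter_upwards [eventually_gt_atTop k] with N hN
      have : (N : ℝ) ≠ 0 := by
        have : 0 < N := by omega
        positivity
      rw [Nat.cast_sub (by omega)]
      push_cast
      field_simp
      ring
    rw [pow_succ']
    refine (h1.mul ih).congr fun N => ?_
    rw [Nat.descFactorial_succ, pow_succ']
    push_cast
    rw [div_mul_div_comm]

lemma tendsto_shiftedStirling_div (r : ℕ) :
    Tendsto (fun N : ℕ => shiftedStirling N r / (N : ℝ) ^ (2 * r)) atTop
      (𝓝 ((12 : ℝ) ^ r / r.factorial)) := by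
  have h1 : Tendsto (fun N : ℕ => (12 * (((N : ℝ) - r) / N) ^ 2) ^ r / r.factorial) atTop
      (𝓝 ((12 : ℝ) ^ r / r.factorial)) := by
    simpa using ((((tendsto_natCast_sub_div r).pow 2).const_mul 12).pow r).div_const
      (r.factorial : ℝ)
  refine tendsto_of_tendsto_of_tendsto_of_le_of_le' h1 tendsto_const_nhds ?_ ?_
  · filter_upwards [eventually_gt_atTop r] with N hN
    have hN0 : 0 < N := by omega
    rw [le_div_iff₀ (by positivity)]
    refine le_trans (le_of_eq ?_) (le_shiftedStirling N r hN.le)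
    have : (N : ℝ) ≠ 0 := by positivity
    rw [pow_mul, div_mul_eq_mul_div, ← mul_pow]
    congr 2
    field_simp
  · filter_upwards [eventually_gt_atTop r] with N hN
    have hN0 : 0 < N := by omega
    rw [div_le_iff₀ (by positivity)]
    refine (shiftedStirling_le N r).trans (le_of_eq ?_)
    rw [pow_mul, div_mul_eq_mul_div, ← mul_pow]

lemma tendsto_factorial_ratio :
    Tendsto (fun N : ℕ => ((2 * N + 1).factorial : ℝ) /
      ((N.factorial : ℝ) ^ 2 * 4 ^ N * √N)) atTop (𝓝 (2 / √Real.pi)) := by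
  have hp : √Real.pi ≠ 0 := (Real.sqrt_pos.2 Real.pi_pos).ne'
  have hs := Stirling.tendsto_stirlingSeq_sqrt_pi
  have h2 : Tendsto (fun N : ℕ => 2 * N) atTop atTop :=
    tendsto_atTop_mono (fun N => (by omega : N ≤ 2 * N)) tendsto_id
  have h3 := (hs.comp h2).div (hs.pow 2) (pow_ne_zero 2 hp)
  have h4 := h3.mul ((tendsto_const_div_atTop_nhds_zero_nat (1 : ℝ)).const_add 2)
  have e : √Real.pi / √Real.pi ^ 2 * (2 + 0) = 2 / √Real.pi := by
    field_simp
    ring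
  rw [e] at h4
  refine h4.congr' ?_
  filter_upwards [eventually_gt_atTop 0] with N hN
  have hN' : (N : ℝ) ≠ 0 := by positivity
  have hs0 : √(N : ℝ) ≠ 0 := by positivity
  have hsq : √(N : ℝ) ^ 2 = N := Real.sq_sqrt (by positivity)
  have e1 : √(2 * ((2 * N : ℕ) : ℝ)) = 2 * √N := by
    rw [show 2 * ((2 * N : ℕ) : ℝ) = 2 ^ 2 * N by push_cast; ring, Real.sqrt_mul (by norm_num),
      Real.sqrt_sq (by norm_num)]
  have e2 : √(2 * (N : ℝ)) ^ 2 = 2 * N := Real.sq_sqrt (by positivity)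
  have e4 : (4 : ℝ) ^ N = 2 ^ (2 * N) := by rw [pow_mul]; norm_num
  have hf : (N.factorial : ℝ) ≠ 0 := by positivity
  simp only [Function.comp_apply, Pi.div_apply, Stirling.stirlingSeq]
  rw [e1, div_pow (N.factorial : ℝ), mul_pow, e2, Nat.factorial_succ, e4, ← pow_mul, mul_comm N 2,
    div_pow, div_pow]
  push_cast
  rw [mul_pow]
  have he := Real.exp_ne_zero 1
  field_simp

lemma tendsto_coeff_fineSum : Tendsto (fun N : ℕ => coeff N (fineSum 0) /
      ((N.factorial : ℝ) * √N * (6 / Real.pi ^ 2) ^ N)) atTop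
      (𝓝 (12 * √3 / Real.pi ^ ((5 : ℝ) / 2) * Real.exp (Real.pi ^ 2 / 12))) := by
  obtain ⟨σ, M, hM, hσ, hchar⟩ := exists_charSum_X_pow_odd
  set a : ℕ → ℕ → ℝ := fun N r =>
    shiftedStirling N r / (2 * N + 1).descFactorial (2 * r) * (Real.pi / 6) ^ (2 * r) *
      σ (N - r) with ha
  set bd : ℕ → ℝ := fun r => (3 * Real.exp 1 ^ 2 * (Real.pi / 6) ^ 2) ^ r / r.factorial * M
    with hbd
  have hpi := Real.pi_ne_zero
  have hlim : Tendsto (fun N => ∑' r, a N r) atTop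
      (𝓝 (∑' r : ℕ, 12 ^ r / r.factorial / 2 ^ (2 * r) * (Real.pi / 6) ^ (2 * r) * (√3 / 3))) := by
    refine tendsto_tsum_of_dominated_convergence (bound := bd)
      ((Real.summable_pow_div_factorial _).mul_right M) (fun r => ?_) ?_
    · have h1 := (tendsto_shiftedStirling_div r).div (tendsto_descFactorial_div (2 * r))
        (by positivity)
      have h2 : Tendsto (fun N => σ (N - r)) atTop (𝓝 (√3 / 3)) :=
        hσ.comp (tendsto_sub_atTop_nat r)
      refine ((h1.mul_const ((Real.pi / 6) ^ (2 * r))).mul h2).congr' ?_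
      filter_upwards [eventually_gt_atTop 0] with N hN
      simp only [ha, Pi.div_apply]
      rw [div_div_div_cancel_right₀ (by positivity)]
    · filter_upwards [eventually_gt_atTop 0] with N hN r
      rcases Nat.lt_or_ge N r with h | h
      · simp only [ha, shiftedStirling_eq_zero h, zero_div, zero_mul, norm_zero, hbd]
        have : 0 ≤ M := (abs_nonneg _).trans (hM 0)
        positivity
      · have hE := shiftedStirling_nonneg N r
        have hd := div_exp_pow_le_descFactorial (by omega : 2 * r ≤ 2 * N + 1)
        have hexp := Real.exp_pos 1
        have hb : (0 : ℝ) < (((2 * N + 1 : ℕ) : ℝ) / Real.exp 1) ^ (2 * r) := by positivity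
        have hb' : (0 : ℝ) < (2 * N / Real.exp 1) ^ (2 * r) := by positivity
        have hb2 : (2 * N / Real.exp 1) ^ (2 * r) ≤
            (((2 * N + 1 : ℕ) : ℝ) / Real.exp 1) ^ (2 * r) := by
          push_cast
          gcongr
          linarith
        simp only [ha, hbd]
        rw [Real.norm_eq_abs, abs_mul]
        refine mul_le_mul ?_ (hM _) (abs_nonneg _) (by positivity)
        rw [abs_of_nonneg (by positivity)]
        calc shiftedStirling N r / ((2 * N + 1).descFactorial (2 * r) : ℝ) *
              (Real.pi / 6) ^ (2 * r)
            ≤ ((12 * (N : ℝ) ^ 2) ^ r / r.factorial) / (2 * N / Real.exp 1) ^ (2 * r) *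
              (Real.pi / 6) ^ (2 * r) := by
              gcongr
              · exact shiftedStirling_le N r
              · exact hb2.trans hd
          _ = _ := by
              have hN' : (N : ℝ) ≠ 0 := by positivity
              rw [pow_mul, pow_mul, div_div, mul_comm (r.factorial : ℝ), ← div_div, ← div_pow,
                div_mul_eq_mul_div, ← mul_pow]
              congr 2
              field_simp
              ring
  have hsum : ∑' r : ℕ, 12 ^ r / r.factorial / 2 ^ (2 * r) * (Real.pi / 6) ^ (2 * r) * (√3 / 3) =
      √3 / 3 * Real.exp (Real.pi ^ 2 / 12) := by
    rw [tsum_mul_right, mul_comm, Real.exp_eq_exp_ℝ, NormedSpace.exp_eq_tsum_div]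
    congr 1
    refine tsum_congr fun r => ?_
    rw [pow_mul, pow_mul, div_right_comm, div_mul_eq_mul_div, ← div_pow, ← mul_pow]
    congr 2
    ring
  rw [hsum] at hlim
  have key : ∀ N : ℕ, coeff N (fineSum 0) =
      (2 * N + 1).factorial * (6 / Real.pi) ^ (2 * N + 2) / (2 * N.factorial * 24 ^ N) *
        ∑' r, a N r := by
    intro N
    rw [tsum_eq_sum (s := range (N + 1)), coeff_fineSum_zero_eq_sum, mul_sum, mul_sum]
    · refine sum_congr rfl fun r hr => ?_
      have hr' : r ≤ N := by
        have := mem_range.1 hr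
        omega
      have hf := Nat.factorial_mul_descFactorial (by omega : 2 * r ≤ 2 * N + 1)
      rw [show 2 * N + 1 - 2 * r = 2 * (N - r) + 1 by omega] at hf
      have hd : ((2 * N + 1).descFactorial (2 * r) : ℝ) ≠ 0 := by
        have := Nat.descFactorial_pos.2 (by omega : 2 * r ≤ 2 * N + 1)
        positivity
      rw [hchar, ← hf, show 2 * N + 2 = 2 * (N - r) + 2 + 2 * r by omega, pow_add _ _ (2 * r)]
      simp only [ha]
      have e : (6 / Real.pi) ^ (2 * r) * (Real.pi / 6) ^ (2 * r) = 1 := by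
        rw [← mul_pow, div_mul_div_comm, mul_comm, div_self (by positivity), one_pow]
      push_cast
      calc _ = 1 / (2 * (N.factorial : ℝ) * 24 ^ N) * (shiftedStirling N r *
            ((2 * (N - r) + 1).factorial * (6 / Real.pi) ^ (2 * (N - r) + 2) * σ (N - r))) *
            ((6 / Real.pi) ^ (2 * r) * (Real.pi / 6) ^ (2 * r)) := by rw [e, mul_one]
        _ = _ := by
            generalize (6 / Real.pi) ^ (2 * r) = u
            generalize (Real.pi / 6) ^ (2 * r) = v
            generalize (6 / Real.pi) ^ (2 * (N - r) + 2) = w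
            field_simp
    · intro r hr
      have : N < r := by
        rw [mem_range] at hr
        omega
      simp [ha, shiftedStirling_eq_zero this]
  have hpre := (tendsto_factorial_ratio.mul_const (18 / Real.pi ^ 2)).mul hlim
  have hC : 2 / √Real.pi * (18 / Real.pi ^ 2) * (√3 / 3 * Real.exp (Real.pi ^ 2 / 12)) =
      12 * √3 / Real.pi ^ ((5 : ℝ) / 2) * Real.exp (Real.pi ^ 2 / 12) := by
    have : Real.pi ^ ((5 : ℝ) / 2) = Real.pi ^ 2 * √Real.pi := by
      rw [Real.sqrt_eq_rpow, show (5 : ℝ) / 2 = 2 + 1 / 2 by norm_num, Real.rpow_add Real.pi_pos]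
      norm_num
    rw [this]
    have : √Real.pi ≠ 0 := (Real.sqrt_pos.2 Real.pi_pos).ne'
    field_simp
    ring
  rw [hC] at hpre
  refine hpre.congr fun N => ?_
  rw [key]
  have e : (6 / Real.pi) ^ (2 * N + 2) = (6 / Real.pi ^ 2) ^ N * 6 ^ N * (36 / Real.pi ^ 2) := by
    rw [pow_add, pow_mul, ← mul_pow]
    congr 1
    · congr 1
      ring
    · ring
  have e2 : (24 : ℝ) ^ N = 6 ^ N * 4 ^ N := by rw [← mul_pow]; norm_num
  rw [e, e2]
  have h6 : ((6 : ℝ) / Real.pi ^ 2) ^ N ≠ 0 := by positivity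
  generalize ((6 : ℝ) / Real.pi ^ 2) ^ N = u at *
  field_simp
  ring

end

/-- The geometric series `1 / (1 - X)`. -/
noncomputable def geomSeries : ℝ⟦X⟧ := PowerSeries.mk 1

lemma geomSeries_mul : geomSeries * (1 - X) = 1 := PowerSeries.mk_one_mul_one_sub_eq_one ℝ

lemma geomSeries_pow_mul (c : ℕ) : geomSeries ^ c * (1 - X) ^ c = 1 := by
  rw [← mul_pow, geomSeries_mul, one_pow]

lemma X_dvd_geomSeries_pow_sub_one (c : ℕ) : (X : ℝ⟦X⟧) ∣ geomSeries ^ c - 1 := by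
  have h : constantCoeff geomSeries = (1 : ℝ) := by
    rw [← coeff_zero_eq_constantCoeff_apply, geomSeries, coeff_mk, Pi.one_apply]
  rw [X_dvd_iff]
  simp [h]

/-- The iterates on `1` of `φ ↦ (T ^ (c + 1) - 1) φ (c + 1) - (T ^ c - 1) φ c`, where
`T = 1 / (1 - X)`. -/
noncomputable def fishburnSeries : ℕ → ℕ → ℝ⟦X⟧
  | 0, _ => 1
  | k + 1, c => (geomSeries ^ (c + 1) - 1) * fishburnSeries k (c + 1) -
      (geomSeries ^ c - 1) * fishburnSeries k c

lemma X_pow_dvd_fishburnSeries (k c : ℕ) : (X : ℝ⟦X⟧) ^ k ∣ fishburnSeries k c := by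
  induction k generalizing c with
  | zero => simp
  | succ k ih =>
    rw [fishburnSeries, pow_succ']
    exact dvd_sub (mul_dvd_mul (X_dvd_geomSeries_pow_sub_one _) (ih _))
      (mul_dvd_mul (X_dvd_geomSeries_pow_sub_one _) (ih _))

lemma geomSeries_pow_mul_formalSum_fishburnSeries (c : ℕ) :
    geomSeries ^ c * formalSum (fun k => fishburnSeries k c) =
      1 + (1 - qpow (c + 1)) *
        (geomSeries ^ (c + 1) * formalSum fun k => fishburnSeries k (c + 1)) := by
  have hd := fun c k => X_pow_dvd_fishburnSeries k c
  have h := formalSum_succ (hd c)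
  simp only [fishburnSeries] at h
  rw [formalSum_sub, formalSum_mul_left _ (hd _), formalSum_mul_left _ (hd _)] at h
  have hq : qpow ((c : ℝ) + 1) = (1 - X) ^ (c + 1) := by
    rw [← qpow_natCast]
    push_cast
    rfl
  rw [hq]
  linear_combination h + formalSum (fun k => fishburnSeries k (c + 1)) *
    geomSeries_pow_mul (c + 1)

lemma formalSum_qPoch (c : ℕ) : formalSum (fun n => qPoch (c + 1) n) =
    1 + (1 - qpow (c + 1)) * formalSum fun n => qPoch ((c + 1 : ℕ) + 1) n := by
  rw [formalSum_succ (X_pow_dvd_qPoch _), ← formalSum_mul_left _ (X_pow_dvd_qPoch _)]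
  simp only [qPoch_succ']
  push_cast
  simp [qPoch]

lemma formalSum_fishburnSeries_zero :
    formalSum (fun k => fishburnSeries k 0) = fineSum 0 := by
  have h : ∀ J c, (X : ℝ⟦X⟧) ^ J ∣ geomSeries ^ c * formalSum (fun k => fishburnSeries k c) -
      formalSum fun n => qPoch (c + 1) n := by
    intro J
    induction J with
    | zero => simp
    | succ J ih =>
      intro c
      rw [geomSeries_pow_mul_formalSum_fishburnSeries, formalSum_qPoch, add_sub_add_left_eq_sub,
        ← mul_sub, pow_succ']
      exact mul_dvd_mul (X_dvd_one_sub_qpow _) (ih (c + 1))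
  have h0 : formalSum (fun k => fishburnSeries k 0) - fineSum 0 = 0 := by
    ext n
    have := X_pow_dvd_iff.1 (h (n + 1) 0) n (by omega)
    simpa [fineSum] using this
  exact sub_eq_zero.1 h0

lemma card_finsuppAntidiag_eq_coeff {ι : Type*} [DecidableEq ι] (s : Finset ι) (n : ℕ) :
    (#(finsuppAntidiag s n) : ℝ) = coeff n (geomSeries ^ #s) := by
  rw [← prod_const, coeff_prod]
  simp [geomSeries]

/-- The cells `(i, j)` with `i ≤ j` of a `k × k` matrix, those in the rows `R` and the columns `C`
being excluded. -/
def upperCells (k : ℕ) (R C : Finset ℕ) : Finset (ℕ × ℕ) :=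
  (range k ×ˢ range k).filter fun c => c.1 ≤ c.2 ∧ c.1 ∉ R ∧ c.2 ∉ C

lemma card_upperCells (k : ℕ) (R C : Finset ℕ) :
    #(upperCells k R C) = ∑ j ∈ range k \ C, #(range (j + 1) \ R) := by
  have h : ((upperCells k R C : Finset (ℕ × ℕ)) : Set (ℕ × ℕ)).MapsTo Prod.snd
      (range k \ C : Finset ℕ) := by
    intro c hc
    simp only [upperCells, coe_filter, mem_product, mem_range, Set.mem_ofPred_eq] at hc
    simp only [coe_sdiff, Set.mem_sdiff, mem_coe, mem_range]
    tauto
  rw [card_eq_sum_card_fiberwise h]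
  refine sum_congr rfl fun j hj => ?_
  rw [mem_sdiff, mem_range] at hj
  refine (card_bij (fun i _ => (i, j)) ?_ ?_ ?_).symm
  · intro i hi
    rw [mem_sdiff, mem_range] at hi
    simp only [upperCells, mem_filter, mem_product, mem_range]
    exact ⟨⟨⟨by omega, hj.1⟩, by omega, hi.2, hj.2⟩, trivial⟩
  · intro i _ i' _ h
    exact (Prod.mk.inj h).1
  · rintro ⟨i, j'⟩ hc
    simp only [upperCells, mem_filter, mem_product, mem_range] at hc
    obtain ⟨⟨-, hij, hR, -⟩, rfl⟩ := hc
    exact ⟨i, by simp only [mem_sdiff, mem_range]; exact ⟨by omega, hR⟩, rfl⟩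

/-- The upper triangular `k × k` matrices of natural numbers with sum `n` and without zero row or
column. -/
noncomputable def fishburnMatrices (k n : ℕ) : Finset (ℕ × ℕ →₀ ℕ) :=
  (finsuppAntidiag (upperCells k ∅ ∅) n).filter fun l =>
    (∀ i ∈ range k, ∃ j, l (i, j) ≠ 0) ∧ ∀ j ∈ range k, ∃ i, l (i, j) ≠ 0

lemma filter_finsuppAntidiag_upperCells (k n : ℕ) (R C : Finset ℕ) :
    (finsuppAntidiag (upperCells k ∅ ∅) n).filter (fun l =>
      (∀ i ∈ R, ∀ j, l (i, j) = 0) ∧ ∀ j ∈ C, ∀ i, l (i, j) = 0) =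
    finsuppAntidiag (upperCells k R C) n := by
  ext l
  simp only [mem_filter, mem_finsuppAntidiag', and_assoc, subset_iff, Finsupp.mem_support_iff,
    upperCells, mem_product, Prod.forall, notMem_empty, not_false_eq_true, and_true]
  refine and_congr_right fun _ => ⟨fun ⟨h, hR, hC⟩ i j hij => ?_, fun h => ⟨fun i j hij => ?_,
    fun i hi j => ?_, fun j hj i => ?_⟩⟩
  · obtain ⟨h1, h2, h3⟩ := h i j hij
    exact ⟨h1, h2, h3, fun hi => hij (hR i hi j), fun hj => hij (hC j hj i)⟩
  · obtain ⟨h1, h2, h3, -⟩ := h i j hij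
    exact ⟨h1, h2, h3⟩
  · by_contra hij
    exact (h i j hij).2.2.2.1 hi
  · by_contra hij
    exact (h i j hij).2.2.2.2 hj

lemma prod_one_sub_boole {ι : Type*} (s : Finset ι) (p : ι → Prop) :
    (if ∀ i ∈ s, ¬ p i then (1 : ℝ) else 0) =
      ∑ t ∈ s.powerset, (-1) ^ #t * if ∀ i ∈ t, p i then (1 : ℝ) else 0 := by
  have h := prod_sub (fun _ => (1 : ℝ)) (fun i => if p i then (1 : ℝ) else 0) s
  simp only [prod_const_one, mul_one, prod_boole] at h
  rw [← h, ← prod_boole]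
  refine prod_congr rfl fun i _ => ?_
  split_ifs <;> simp_all

lemma card_fishburnMatrices_eq_sum (k n : ℕ) : (#(fishburnMatrices k n) : ℝ) =
    coeff n (∑ R ∈ (range k).powerset, (-1) ^ #R *
      ∏ j ∈ range k, (geomSeries ^ #(range (j + 1) \ R) - 1)) := by
  have h1 : ∀ l : ℕ × ℕ →₀ ℕ, (if (∀ i ∈ range k, ∃ j, l (i, j) ≠ 0) ∧
      ∀ j ∈ range k, ∃ i, l (i, j) ≠ 0 then (1 : ℝ) else 0) =
      ∑ R ∈ (range k).powerset, ∑ C ∈ (range k).powerset, (-1) ^ #R * (-1) ^ #C *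
        if (∀ i ∈ R, ∀ j, l (i, j) = 0) ∧ ∀ j ∈ C, ∀ i, l (i, j) = 0 then (1 : ℝ) else 0 := by
    intro l
    have hR := prod_one_sub_boole (range k) fun i => ∀ j, l (i, j) = 0
    have hC := prod_one_sub_boole (range k) fun j => ∀ i, l (i, j) = 0
    simp only [not_forall, ← ne_eq] at hR hC
    rw [← mul_one (1 : ℝ), ← ite_zero_mul_ite_zero, hR, hC, sum_mul_sum]
    refine sum_congr rfl fun R _ => sum_congr rfl fun C _ => ?_
    rw [mul_mul_mul_comm, ite_zero_mul_ite_zero, mul_one]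
  have h2 : ∀ R, ∏ j ∈ range k, (geomSeries ^ #(range (j + 1) \ R) - 1) =
      ∑ C ∈ (range k).powerset, (-1) ^ #C * geomSeries ^ #(upperCells k R C) := by
    intro R
    rw [prod_sub]
    refine sum_congr rfl fun C _ => ?_
    rw [prod_const_one, mul_one, card_upperCells, prod_pow_eq_pow_sum]
  have hc : ∀ (m : ℕ) (f : ℝ⟦X⟧), coeff n ((-1) ^ m * f) = (-1) ^ m * coeff n f := by
    intro m f
    rw [show (-1 : ℝ⟦X⟧) ^ m = C ((-1) ^ m) by simp, coeff_C_mul]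
  rw [fishburnMatrices, card_filter]
  push_cast
  simp only [h1, h2]
  rw [sum_comm, map_sum]
  refine sum_congr rfl fun R _ => ?_
  rw [hc, map_sum, mul_sum, sum_comm]
  refine sum_congr rfl fun C _ => ?_
  rw [hc, ← mul_sum, mul_assoc, ← card_finsuppAntidiag_eq_coeff,
    ← filter_finsuppAntidiag_upperCells k n R C, card_filter]
  push_cast
  rfl

lemma sum_powerset_eq_fishburnSeries (k m : ℕ) :
    ∑ R ∈ (range k).powerset, (-1) ^ #R *
      (∏ j ∈ range k, (geomSeries ^ #(range (j + 1) \ R) - 1)) *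
        fishburnSeries m #(range k \ R) = fishburnSeries (m + k) 0 := by
  induction k generalizing m with
  | zero => simp
  | succ k ih =>
    rw [range_add_one, sum_powerset_insert notMem_range_self, ← range_add_one, ← sum_add_distrib,
      show m + (k + 1) = (m + 1) + k by ring, ← ih]
    refine sum_congr rfl fun R hR => ?_
    have hR' := mem_powerset.1 hR
    have hk : k ∉ R := fun h => notMem_range_self (hR' h)
    have e1 : #(range (k + 1) \ R) = #(range k \ R) + 1 := by
      rw [range_add_one, insert_sdiff_of_notMem _ hk, card_insert_of_notMem (by simp)]
    have e2 : range (k + 1) \ insert k R = range k \ R := by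
      rw [range_add_one, insert_sdiff_insert, sdiff_insert_of_notMem notMem_range_self]
    have e3 : ∏ j ∈ range k, (geomSeries ^ #(range (j + 1) \ insert k R) - 1) =
        ∏ j ∈ range k, (geomSeries ^ #(range (j + 1) \ R) - 1) := by
      refine prod_congr rfl fun j hj => ?_
      rw [sdiff_insert_of_notMem]
      have := mem_range.1 hj
      simp only [mem_range]
      omega
    rw [prod_range_succ, prod_range_succ, e1, e2, e3, card_insert_of_notMem hk, fishburnSeries,
      pow_succ]
    ring

lemma card_fishburnMatrices (k n : ℕ) :
    (#(fishburnMatrices k n) : ℝ) = coeff n (fishburnSeries k 0) := by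
  rw [card_fishburnMatrices_eq_sum, ← Nat.zero_add k, ← sum_powerset_eq_fishburnSeries]
  simp [fishburnSeries]

lemma exists_card_filter_ssubset_eq {α : Type*} {𝒟 : Finset (Finset α)}
    (h : ∀ S ∈ 𝒟, ∀ S' ∈ 𝒟, S ⊆ S' ∨ S' ⊆ S) {v : ℕ} (hv : v < #𝒟) :
    ∃ S ∈ 𝒟, #(𝒟.filter (· ⊂ S)) = v := by
  have hlt : ∀ S ∈ 𝒟, ∀ S', S ⊂ S' → #(𝒟.filter (· ⊂ S)) < #(𝒟.filter (· ⊂ S')) := by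
    intro S hS S' hSS'
    refine card_lt_card ((ssubset_iff_of_subset fun U hU => ?_).2 ⟨S, ?_, ?_⟩)
    · rw [mem_filter] at hU ⊢
      exact ⟨hU.1, hU.2.trans hSS'⟩
    · exact mem_filter.2 ⟨hS, hSS'⟩
    · simp
  have hinj : Set.InjOn (fun S => #(𝒟.filter (· ⊂ S))) (𝒟 : Set (Finset α)) := by
    intro S hS S' hS' heq
    by_contra hne
    rcases h S hS S' hS' with hs | hs
    · exact (hlt S hS S' (hs.ssubset_of_ne hne)).ne heq
    · exact (hlt S' hS' S (hs.ssubset_of_ne (Ne.symm hne))).ne heq.symm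
  have himg : 𝒟.image (fun S => #(𝒟.filter (· ⊂ S))) = range #𝒟 := by
    refine eq_of_subset_of_card_le (fun w hw => ?_) ?_
    · obtain ⟨S, hS, rfl⟩ := mem_image.1 hw
      rw [mem_range]
      exact card_lt_card (filter_ssubset.2 ⟨S, hS, by simp⟩)
    · rw [card_image_of_injOn hinj, card_range]
  obtain ⟨S, hS, h⟩ := mem_image.1 (himg ▸ mem_range.2 hv)
  exact ⟨S, hS, h⟩

lemma exists_mem_forall_ssubset_notMem {α : Type*} {𝒟 : Finset (Finset α)}
    (h : ∀ S ∈ 𝒟, ∀ S' ∈ 𝒟, S ⊆ S' ∨ S' ⊆ S) {S : Finset α} (hS : S.Nonempty) :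
    ∃ x ∈ S, ∀ S' ∈ 𝒟, S' ⊂ S → x ∉ S' := by
  rcases (𝒟.filter (· ⊂ S)).eq_empty_or_nonempty with h0 | h0
  · obtain ⟨x, hx⟩ := hS
    exact ⟨x, hx, fun S' hS' hss => absurd hss (filter_eq_empty_iff.1 h0 hS')⟩
  · obtain ⟨U, hU, hmax⟩ := exists_max_image _ card h0
    rw [mem_filter] at hU
    obtain ⟨x, hx, hxU⟩ := exists_of_ssubset hU.2
    refine ⟨x, hx, fun S' hS' hss hxS' => ?_⟩
    rcases h S' hS' U hU.1 with hs | hs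
    · exact hxU (hs hxS')
    · exact hxU (eq_of_subset_of_card_le hs (hmax S' (mem_filter.2 ⟨hS', hss⟩)) ▸ hxS')

/-- The intervals `g x = [(g x).1, (g x).2]` represent the relation `r`, and both the left and the
right ends of these intervals take all values less than `k`. -/
structure IsRepresentation {α : Type*} (r : α → α → Prop) (k : ℕ) (g : α → ℕ × ℕ) : Prop where
  fst_le_snd : ∀ x, (g x).1 ≤ (g x).2
  snd_lt : ∀ x, (g x).2 < k
  exists_fst_eq : ∀ i < k, ∃ x, (g x).1 = i
  exists_snd_eq : ∀ j < k, ∃ x, (g x).2 = j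
  rel_iff : ∀ x y, r x y ↔ (g x).2 < (g y).1

section

variable {α : Type*} [Fintype α]

/-- The elements related to `y`. -/
noncomputable def downSet (r : α → α → Prop) (y : α) : Finset α := univ.filter (r · y)

@[simp] lemma mem_downSet {r : α → α → Prop} {x y : α} : x ∈ downSet r y ↔ r x y := by
  simp [downSet]

lemma downSet_ssubset {r : α → α → Prop} [IsStrictOrder α r] {x y : α} (h : r x y) :
    downSet r x ⊂ downSet r y := by
  refine (ssubset_iff_of_subset fun z hz => ?_).2 ⟨x, by simpa, by simpa using irrefl x⟩
  rw [mem_downSet] at hz ⊢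
  exact _root_.trans hz h

lemma exists_isRepresentation (r : α → α → Prop) [IsStrictOrder α r]
    (h : ∀ a b c d, r a b → r c d → r a d ∨ r c b) : ∃ k g, IsRepresentation r k g := by
  rcases isEmpty_or_nonempty α with hα | hα
  · exact ⟨0, isEmptyElim, isEmptyElim, isEmptyElim, by simp, by simp, isEmptyElim⟩
  have hD : ∀ y z, downSet r y ⊆ downSet r z ∨ downSet r z ⊆ downSet r y := by
    intro y z
    by_contra! hcon
    obtain ⟨⟨a, ha, ha'⟩, b, hb, hb'⟩ := And.intro (not_subset.1 hcon.1) (not_subset.1 hcon.2)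
    simp only [mem_downSet] at ha ha' hb hb'
    rcases h a y b z ha hb with h1 | h1
    · exact ha' h1
    · exact hb' h1
  set 𝒟 : Finset (Finset α) := (univ.image (downSet r)).erase ∅ with h𝒟
  have hmem : ∀ S, S ∈ 𝒟 ↔ S.Nonempty ∧ ∃ y, downSet r y = S := by
    intro S
    simp [h𝒟, nonempty_iff_ne_empty]
  have hchain : ∀ S ∈ 𝒟, ∀ S' ∈ 𝒟, S ⊆ S' ∨ S' ⊆ S := by
    intro S hS S' hS'
    obtain ⟨-, y, rfl⟩ := (hmem S).1 hS
    obtain ⟨-, z, rfl⟩ := (hmem S').1 hS'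
    exact hD y z
  have hrel : ∀ x y, ¬ r x y →
      #(𝒟.filter (· ⊆ downSet r y)) ≤ #(𝒟.filter (x ∉ ·)) := by
    intro x y hxy
    refine card_le_card fun S hS => ?_
    rw [mem_filter] at hS ⊢
    exact ⟨hS.1, fun hx => hxy (mem_downSet.1 (hS.2 hx))⟩
  refine ⟨#𝒟 + 1, fun x => (#(𝒟.filter (· ⊆ downSet r x)), #(𝒟.filter (x ∉ ·))),
    fun x => hrel x x (irrefl x), fun x => Nat.lt_succ_of_le (card_filter_le _ _),
    fun v hv => ?_, fun v hv => ?_, fun x y => ⟨fun hxy => ?_, fun hlt => ?_⟩⟩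
  · cases v with
    | zero =>
      obtain ⟨x, -, hx⟩ := exists_min_image univ (fun x => #(downSet r x)) univ_nonempty
      refine ⟨x, card_eq_zero.2 (filter_eq_empty_iff.2 fun S hS hSx => ?_)⟩
      obtain ⟨z, hz⟩ := ((hmem S).1 hS).1
      exact (hx z (mem_univ z)).not_gt (card_lt_card (downSet_ssubset (mem_downSet.1 (hSx hz))))
    | succ w =>
      obtain ⟨S, hS, hw⟩ := exists_card_filter_ssubset_eq hchain (v := w) (by omega)
      obtain ⟨-, y, rfl⟩ := (hmem S).1 hS
      refine ⟨y, ?_⟩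
      have : 𝒟.filter (· ⊆ downSet r y) = insert (downSet r y) (𝒟.filter (· ⊂ downSet r y)) := by
        ext U
        simp only [mem_filter, mem_insert, subset_iff_ssubset_or_eq]
        constructor
        · tauto
        · rintro (rfl | h1) <;> tauto
      simp only [this]
      rw [card_insert_of_notMem (by simp), hw]
  · rcases Nat.lt_succ_iff_lt_or_eq.1 hv with hv | rfl
    · obtain ⟨S, hS, hw⟩ := exists_card_filter_ssubset_eq hchain hv
      obtain ⟨x, hx, hxS⟩ := exists_mem_forall_ssubset_notMem hchain ((hmem S).1 hS).1
      refine ⟨x, ?_⟩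
      rw [← hw]
      refine congrArg card (filter_congr fun U hU => ⟨fun hxU => ?_, hxS U hU⟩)
      rcases hchain U hU S hS with hs | hs
      · exact hs.ssubset_of_ne fun he => hxU (he ▸ hx)
      · exact absurd (hs hx) hxU
    · obtain ⟨x, -, hx⟩ := exists_max_image univ (fun x => #(downSet r x)) univ_nonempty
      refine ⟨x, congrArg card (filter_true_of_mem fun S hS hxS => ?_)⟩
      obtain ⟨-, y, rfl⟩ := (hmem S).1 hS
      exact (hx y (mem_univ y)).not_gt (card_lt_card (downSet_ssubset (mem_downSet.1 hxS)))
  · have hy : downSet r y ∈ 𝒟 := (hmem _).2 ⟨⟨x, mem_downSet.2 hxy⟩, y, rfl⟩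
    refine card_lt_card ((ssubset_iff_of_subset fun S hS => ?_).2 ⟨downSet r y, ?_, ?_⟩)
    · rw [mem_filter] at hS ⊢
      refine ⟨hS.1, (hchain S hS.1 _ hy).resolve_right fun hs => hS.2 (hs (mem_downSet.2 hxy))⟩
    · exact mem_filter.2 ⟨hy, subset_rfl⟩
    · simpa using fun _ => hxy
  · by_contra hxy
    exact hlt.not_ge (hrel x y hxy)

namespace IsRepresentation

variable {r : α → α → Prop} {k : ℕ} {g : α → ℕ × ℕ}

lemma card_filter_downSet (hg : IsRepresentation r k g) {p : Finset α → Prop} [DecidablePred p]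
    {m : ℕ} (hm : m ≤ k) (hp : ∀ y, p (downSet r y) ↔ (g y).1 < m) :
    #((univ.image (downSet r)).filter p) = m := by
  set S : ℕ → Finset α := fun v => univ.filter fun x => (g x).2 < v with hS
  have hDS : ∀ y, downSet r y = S (g y).1 := fun y => by
    ext x
    simp [hS, hg.rel_iff]
  have hlt : ∀ v < k, ∀ w, v < w → S v ≠ S w := by
    intro v hv w hvw he
    obtain ⟨x, rfl⟩ := hg.exists_snd_eq v hv
    have : x ∈ S w := by simpa [hS] using hvw
    rw [← he] at this
    simp [hS] at this
  have himg : (univ.image (downSet r)).filter p = (range m).image S := by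
    ext U
    simp only [mem_filter, mem_image, mem_univ, true_and, mem_range]
    constructor
    · rintro ⟨⟨y, rfl⟩, hU⟩
      exact ⟨_, (hp y).1 hU, (hDS y).symm⟩
    · rintro ⟨v, hv, rfl⟩
      obtain ⟨y, rfl⟩ := hg.exists_fst_eq v (by omega)
      rw [← hDS]
      exact ⟨⟨y, rfl⟩, (hp y).2 hv⟩
  rw [himg, card_image_of_injOn, card_range]
  intro v hv w hw he
  simp only [coe_range, Set.mem_Iio] at hv hw
  by_contra hne
  rcases Nat.lt_or_gt_of_ne hne with h | h
  · exact hlt v (by omega) w h he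
  · exact hlt w (by omega) v h he.symm

lemma card_filter_ssubset_downSet (hg : IsRepresentation r k g) (y : α) :
    #((univ.image (downSet r)).filter (· ⊂ downSet r y)) = (g y).1 := by
  refine hg.card_filter_downSet ((hg.fst_le_snd y).trans (hg.snd_lt y).le) fun z => ?_
  constructor
  · intro h
    obtain ⟨x, hx, hxz⟩ := exists_of_ssubset h
    rw [mem_downSet, hg.rel_iff] at hx hxz
    omega
  · intro h
    refine (ssubset_iff_of_subset fun x hx => ?_).2 ?_
    · rw [mem_downSet, hg.rel_iff] at hx ⊢
      omega
    · obtain ⟨x, hx⟩ := hg.exists_snd_eq (g z).1 ((hg.fst_le_snd z).trans_lt (hg.snd_lt z))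
      refine ⟨x, ?_, ?_⟩ <;> rw [mem_downSet, hg.rel_iff] <;> omega

lemma card_filter_notMem_downSet (hg : IsRepresentation r k g) (x : α) :
    #((univ.image (downSet r)).filter (x ∉ ·)) = (g x).2 + 1 := by
  refine hg.card_filter_downSet (hg.snd_lt x) fun z => ?_
  rw [mem_downSet, hg.rel_iff]
  omega

lemma unique (hg : IsRepresentation r k g) {k' : ℕ} {g' : α → ℕ × ℕ}
    (hg' : IsRepresentation r k' g') : g = g' := by
  funext x
  refine Prod.ext ?_ ?_
  · rw [← hg.card_filter_ssubset_downSet, hg'.card_filter_ssubset_downSet]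
  · have := hg.card_filter_notMem_downSet x
    rw [hg'.card_filter_notMem_downSet] at this
    omega

end IsRepresentation

end

/-- The number of times that each cell is taken as a value of `g`. -/
noncomputable def cellCount {n : ℕ} (g : Fin n → ℕ × ℕ) : ℕ × ℕ →₀ ℕ :=
  Multiset.toFinsupp (univ.val.map g)

lemma cellCount_ne_zero {n : ℕ} {g : Fin n → ℕ × ℕ} {c : ℕ × ℕ} :
    cellCount g c ≠ 0 ↔ ∃ x, g x = c := by
  simp [cellCount, Multiset.count_eq_zero, -Fin.univ_val_map]

lemma cellCount_comp {n : ℕ} (g : Fin n → ℕ × ℕ) (e : Equiv.Perm (Fin n)) :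
    cellCount (g ∘ e) = cellCount g := by
  rw [cellCount, cellCount, ← Multiset.map_map]
  congr 2
  exact congrArg val (map_univ_equiv e)

lemma exists_comp_eq_of_cellCount_eq {n : ℕ} {g g' : Fin n → ℕ × ℕ}
    (h : cellCount g = cellCount g') : ∃ e : Equiv.Perm (Fin n), g' ∘ e = g := by
  have hcard : ∀ c, Fintype.card {x // g x = c} = Fintype.card {x // g' x = c} := by
    intro c
    have hc := DFunLike.congr_fun h c
    simp only [cellCount, Multiset.toFinsupp_apply, Multiset.count_map] at hc
    rw [Fintype.card_subtype, Fintype.card_subtype, card_def, card_def, filter_val, filter_val]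
    simpa only [eq_comm] using hc
  exact ⟨Equiv.ofFiberEquiv fun c => Fintype.equivOfCardEq (hcard c),
    funext fun x => Equiv.ofFiberEquiv_map _ x⟩

lemma exists_cellCount_eq {n : ℕ} {l : ℕ × ℕ →₀ ℕ} (hl : (l.sum fun _ m => m) = n) :
    ∃ g : Fin n → ℕ × ℕ, cellCount g = l := by
  obtain ⟨L, hL⟩ := Quot.exists_rep (Finsupp.toMultiset l)
  have hcard : n = L.length := by
    rw [← hl]
    exact (Finsupp.card_toMultiset l).symm.trans (congrArg _ hL.symm)
  subst hcard
  refine ⟨L.get, ?_⟩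
  rw [cellCount, Fin.univ_val_map, List.ofFn_get]
  exact (congrArg _ hL).trans (Finsupp.toMultiset_toFinsupp l)

lemma cellCount_mem_fishburnMatrices {n k : ℕ} {g : Fin n → ℕ × ℕ} :
    cellCount g ∈ fishburnMatrices k n ↔
      IsRepresentation (fun x y => (g x).2 < (g y).1) k g := by
  have hsum : ((cellCount g).sum fun _ m => m) = n :=
    (Multiset.toFinsupp_sum_eq _).trans (by simp [-Fin.univ_val_map])
  have hsupp : (cellCount g).support ⊆ upperCells k ∅ ∅ ↔
      ∀ x, (g x).1 ≤ (g x).2 ∧ (g x).2 < k := by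
    simp only [subset_iff, Finsupp.mem_support_iff, cellCount_ne_zero, forall_exists_index,
      forall_apply_eq_imp_iff, upperCells, mem_filter, mem_product, mem_range, notMem_empty,
      not_false_eq_true, and_true]
    exact forall_congr' fun x => by omega
  simp only [fishburnMatrices, mem_filter, mem_finsuppAntidiag', hsum, hsupp, true_and, mem_range,
    cellCount_ne_zero]
  refine ⟨fun ⟨h1, h2, h3⟩ => ⟨fun x => (h1 x).1, fun x => (h1 x).2, fun i hi => ?_, fun j hj => ?_,
    fun _ _ => Iff.rfl⟩, fun h => ⟨fun x => ⟨h.1 x, h.2 x⟩, fun i hi => ?_, fun j hj => ?_⟩⟩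
  · obtain ⟨j, x, hx⟩ := h2 i hi
    exact ⟨x, by rw [hx]⟩
  · obtain ⟨i, x, hx⟩ := h3 j hj
    exact ⟨x, by rw [hx]⟩
  · obtain ⟨x, rfl⟩ := h.3 i hi
    exact ⟨_, x, rfl⟩
  · obtain ⟨x, rfl⟩ := h.4 j hj
    exact ⟨_, x, rfl⟩

lemma IsRepresentation.comp {α β : Type*} {r : α → α → Prop} {k : ℕ} {g : α → ℕ × ℕ}
    (hg : IsRepresentation r k g) (e : β ≃ α) :
    IsRepresentation (fun x y => r (e x) (e y)) k (g ∘ e) where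
  fst_le_snd _ := hg.fst_le_snd _
  snd_lt _ := hg.snd_lt _
  exists_fst_eq i hi := e.surjective.exists.1 (hg.exists_fst_eq i hi)
  exists_snd_eq j hj := e.surjective.exists.1 (hg.exists_snd_eq j hj)
  rel_iff _ _ := hg.rel_iff _ _

lemma IsRepresentation.le_card {α : Type*} [Fintype α] {r : α → α → Prop} {k : ℕ}
    {g : α → ℕ × ℕ} (hg : IsRepresentation r k g) : k ≤ Fintype.card α := by
  have h : range k ⊆ univ.image fun x => (g x).1 := fun i hi => by
    simpa using hg.exists_fst_eq i (mem_range.1 hi)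
  simpa using (card_le_card h).trans card_image_le

lemma IsRepresentation.isStrictOrder {α : Type*} {r : α → α → Prop} {k : ℕ}
    {g : α → ℕ × ℕ} (hg : IsRepresentation r k g) : IsStrictOrder α r where
  irrefl x h := ((hg.rel_iff x x).1 h).not_ge (hg.fst_le_snd x)
  trans x y z hxy hyz := by
    rw [hg.rel_iff] at *
    exact hxy.trans ((hg.fst_le_snd y).trans_lt hyz)

lemma IsRepresentation.rel_or_rel {α : Type*} {r : α → α → Prop} {k : ℕ}
    {g : α → ℕ × ℕ} (hg : IsRepresentation r k g) (a b c d : α) (hab : r a b) (hcd : r c d) :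
    r a d ∨ r c b := by
  rw [hg.rel_iff] at *
  rw [hg.rel_iff]
  omega

lemma IsRepresentation.length_le {α : Type*} {r r' : α → α → Prop} {k k' : ℕ} {g : α → ℕ × ℕ}
    (hg : IsRepresentation r k g) (hg' : IsRepresentation r' k' g) : k ≤ k' := by
  by_contra! h
  obtain ⟨x, hx⟩ := hg.exists_snd_eq k' h
  exact (hg'.snd_lt x).ne hx

lemma exists_cellCount_eq_of_mem_fishburnMatrices {k n : ℕ} {l : ℕ × ℕ →₀ ℕ}
    (hl : l ∈ fishburnMatrices k n) : ∃ g : Fin n → ℕ × ℕ, cellCount g = l :=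
  exists_cellCount_eq (mem_finsuppAntidiag'.1 (mem_filter.1 hl).1).1

lemma pairwiseDisjoint_fishburnMatrices (n : ℕ) (s : Set ℕ) :
    s.PairwiseDisjoint fun k => fishburnMatrices k n := by
  intro k _ k' _ hne
  refine disjoint_left.2 fun l hl hl' => hne ?_
  obtain ⟨g, rfl⟩ := exists_cellCount_eq_of_mem_fishburnMatrices hl
  have hg := cellCount_mem_fishburnMatrices.1 hl
  have hg' := cellCount_mem_fishburnMatrices.1 hl'
  exact (hg.length_le hg').antisymm (hg'.length_le hg)

lemma intervalOrderCount_eq_sum (n : ℕ) :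
    intervalOrderCount n = ∑ k ∈ range (n + 1), #(fishburnMatrices k n) := by
  have hrep (P : IntervalOrderRel n) : ∃ k g, IsRepresentation P.1 k g :=
    have := P.2.1
    exists_isRepresentation P.1 P.2.2
  choose k g hg using hrep
  have hwd : ∀ P Q : IntervalOrderRel n, IntervalOrderIso P Q →
      cellCount (g P) = cellCount (g Q) := by
    rintro P Q ⟨e, he⟩
    have h := (hg Q).comp e
    simp only [← he] at h
    rw [(hg P).unique h, cellCount_comp]
  have hinj : Function.Injective (Quot.lift (fun P => cellCount (g P)) hwd) := by
    rintro ⟨P⟩ ⟨Q⟩ h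
    obtain ⟨e, he⟩ := exists_comp_eq_of_cellCount_eq h
    refine Quot.sound ⟨e, fun a b => ?_⟩
    rw [(hg P).rel_iff, (hg Q).rel_iff, ← he, Function.comp_apply, Function.comp_apply]
  have hrange : Set.range (Quot.lift (fun P => cellCount (g P)) hwd) =
      ((range (n + 1)).biUnion fun k => fishburnMatrices k n : Finset (ℕ × ℕ →₀ ℕ)) := by
    ext l
    simp only [Set.range_quot_lift, Set.mem_range, coe_biUnion, Set.mem_iUnion, mem_coe, mem_range,
      exists_prop]
    constructor
    · rintro ⟨P, rfl⟩
      refine ⟨k P, Nat.lt_succ_of_le (by simpa using (hg P).le_card), ?_⟩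
      have h := hg P
      rwa [cellCount_mem_fishburnMatrices,
        show (fun x y => (g P x).2 < (g P y).1) = P.1 from
          funext₂ fun x y => propext (h.rel_iff x y).symm]
    · rintro ⟨m, -, hl⟩
      obtain ⟨f, rfl⟩ := exists_cellCount_eq_of_mem_fishburnMatrices hl
      have hf := cellCount_mem_fishburnMatrices.1 hl
      let P : IntervalOrderRel n := ⟨_, hf.isStrictOrder, hf.rel_or_rel⟩
      exact ⟨P, congrArg cellCount ((hg P).unique hf)⟩
  rw [intervalOrderCount, Nat.card_congr (Equiv.ofInjective _ hinj), hrange,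
    Nat.card_coe_set_eq, Set.ncard_coe_finset,
    card_biUnion fun k hk k' hk' hne => pairwiseDisjoint_fishburnMatrices n Set.univ
      (Set.mem_univ k) (Set.mem_univ k') hne]

lemma intervalOrderCount_eq_coeff (n : ℕ) :
    (intervalOrderCount n : ℝ) = coeff n (fineSum 0) := by
  rw [← formalSum_fishburnSeries_zero, formalSum, coeff_mk, intervalOrderCount_eq_sum,
    Nat.cast_sum]
  exact sum_congr rfl fun k _ => card_fishburnMatrices k n

end IntervalOrder

/-- `i n / (n! √n (6/π²)^n) → C₀ = (12√3/π^{5/2}) e^{π²/12}`. -/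
theorem unlabelled_asymptotics :
    Filter.Tendsto
      (fun n : ℕ => (intervalOrderCount n : ℝ) /
        ((n.factorial : ℝ) * Real.sqrt n * (6 / Real.pi ^ 2) ^ n))
      Filter.atTop
      (nhds (12 * Real.sqrt 3 / Real.pi ^ ((5 : ℝ) / 2) * Real.exp (Real.pi ^ 2 / 12))) := by
  simpa only [IntervalOrder.intervalOrderCount_eq_coeff] using IntervalOrder.tendsto_coeff_fineSum
end

section
/- The number r_n of unlabelled rigid interval orders on n points satisfies the asymptotic formula r_n / ( n! · √n · (6/π²)^n ) → D₀ as n → ∞, where D₀ = 12√3 / ( π^{5/2} · e^{π²/12} ). -/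
open scoped Classical

namespace IntervalOrderRel

/-- `f` assigns to each element the endpoints of an interval in the canonical (minimal endpoint)
representation of the relation `r`. -/
structure CanonicalRep {α : Type*} (r : α → α → Prop) (f : α → ℕ × ℕ) : Prop where
  rel_iff : ∀ x y, r x y ↔ (f x).2 < (f y).1
  fst_le_snd : ∀ x, (f x).1 ≤ (f x).2
  exists_levels : ∃ m, (∀ k, k < m ↔ ∃ x, (f x).1 = k) ∧ (∀ k, k < m ↔ ∃ x, (f x).2 = k)

theorem le_of_lt_iff_lt {α : Type*} {f g : α → ℕ} (hf : ∀ x, ∀ k < f x, ∃ y, f y = k)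
    (h : ∀ x y, f x < f y → g x < g y) (x : α) : f x ≤ g x := by
  induction hk : f x using Nat.strong_induction_on generalizing x with
  | _ k ih =>
    by_contra! hlt
    obtain ⟨y, hy⟩ := hf x (g x) (by omega)
    have h1 := ih (g x) hlt y hy
    have h2 := h y x (by omega)
    omega

theorem CanonicalRep.fst_le_iff {α : Type*} {r : α → α → Prop} {f : α → ℕ × ℕ}
    (hf : CanonicalRep r f) (x y : α) :
    (f x).1 ≤ (f y).1 ↔ ∀ z, r z x → r z y := by
  obtain ⟨m, h1, h2⟩ := hf.exists_levels
  constructor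
  · intro h z hz
    rw [hf.rel_iff] at hz ⊢
    omega
  · intro h
    by_contra! hlt
    have : (f y).1 < m := (h1 _).2 ⟨y, rfl⟩
    obtain ⟨z, hz⟩ := (h2 _).1 this
    have h3 := h z (by rw [hf.rel_iff]; omega)
    rw [hf.rel_iff] at h3
    omega

theorem CanonicalRep.fst_eq {α : Type*} {r : α → α → Prop} {f g : α → ℕ × ℕ}
    (hf : CanonicalRep r f) (hg : CanonicalRep r g) (x : α) : (f x).1 = (g x).1 := by
  have key : ∀ {f g : α → ℕ × ℕ}, CanonicalRep r f → CanonicalRep r g →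
      ∀ x, (f x).1 ≤ (g x).1 := by
    intro f g hf hg x
    refine le_of_lt_iff_lt (f := fun x => (f x).1) (g := fun x => (g x).1) ?_ ?_ x
    · intro x k hk
      obtain ⟨m, h1, -⟩ := hf.exists_levels
      exact (h1 k).1 (hk.trans ((h1 _).2 ⟨x, rfl⟩))
    · intro x y h
      rw [← not_le, hf.fst_le_iff] at h
      rw [← not_le, hg.fst_le_iff]
      exact h
  exact le_antisymm (key hf hg x) (key hg hf x)

theorem CanonicalRep.unique {α : Type*} {r : α → α → Prop} {f g : α → ℕ × ℕ}
    (hf : CanonicalRep r f) (hg : CanonicalRep r g) : f = g := by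
  have key : ∀ {f g : α → ℕ × ℕ}, CanonicalRep r f → CanonicalRep r g →
      ∀ x, (f x).2 ≤ (g x).2 := by
    intro f g hf hg x
    by_contra! hlt
    obtain ⟨m, h1, h2⟩ := hf.exists_levels
    obtain ⟨y, hy⟩ := (h1 (f x).2).1 ((h2 _).2 ⟨x, rfl⟩)
    have h3 := hf.fst_eq hg y
    have h4 := (hg.rel_iff x y).2 (by omega)
    rw [hf.rel_iff] at h4
    omega
  funext x
  exact Prod.ext (hf.fst_eq hg x) (le_antisymm (key hf hg x) (key hg hf x))

/-- The strict down-set of an element. -/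
noncomputable def downSet {n : ℕ} (P : IntervalOrderRel n) (x : Fin n) : Finset (Fin n) :=
  Finset.univ.filter fun z => P.1 z x

/-- The family of all strict down-sets. -/
noncomputable def downSets {n : ℕ} (P : IntervalOrderRel n) : Finset (Finset (Fin n)) :=
  Finset.univ.image P.downSet

/-- The endpoints of the interval of an element in the canonical representation. -/
noncomputable def endpoints {n : ℕ} (P : IntervalOrderRel n) (x : Fin n) : ℕ × ℕ :=
  ((P.downSets.filter fun d => d ⊂ P.downSet x).card,
    (P.downSets.filter fun d => x ∉ d).card - 1)

variable {n : ℕ} (P : IntervalOrderRel n)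

theorem mem_downSet {x z : Fin n} : z ∈ P.downSet x ↔ P.1 z x := by simp [downSet]

theorem downSet_mem_downSets (x : Fin n) : P.downSet x ∈ P.downSets :=
  Finset.mem_image_of_mem _ (Finset.mem_univ x)

theorem exists_of_mem_downSets {d : Finset (Fin n)} (hd : d ∈ P.downSets) :
    ∃ x, P.downSet x = d := by simpa [downSets] using hd

theorem notMem_downSet_self (x : Fin n) : x ∉ P.downSet x := by
  rw [mem_downSet]
  exact P.2.1.irrefl x

theorem downSets_total {d e : Finset (Fin n)} (hd : d ∈ P.downSets) (he : e ∈ P.downSets) :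
    d ⊆ e ∨ e ⊂ d := by
  obtain ⟨x, rfl⟩ := P.exists_of_mem_downSets hd
  obtain ⟨y, rfl⟩ := P.exists_of_mem_downSets he
  by_cases h : P.downSet x ⊆ P.downSet y
  · exact Or.inl h
  · refine Or.inr ⟨fun z hz => ?_, h⟩
    obtain ⟨w, hw, hw'⟩ := Finset.not_subset.1 h
    rw [mem_downSet] at *
    rcases P.2.2 _ _ _ _ hw hz with h1 | h1
    · exact absurd h1 hw'
    · exact h1

/-- The number of down-sets properly contained in `d`. -/
noncomputable def rank (d : Finset (Fin n)) : ℕ := (P.downSets.filter fun e => e ⊂ d).card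

theorem rank_lt_rank {d e : Finset (Fin n)} (hd : d ∈ P.downSets) (h : d ⊂ e) :
    P.rank d < P.rank e := by
  refine Finset.card_lt_card ⟨fun c hc => ?_, fun hc => ?_⟩
  · rw [Finset.mem_filter] at hc ⊢
    exact ⟨hc.1, hc.2.trans h⟩
  · have := hc (Finset.mem_filter.2 ⟨hd, h⟩)
    exact (Finset.mem_filter.1 this).2.ne rfl

theorem rank_lt_card {d : Finset (Fin n)} (hd : d ∈ P.downSets) : P.rank d < P.downSets.card := by
  refine Finset.card_lt_card ⟨Finset.filter_subset _ _, fun hc => ?_⟩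
  exact (Finset.mem_filter.1 (hc hd)).2.ne rfl

theorem rank_injOn : Set.InjOn P.rank (P.downSets : Set (Finset (Fin n))) := by
  intro d hd e he h
  rcases P.downSets_total hd he with h1 | h1
  · by_contra hne
    exact (P.rank_lt_rank hd (h1.ssubset_of_ne hne)).ne h
  · exact absurd h.symm (P.rank_lt_rank he h1).ne

theorem exists_rank_eq {k : ℕ} (hk : k < P.downSets.card) : ∃ d ∈ P.downSets, P.rank d = k := by
  have h : P.downSets.image P.rank = Finset.range P.downSets.card := by
    refine Finset.eq_of_subset_of_card_le (fun k hk => ?_) ?_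
    · obtain ⟨d, hd, rfl⟩ := Finset.mem_image.1 hk
      exact Finset.mem_range.2 (P.rank_lt_card hd)
    · rw [Finset.card_range, Finset.card_image_of_injOn P.rank_injOn]
  have := Finset.mem_range.2 hk
  rw [← h] at this
  simpa using this

theorem fst_endpoints (x : Fin n) : (P.endpoints x).1 = P.rank (P.downSet x) := rfl

theorem snd_endpoints_add_one (x : Fin n) :
    (P.endpoints x).2 + 1 = (P.downSets.filter fun d => x ∉ d).card := by
  have : 0 < (P.downSets.filter fun d => x ∉ d).card :=
    Finset.card_pos.2 ⟨P.downSet x,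
      Finset.mem_filter.2 ⟨P.downSet_mem_downSets x, P.notMem_downSet_self x⟩⟩
  simp only [endpoints]
  omega

theorem snd_lt_fst_of_rel {x y : Fin n} (h : P.1 x y) :
    (P.endpoints x).2 < (P.endpoints y).1 := by
  rw [← Nat.succ_le_iff, Nat.succ_eq_add_one, snd_endpoints_add_one, fst_endpoints, rank]
  refine Finset.card_le_card fun d hd => ?_
  rw [Finset.mem_filter] at hd ⊢
  refine ⟨hd.1, ?_⟩
  rcases P.downSets_total (P.downSet_mem_downSets y) hd.1 with h1 | h1
  · exact absurd (h1 (P.mem_downSet.2 h)) hd.2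
  · exact h1

theorem fst_le_snd_of_not_rel {x y : Fin n} (h : ¬ P.1 x y) :
    (P.endpoints y).1 ≤ (P.endpoints x).2 := by
  rw [← Nat.lt_succ_iff, Nat.succ_eq_add_one, snd_endpoints_add_one, fst_endpoints, rank]
  refine Finset.card_lt_card ⟨fun d hd => ?_, fun hc => ?_⟩
  · rw [Finset.mem_filter] at hd ⊢
    exact ⟨hd.1, fun hx => h (P.mem_downSet.1 (hd.2.1 hx))⟩
  · have := hc (Finset.mem_filter.2
      ⟨P.downSet_mem_downSets y, fun hx => h (P.mem_downSet.1 hx)⟩)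
    exact (Finset.mem_filter.1 this).2.ne rfl

theorem exists_maximal (x₀ : Fin n) : ∃ x, ∀ y, ¬ P.1 x y := by
  have := P.2.1
  have hwf : WellFounded (fun a b => P.1 b a) :=
    Finite.wellFounded_of_trans_of_irrefl (Function.swap P.1)
  obtain ⟨x, -, hx⟩ := hwf.has_min Set.univ ⟨x₀, trivial⟩
  exact ⟨x, fun y => hx y trivial⟩

theorem canonicalRep_endpoints : CanonicalRep P.1 P.endpoints where
  rel_iff x y := by
    refine ⟨P.snd_lt_fst_of_rel, fun h => ?_⟩
    by_contra h'
    exact absurd (P.fst_le_snd_of_not_rel h') (not_le.2 h)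
  fst_le_snd x := P.fst_le_snd_of_not_rel (P.2.1.irrefl x)
  exists_levels := by
    refine ⟨P.downSets.card, fun k => ⟨fun hk => ?_, ?_⟩, fun k => ⟨fun hk => ?_, ?_⟩⟩
    · obtain ⟨d, hd, rfl⟩ := P.exists_rank_eq hk
      obtain ⟨x, rfl⟩ := P.exists_of_mem_downSets hd
      exact ⟨x, rfl⟩
    · rintro ⟨x, rfl⟩
      exact P.rank_lt_card (P.downSet_mem_downSets x)
    · obtain ⟨d, hd, hdk⟩ := P.exists_rank_eq hk
      obtain ⟨x₀, -⟩ := P.exists_of_mem_downSets hd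
      rcases Nat.lt_or_ge (k + 1) P.downSets.card with hk' | hk'
      · obtain ⟨e, he, hek⟩ := P.exists_rank_eq hk'
        have hde : d ⊂ e := by
          rcases P.downSets_total he hd with h1 | h1
          · rcases eq_or_ne e d with rfl | hne
            · omega
            · have := P.rank_lt_rank he (h1.ssubset_of_ne hne)
              omega
          · exact h1
        obtain ⟨x, hxe, hxd⟩ := Finset.exists_of_ssubset hde
        refine ⟨x, ?_⟩
        have : (P.endpoints x).2 + 1 = P.rank e := by
          rw [snd_endpoints_add_one, rank]
          congr 1
          refine Finset.filter_congr fun c hc => ⟨fun hx => ?_, fun hce hx => ?_⟩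
          · rcases P.downSets_total he hc with h1 | h1
            · exact absurd (h1 hxe) hx
            · exact h1
          · rcases P.downSets_total hc hd with h1 | h1
            · exact hxd (h1 hx)
            · have h2 := P.rank_lt_rank hd h1
              have h3 := P.rank_lt_rank hc hce
              omega
        omega
      · obtain ⟨x, hx⟩ := P.exists_maximal x₀
        refine ⟨x, ?_⟩
        have : (P.endpoints x).2 + 1 = P.downSets.card := by
          rw [snd_endpoints_add_one]
          congr 1
          refine Finset.filter_true_of_mem fun c hc hxc => ?_
          obtain ⟨y, rfl⟩ := P.exists_of_mem_downSets hc
          exact hx y (P.mem_downSet.1 hxc)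
        omega
    · rintro ⟨x, rfl⟩
      have : (P.endpoints x).2 + 1 ≤ P.downSets.card := by
        rw [snd_endpoints_add_one]
        exact Finset.card_filter_le _ _
      omega

end IntervalOrderRel

/-- The support of an upper triangular `m × m` zero-one matrix with no zero row or column. -/
def IsFishburnSupport (m : ℕ) (S : Finset (ℕ × ℕ)) : Prop :=
  (∀ p ∈ S, p.1 ≤ p.2) ∧ (∀ k, k < m ↔ ∃ p ∈ S, p.1 = k) ∧ (∀ k, k < m ↔ ∃ p ∈ S, p.2 = k)

namespace IntervalOrderRel

variable {n : ℕ}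

theorem CanonicalRep.comp_equiv {P Q : IntervalOrderRel n} {f : Fin n → ℕ × ℕ}
    (hf : CanonicalRep Q.1 f) (e : Equiv.Perm (Fin n)) (he : ∀ a b, P.1 a b ↔ Q.1 (e a) (e b)) :
    CanonicalRep P.1 (f ∘ e) where
  rel_iff x y := by rw [he, hf.rel_iff]; rfl
  fst_le_snd x := hf.fst_le_snd (e x)
  exists_levels := by
    obtain ⟨m, h1, h2⟩ := hf.exists_levels
    exact ⟨m, fun k => (h1 k).trans e.surjective.exists,
      fun k => (h2 k).trans e.surjective.exists⟩

theorem endpoints_injective {P : IntervalOrderRel n} (hP : IsRigid P) :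
    Function.Injective P.endpoints := by
  intro x y hxy
  have hrep := P.canonicalRep_endpoints
  have hsw : ∀ a, P.endpoints (Equiv.swap x y a) = P.endpoints a := by
    intro a
    by_cases hx : a = x
    · rw [hx, Equiv.swap_apply_left, hxy]
    · by_cases hy : a = y
      · rw [hy, Equiv.swap_apply_right, hxy]
      · rw [Equiv.swap_apply_of_ne_of_ne hx hy]
  have := hP (Equiv.swap x y) fun a b => by
    rw [hrep.rel_iff, hrep.rel_iff, hsw, hsw]
  rwa [Equiv.Perm.one_def, Equiv.swap_eq_refl_iff] at this

/-- The support of the Fishburn matrix of an interval order. -/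
noncomputable def support (P : IntervalOrderRel n) : Finset (ℕ × ℕ) :=
  Finset.univ.image P.endpoints

theorem exists_isFishburnSupport (P : IntervalOrderRel n) :
    ∃ m, IsFishburnSupport m P.support := by
  have hrep := P.canonicalRep_endpoints
  obtain ⟨m, h1, h2⟩ := hrep.exists_levels
  refine ⟨m, ?_, ?_, ?_⟩
  · simpa [support] using hrep.fst_le_snd
  · simpa [support] using h1
  · simpa [support] using h2

theorem card_support {P : IntervalOrderRel n} (hP : IsRigid P) : P.support.card = n := by
  rw [support, Finset.card_image_of_injective _ (endpoints_injective hP), Finset.card_fin]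

theorem support_eq_of_iso {P Q : IntervalOrderRel n} (h : IntervalOrderIso P Q) :
    P.support = Q.support := by
  obtain ⟨e, he⟩ := h
  have := P.canonicalRep_endpoints.unique (Q.canonicalRep_endpoints.comp_equiv e he)
  rw [support, support, this]
  ext p
  simpa using (e.surjective.exists (p := fun x => Q.endpoints x = p)).symm

theorem iso_of_support_eq {P Q : IntervalOrderRel n} (hP : IsRigid P)
    (h : P.support = Q.support) : IntervalOrderIso P Q := by
  have hex : ∀ x, ∃ y, Q.endpoints y = P.endpoints x := by
    intro x
    have : P.endpoints x ∈ Q.support := by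
      rw [← h]
      exact Finset.mem_image_of_mem _ (Finset.mem_univ x)
    simpa [support] using this
  choose e he using hex
  have hinj : Function.Injective e := fun x y hxy =>
    endpoints_injective hP (by rw [← he, ← he, hxy])
  refine ⟨Equiv.ofBijective e (Finite.injective_iff_bijective.1 hinj), fun a b => ?_⟩
  rw [P.canonicalRep_endpoints.rel_iff, Q.canonicalRep_endpoints.rel_iff]
  simp [he]

theorem exists_rigid_of_isFishburnSupport {m : ℕ} {S : Finset (ℕ × ℕ)} (hS : S.card = n)
    (h : IsFishburnSupport m S) : ∃ P : IntervalOrderRel n, IsRigid P ∧ P.support = S := by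
  obtain ⟨hle, h1, h2⟩ := h
  let e : Fin n ≃ S := (Finset.equivFinOfCardEq hS).symm
  let f : Fin n → ℕ × ℕ := fun x => e x
  have hfinj : Function.Injective f := Subtype.val_injective.comp e.injective
  have hfle : ∀ x, (f x).1 ≤ (f x).2 := fun x => hle _ (e x).2
  have himage : Finset.univ.image f = S := by
    ext p
    simp only [Finset.mem_image, Finset.mem_univ, true_and]
    refine ⟨?_, fun hp => ⟨e.symm ⟨p, hp⟩, by simp [f]⟩⟩
    rintro ⟨x, rfl⟩
    exact (e x).2
  have hmem : ∀ q : ℕ × ℕ → Prop, (∃ p ∈ S, q p) ↔ ∃ x, q (f x) := by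
    intro q
    rw [← himage]
    simp
  let P : IntervalOrderRel n := ⟨fun x y => (f x).2 < (f y).1,
    { irrefl := fun x hx => absurd hx (not_lt.2 (hfle x))
      trans := fun x y z hxy hyz => hxy.trans ((hfle y).trans_lt hyz) },
    fun a b c d hab hcd => by
      rcases le_total (f b).1 (f d).1 with hbd | hbd
      · exact Or.inl (hab.trans_le hbd)
      · exact Or.inr (hcd.trans_le hbd)⟩
  have hrep : CanonicalRep P.1 f :=
    { rel_iff := fun x y => Iff.rfl
      fst_le_snd := hfle
      exists_levels := ⟨m, fun k => (h1 k).trans (hmem fun p => p.1 = k),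
        fun k => (h2 k).trans (hmem fun p => p.2 = k)⟩ }
  refine ⟨P, fun g hg => ?_, ?_⟩
  · have := hrep.unique (hrep.comp_equiv g hg)
    ext x : 1
    exact hfinj (congrFun this x).symm
  · rw [support, ← hrep.unique P.canonicalRep_endpoints, himage]

end IntervalOrderRel

theorem rigidIntervalOrderCount_eq_card (n : ℕ) :
    rigidIntervalOrderCount n =
      Nat.card {S : Finset (ℕ × ℕ) // S.card = n ∧ ∃ m, IsFishburnSupport m S} := by
  refine Nat.card_congr (Equiv.ofBijective
    (Quot.lift (fun P => ⟨P.1.support, P.1.card_support P.2, P.1.exists_isFishburnSupport⟩)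
      fun P Q h => Subtype.ext (IntervalOrderRel.support_eq_of_iso h)) ⟨?_, ?_⟩)
  · rintro ⟨P⟩ ⟨Q⟩ h
    exact Quot.sound (IntervalOrderRel.iso_of_support_eq P.2 (congrArg Subtype.val h))
  · rintro ⟨S, hS, m, hm⟩
    obtain ⟨P, hP, rfl⟩ := IntervalOrderRel.exists_rigid_of_isFishburnSupport hS hm
    exact ⟨Quot.mk _ ⟨P, hP⟩, rfl⟩

namespace FishburnMatrix

open Finset

/-- The cells on or above the diagonal of an `m × m` matrix. -/
def cells (m : ℕ) : Finset (ℕ × ℕ) :=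
  (range m ×ˢ range m).filter fun p => p.1 ≤ p.2

/-- The supports of primitive Fishburn matrices of dimension `m`. -/
noncomputable def supports (m : ℕ) : Finset (Finset (ℕ × ℕ)) :=
  (cells m).powerset.filter (IsFishburnSupport m)

theorem mem_supports {m : ℕ} {S : Finset (ℕ × ℕ)} : S ∈ supports m ↔ IsFishburnSupport m S := by
  rw [supports, mem_filter, mem_powerset, and_iff_right_iff_imp]
  rintro ⟨h0, h1, h2⟩ p hp
  simp only [cells, mem_filter, mem_product, mem_range]
  exact ⟨⟨(h1 _).2 ⟨p, hp, rfl⟩, (h2 _).2 ⟨p, hp, rfl⟩⟩, h0 p hp⟩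

theorem image_fst_eq_range {m : ℕ} {S : Finset (ℕ × ℕ)} (h : IsFishburnSupport m S) :
    S.image Prod.fst = range m := by
  ext k
  rw [mem_range, h.2.1 k]
  simp

theorem card_eq_sum_supports (n : ℕ) :
    Nat.card {S : Finset (ℕ × ℕ) // S.card = n ∧ ∃ m, IsFishburnSupport m S} =
      ∑ m ∈ range (n + 1), ((supports m).filter fun S => S.card = n).card := by
  have hdisj : (range (n + 1) : Set ℕ).PairwiseDisjoint
      fun m => (supports m).filter fun S => S.card = n := by
    intro a _ b _ hab
    refine disjoint_left.2 fun S hSa hSb => hab ?_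
    have ha := image_fst_eq_range (mem_supports.1 (mem_filter.1 hSa).1)
    rw [image_fst_eq_range (mem_supports.1 (mem_filter.1 hSb).1)] at ha
    simpa using (congrArg card ha).symm
  rw [← card_biUnion hdisj]
  refine Nat.subtype_card _ fun S => ?_
  simp only [mem_biUnion, mem_range, mem_filter, mem_supports]
  refine ⟨fun ⟨m, _, hm, hS⟩ => ⟨hS, m, hm⟩, fun ⟨hS, m, hm⟩ => ⟨m, ?_, hm, hS⟩⟩
  have := card_image_le (s := S) (f := Prod.fst)
  rw [image_fst_eq_range hm, card_range] at this
  omega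

theorem isFishburnSupport_iff {m : ℕ} {S : Finset (ℕ × ℕ)} (hS : S ⊆ cells m) :
    IsFishburnSupport m S ↔
      (∀ i ∈ range m, ∃ p ∈ S, p.1 = i) ∧ ∀ j ∈ range m, ∃ p ∈ S, p.2 = j := by
  have hc : ∀ p ∈ S, (p.1 < m ∧ p.2 < m) ∧ p.1 ≤ p.2 := by
    intro p hp
    simpa [cells] using hS hp
  simp only [mem_range]
  constructor
  · rintro ⟨-, h1, h2⟩
    exact ⟨fun i => (h1 i).1, fun j => (h2 j).1⟩
  · rintro ⟨h1, h2⟩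
    refine ⟨fun p hp => (hc p hp).2, fun k => ⟨h1 k, ?_⟩, fun k => ⟨h2 k, ?_⟩⟩
    · rintro ⟨p, hp, rfl⟩
      exact (hc p hp).1.1
    · rintro ⟨p, hp, rfl⟩
      exact (hc p hp).1.2

section GeneratingFunction

variable {A : Type*} [CommRing A]

theorem sum_powerset_pow_card {α : Type*} (x : A) (s : Finset α) :
    ∑ t ∈ s.powerset, x ^ t.card = (1 + x) ^ s.card := by
  have := prod_one_add (f := fun _ : α => x) s
  simpa using this.symm

theorem prod_ite_exists {α ι : Type*} (S : Finset α) (g : α → ι) (s : Finset ι)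
    [Decidable (∀ i ∈ s, ∃ p ∈ S, g p = i)] [∀ R : Finset ι, Decidable (∀ p ∈ S, g p ∉ R)] :
    (if ∀ i ∈ s, ∃ p ∈ S, g p = i then (1 : A) else 0) =
      ∑ R ∈ s.powerset, (-1) ^ R.card * if ∀ p ∈ S, g p ∉ R then 1 else 0 := by
  have h1 : (if ∀ i ∈ s, ∃ p ∈ S, g p = i then (1 : A) else 0) =
      ∏ i ∈ s, (1 + -(if ∀ p ∈ S, g p ≠ i then (1 : A) else 0)) := by
    have : ∀ i, (1 + -(if ∀ p ∈ S, g p ≠ i then (1 : A) else 0)) =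
        if ∃ p ∈ S, g p = i then 1 else 0 := by
      intro i
      by_cases h : ∃ p ∈ S, g p = i
      · have h' : ¬ ∀ p ∈ S, g p ≠ i := by push Not; exact h
        rw [if_pos h, if_neg h']; simp
      · have h' : ∀ p ∈ S, g p ≠ i := by push Not at h; exact h
        rw [if_neg h, if_pos h']; simp
    simp_rw [this]
    rw [prod_ite_zero]
    simp
  rw [h1, prod_one_add]
  refine sum_congr rfl fun R _ => ?_
  rw [prod_neg, prod_ite_zero]
  congr 1
  simp only [prod_const_one]
  refine if_congr ⟨fun h p hp hR => h _ hR p hp rfl, fun h i hi p hp hpi => h p hp (hpi ▸ hi)⟩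
    rfl rfl

theorem ite_mul_ite_mul (a b : Prop) [Decidable a] [Decidable b] (y : A) :
    ((if a then (1 : A) else 0) * (if b then 1 else 0)) * y = if a ∧ b then y else 0 := by
  by_cases ha : a <;> by_cases hb : b <;> simp [ha, hb]

theorem sum_powerset_avoiding (x : A) (T : Finset (ℕ × ℕ)) (R C : Finset ℕ) :
    ∑ S ∈ T.powerset, ((if ∀ p ∈ S, p.1 ∉ R then (1 : A) else 0) *
        (if ∀ p ∈ S, p.2 ∉ C then 1 else 0)) * x ^ S.card =
      (1 + x) ^ (T.filter fun p => p.1 ∉ R ∧ p.2 ∉ C).card := by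
  rw [← sum_powerset_pow_card]
  have : (T.filter fun p => p.1 ∉ R ∧ p.2 ∉ C).powerset =
      T.powerset.filter fun S => (∀ p ∈ S, p.1 ∉ R) ∧ ∀ p ∈ S, p.2 ∉ C := by
    ext S
    simp only [mem_powerset, mem_filter, subset_iff]
    grind
  rw [this, sum_filter]
  exact sum_congr rfl fun S _ => ite_mul_ite_mul _ _ _

theorem card_cells_filter (m : ℕ) (R C : Finset ℕ) :
    ((cells m).filter fun p => p.1 ∉ R ∧ p.2 ∉ C).card =
      ∑ j ∈ range m \ C, (range (j + 1) \ R).card := by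
  have : (cells m).filter (fun p => p.1 ∉ R ∧ p.2 ∉ C) =
      (range m \ C).biUnion fun j => (range (j + 1) \ R).image fun i => (i, j) := by
    ext ⟨i, j⟩
    simp only [cells, mem_filter, mem_product, mem_range, mem_biUnion, mem_sdiff, mem_image,
      Prod.mk.injEq]
    constructor
    · rintro ⟨⟨⟨_, hj⟩, hij⟩, hR, hC⟩
      exact ⟨j, ⟨hj, hC⟩, i, ⟨by omega, hR⟩, rfl, rfl⟩
    · rintro ⟨_, ⟨hj, hC⟩, _, ⟨hi, hR⟩, rfl, rfl⟩
      exact ⟨⟨⟨by omega, hj⟩, by omega⟩, hR, hC⟩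
  rw [this, card_biUnion]
  · refine sum_congr rfl fun j _ => card_image_of_injective _ fun a b h => (Prod.mk.inj h).1
  · intro a _ b _ hab
    refine disjoint_left.2 fun p hp hq => hab ?_
    simp only [mem_image] at hp hq
    obtain ⟨_, _, rfl⟩ := hp
    obtain ⟨_, _, h⟩ := hq
    exact (Prod.mk.inj h).2.symm

theorem sum_supports (x : A) (m : ℕ) :
    ∑ S ∈ supports m, x ^ S.card =
      ∑ R ∈ (range m).powerset, (-1) ^ R.card *
        ∏ j ∈ range m, ((1 + x) ^ (range (j + 1) \ R).card - 1) := by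
  have h1 : ∑ S ∈ supports m, x ^ S.card = ∑ S ∈ (cells m).powerset,
      ((if ∀ i ∈ range m, ∃ p ∈ S, p.1 = i then (1 : A) else 0) *
        if ∀ j ∈ range m, ∃ p ∈ S, p.2 = j then 1 else 0) * x ^ S.card := by
    rw [supports, sum_filter]
    refine sum_congr rfl fun S hS => ?_
    rw [ite_mul_ite_mul]
    exact if_congr (isFishburnSupport_iff (mem_powerset.1 hS)) rfl rfl
  have h2 : ∀ R : Finset ℕ, ∏ j ∈ range m, ((1 + x) ^ (range (j + 1) \ R).card - 1) =
      ∑ C ∈ (range m).powerset, (-1) ^ C.card *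
        (1 + x) ^ ((cells m).filter fun p => p.1 ∉ R ∧ p.2 ∉ C).card := by
    intro R
    simp_rw [sub_eq_neg_add]
    rw [prod_add]
    refine sum_congr rfl fun C _ => ?_
    rw [card_cells_filter, prod_const, prod_pow_eq_pow_sum]
  simp_rw [h1, h2, prod_ite_exists, ← sum_powerset_avoiding, sum_mul_sum, sum_mul, mul_sum]
  rw [sum_comm]
  refine sum_congr rfl fun R _ => ?_
  rw [sum_comm]
  refine sum_congr rfl fun C _ => sum_congr rfl fun S _ => ?_
  ring

/-- The signed contribution to the generating function of the supports of dimension `m` of the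
row sets with `k` elements. -/
noncomputable def rowSum (q : A) (m k : ℕ) : A :=
  ∑ R ∈ (range m).powerset, if (range m \ R).card = k then
    (-1) ^ R.card * ∏ j ∈ range m, (q ^ (range (j + 1) \ R).card - 1) else 0

theorem sum_supports_eq_sum_rowSum (x : A) (m : ℕ) :
    ∑ S ∈ supports m, x ^ S.card = ∑ k ∈ range (m + 1), rowSum (1 + x) m k := by
  rw [sum_supports]
  simp only [rowSum]
  rw [sum_comm]
  refine sum_congr rfl fun R _ => ?_
  rw [sum_ite_eq, if_pos]
  have := card_le_card (sdiff_subset (s := range m) (t := R))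
  rw [card_range] at this
  rw [mem_range]
  omega

theorem rowSum_zero_left (q : A) (k : ℕ) : rowSum q 0 k = if k = 0 then 1 else 0 := by
  simp [rowSum, eq_comm]

theorem rowSum_succ (q : A) (m k : ℕ) :
    rowSum q (m + 1) k = (q ^ k - 1) *
      ((if k = 0 then 0 else rowSum q m (k - 1)) - rowSum q m k) := by
  have hcol : ∀ R ∈ (range m).powerset, ∀ j ∈ range m,
      range (j + 1) \ insert m R = range (j + 1) \ R := by
    intro R _ j hj
    ext i
    simp only [mem_sdiff, mem_range, mem_insert] at *
    grind
  have h0 : ∀ R ∈ (range m).powerset, (range (m + 1) \ R).card = (range m \ R).card + 1 := by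
    intro R hR
    have : m ∉ R := fun h => by simpa using mem_powerset.1 hR h
    rw [range_add_one, insert_sdiff_of_notMem _ this, card_insert_of_notMem (by simp)]
  have h1 : ∀ R ∈ (range m).powerset, range (m + 1) \ insert m R = range m \ R := by
    intro R _
    ext i
    simp only [mem_sdiff, mem_range, mem_insert]
    grind
  have hm : ∀ R ∈ (range m).powerset, (insert m R).card = R.card + 1 := by
    intro R hR
    exact card_insert_of_notMem fun h => by simpa using mem_powerset.1 hR h
  unfold rowSum
  conv_lhs => rw [range_add_one (n := m), sum_powerset_insert (by simp)]
  simp only [← range_add_one]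
  rw [mul_sub, sub_eq_add_neg]
  congr 1
  · rcases Nat.eq_zero_or_pos k with rfl | hk
    · simp only [pow_zero, sub_self, zero_mul]
      refine sum_eq_zero fun R hR => ?_
      rw [if_neg]
      rw [h0 R hR]
      omega
    · rw [if_neg hk.ne', mul_sum]
      refine sum_congr rfl fun R hR => ?_
      rw [h0 R hR, mul_ite, mul_zero]
      refine if_ctx_congr (by omega) (fun h => ?_) fun _ => rfl
      rw [prod_range_succ, h0 R hR, h, Nat.sub_add_cancel hk]
      ring
  · rw [mul_sum, ← sum_neg_distrib]
    refine sum_congr rfl fun R hR => ?_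
    rw [h1 R hR, mul_ite, mul_zero]
    by_cases h : (range m \ R).card = k
    · rw [if_pos h, if_pos h, prod_range_succ, h1 R hR, h, hm R hR,
        prod_congr rfl fun j hj => by rw [hcol R hR j hj]]
      ring
    · rw [if_neg h, if_neg h, neg_zero]

end GeneratingFunction

end FishburnMatrix

namespace FishburnMatrix

open Finset PowerSeries

variable {A : Type*} [CommRing A]

theorem rowSum_eq_zero {m k : ℕ} (h : m < k) (q : A) : rowSum q m k = 0 := by
  refine sum_eq_zero fun R _ => if_neg ?_
  have := card_le_card (sdiff_subset (s := range m) (t := R))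
  rw [card_range] at this
  omega

theorem X_dvd_one_add_X_pow_sub_one (k : ℕ) : (X : A⟦X⟧) ∣ (1 + X) ^ k - 1 := by
  have := sub_dvd_pow_sub_pow (1 + X : A⟦X⟧) 1 k
  rwa [add_sub_cancel_left, one_pow] at this

theorem X_pow_dvd_rowSum (m k : ℕ) : (X : A⟦X⟧) ^ m ∣ rowSum (1 + X) m k := by
  induction m generalizing k with
  | zero => simp
  | succ m ih =>
    rw [rowSum_succ, pow_succ']
    refine mul_dvd_mul (X_dvd_one_add_X_pow_sub_one k) (dvd_sub ?_ (ih k))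
    split_ifs
    · exact dvd_zero _
    · exact ih _

theorem pow_mul_sum_rowSum (q : A) (M k : ℕ) :
    q ^ (k + 1) * ∑ m ∈ range (M + 1), rowSum q m (k + 1) =
      (q ^ (k + 1) - 1) * ∑ m ∈ range (M + 1), rowSum q m k - rowSum q (M + 1) (k + 1) := by
  have h : ∑ m ∈ range (M + 1), rowSum q (m + 1) (k + 1) =
      (q ^ (k + 1) - 1) * (∑ m ∈ range (M + 1), rowSum q m k -
        ∑ m ∈ range (M + 1), rowSum q m (k + 1)) := by
    rw [← sum_sub_distrib, mul_sum]
    refine sum_congr rfl fun m _ => ?_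
    rw [rowSum_succ, if_neg k.succ_ne_zero, Nat.add_sub_cancel]
  have h' := sum_range_succ' (fun m => rowSum q m (k + 1)) (M + 1)
  rw [sum_range_succ, h, rowSum_zero_left, if_neg k.succ_ne_zero] at h'
  linear_combination h'

theorem sum_rowSum_zero (q : A) (M : ℕ) : ∑ m ∈ range (M + 1), rowSum q m 0 = 1 := by
  rw [sum_range_succ', rowSum_zero_left, if_pos rfl, sum_eq_zero, zero_add]
  intro m _
  rw [rowSum_succ]
  simp

theorem X_pow_dvd_sum_rowSum_sub_prod {p : A⟦X⟧} (hp : p * (1 + X) = 1) (M k : ℕ) :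
    (X : A⟦X⟧) ^ (M + 1) ∣
      ∑ m ∈ range (M + 1), rowSum (1 + X : A⟦X⟧) m k - ∏ l ∈ range k, (1 - p ^ (l + 1)) := by
  induction k with
  | zero => simp [sum_rowSum_zero]
  | succ k ih =>
    have h1 : p ^ (k + 1) * (1 + X) ^ (k + 1) = 1 := by rw [← mul_pow, hp, one_pow]
    have h2 := pow_mul_sum_rowSum (1 + X : A⟦X⟧) M k
    have h3 := (ih.mul_left (1 - p ^ (k + 1))).sub
      ((X_pow_dvd_rowSum (A := A) (M + 1) (k + 1)).mul_left (p ^ (k + 1)))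
    rw [prod_range_succ]
    convert h3 using 1
    set V := ∑ m ∈ range (M + 1), rowSum (1 + X : A⟦X⟧) m (k + 1)
    set V' := ∑ m ∈ range (M + 1), rowSum (1 + X : A⟦X⟧) m k
    linear_combination p ^ (k + 1) * h2 + (V' - V) * h1

theorem coeff_sum_supports (n m : ℕ) :
    coeff n (∑ S ∈ supports m, (X : A⟦X⟧) ^ S.card) =
      (((supports m).filter fun S => S.card = n).card : A) := by
  rw [map_sum, card_filter, Nat.cast_sum]
  refine sum_congr rfl fun S _ => ?_
  simp [coeff_X_pow, eq_comm]

/-- The generating function of the supports of primitive Fishburn matrices, by size. -/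
theorem card_eq_coeff_sum_prod {p : A⟦X⟧} (hp : p * (1 + X) = 1) (n : ℕ) :
    (Nat.card {S : Finset (ℕ × ℕ) // S.card = n ∧ ∃ m, IsFishburnSupport m S} : A) =
      coeff n (∑ k ∈ range (n + 1), ∏ l ∈ range k, (1 - p ^ (l + 1))) := by
  rw [card_eq_sum_supports, Nat.cast_sum]
  simp_rw [← coeff_sum_supports]
  rw [← map_sum]
  have h : ∀ m ∈ range (n + 1), ∑ S ∈ supports m, (X : A⟦X⟧) ^ S.card =
      ∑ k ∈ range (n + 1), rowSum (1 + X) m k := by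
    intro m hm
    rw [sum_supports_eq_sum_rowSum]
    refine sum_subset (fun i => by grind) fun i _ hi => rowSum_eq_zero ?_ _
    simpa using hi
  rw [sum_congr rfl h, sum_comm, ← sub_eq_zero, ← map_sub, ← sum_sub_distrib]
  exact X_pow_dvd_iff.1 (dvd_sum fun k _ => X_pow_dvd_sum_rowSum_sub_prod hp n k) n n.lt_succ_self

end FishburnMatrix

namespace BinomialPower

open Finset Polynomial

section Powers

variable {A : Type*} [CommRing A] [Module ℚ≥0 A]

/-- The formal power `(1 + X) ^ P`. -/
noncomputable def pw (P : A) : PowerSeries A :=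
  PowerSeries.binomialSeries A P

theorem coeff_pw (P : A) (n : ℕ) : PowerSeries.coeff n (pw P) = Ring.choose P n := by
  simp [pw, PowerSeries.binomialSeries_coeff]

theorem pw_add (P R : A) : pw (P + R) = pw P * pw R :=
  PowerSeries.binomialSeries_add P R

theorem pw_zero : pw (0 : A) = 1 :=
  PowerSeries.binomialSeries_zero

theorem pw_one : pw (1 : A) = 1 + PowerSeries.X := by
  simpa [pw] using PowerSeries.binomialSeries_nat (R := A) (A := A) 1

theorem pw_nsmul (P : A) (n : ℕ) : pw (n * P) = pw P ^ n := by
  induction n with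
  | zero => simp [pw_zero]
  | succ n ih => rw [Nat.cast_succ, add_mul, one_mul, pw_add, ih, pow_succ]

theorem map_pw {B : Type*} [CommRing B] [Module ℚ≥0 B] (f : A →+* B) (P : A) :
    PowerSeries.map f (pw P) = pw (f P) := by
  ext n
  rw [PowerSeries.coeff_map, coeff_pw, coeff_pw, Ring.map_choose]

theorem constantCoeff_pw (P : A) : PowerSeries.constantCoeff (pw P) = 1 := by
  rw [← PowerSeries.coeff_zero_eq_constantCoeff_apply, coeff_pw, Ring.choose_zero_right]

theorem X_dvd_one_sub_pw (P : A) : PowerSeries.X ∣ 1 - pw P := by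
  rw [PowerSeries.X_dvd_iff, map_sub, constantCoeff_pw, map_one, sub_self]

theorem factorial_mul_choose (P : A) (n : ℕ) :
    (n.factorial : A) * Ring.choose P n = ∏ i ∈ range n, (P - i) := by
  rw [← nsmul_eq_mul, ← Ring.descPochhammer_eq_factorial_smul_choose]
  induction n with
  | zero => simp [smeval_one]
  | succ n ih =>
    rw [descPochhammer_succ_right, smeval_mul, ih, prod_range_succ, smeval_sub, smeval_X,
      smeval_natCast, npow_zero, nsmul_one, npow_one]

end Powers

section Moments

variable {A : Type*} [CommRing A] [Algebra ℂ A] (μ : ℕ → ℂ)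

/-- The linear functional on polynomials with given moments. -/
noncomputable def momentFunctional : A[X] →ₗ[A] A :=
  lsum fun j => LinearMap.mulLeft A (algebraMap ℂ A (μ j))

theorem momentFunctional_C_mul_X_pow (c : A) (j : ℕ) :
    momentFunctional μ (C c * X ^ j) = algebraMap ℂ A (μ j) * c := by
  rw [C_mul_X_pow_eq_monomial, momentFunctional, lsum_apply, sum_monomial_index] <;> simp

theorem momentFunctional_C_mul (c : A) (p : A[X]) :
    momentFunctional μ (C c * p) = c * momentFunctional μ p := by
  rw [← smul_eq_C_mul, map_smul, smul_eq_mul]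

theorem momentFunctional_add_comp
    (hμ : ∀ j, ∑ i ∈ range (j + 1), (j.choose i : ℂ) *
      ((3 / 2) ^ (j - i) + (-(3 / 2)) ^ (j - i)) * μ i = 1 - (-1) ^ j) (p : A[X]) :
    momentFunctional μ (p.comp (X + C (algebraMap ℂ A (3 / 2)))) +
      momentFunctional μ (p.comp (X + C (-algebraMap ℂ A (3 / 2)))) = p.eval 1 - p.eval (-1) := by
  have key : ∀ (j : ℕ) (c : ℂ), momentFunctional μ ((X + C (algebraMap ℂ A c)) ^ j) =
      algebraMap ℂ A (∑ i ∈ range (j + 1), (j.choose i : ℂ) * c ^ (j - i) * μ i) := by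
    intro j c
    rw [add_pow, map_sum, map_sum]
    refine sum_congr rfl fun i _ => ?_
    have : (X : A[X]) ^ i * C (algebraMap ℂ A c) ^ (j - i) * (j.choose i : A[X]) =
        C (algebraMap ℂ A c ^ (j - i) * (j.choose i : A)) * X ^ i := by
      simp only [map_mul, map_pow, map_natCast]
      ring
    rw [this, momentFunctional_C_mul_X_pow]
    simp only [map_mul, map_pow, map_natCast]
    ring
  induction p using Polynomial.induction_on' with
  | add p q hp hq =>
    simp only [add_comp, map_add, eval_add]
    linear_combination hp + hq
  | monomial j c =>
    have h := congrArg (algebraMap ℂ A) (hμ j)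
    rw [← C_mul_X_pow_eq_monomial]
    simp only [mul_comp, C_comp, pow_comp, X_comp, momentFunctional_C_mul, ← map_neg, key,
      eval_mul, eval_C, eval_pow, eval_X]
    rw [← mul_add, ← map_add, ← sum_add_distrib, one_pow, ← mul_sub]
    congr 1
    rw [map_sub, map_one, map_pow, map_neg, map_one] at h
    rw [← h]
    congr 1
    exact sum_congr rfl fun i _ => by ring

end Moments

section SeriesFunctional

variable {A : Type*} [CommRing A] [Algebra ℂ A] (μ : ℕ → ℂ)

/-- The coefficientwise extension of `momentFunctional` to power series. -/
noncomputable def seriesFunctional (f : PowerSeries A[X]) : PowerSeries A :=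
  PowerSeries.mk fun n => momentFunctional μ (PowerSeries.coeff n f)

theorem coeff_seriesFunctional (f : PowerSeries A[X]) (n : ℕ) :
    PowerSeries.coeff n (seriesFunctional μ f) = momentFunctional μ (PowerSeries.coeff n f) :=
  PowerSeries.coeff_mk _ _

theorem seriesFunctional_add (f g : PowerSeries A[X]) :
    seriesFunctional μ (f + g) = seriesFunctional μ f + seriesFunctional μ g := by
  ext n
  simp [coeff_seriesFunctional]

theorem seriesFunctional_map_C_mul (s : PowerSeries A) (f : PowerSeries A[X]) :
    seriesFunctional μ (PowerSeries.map C s * f) = s * seriesFunctional μ f := by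
  ext n
  simp only [coeff_seriesFunctional, PowerSeries.coeff_mul, map_sum, PowerSeries.coeff_map,
    momentFunctional_C_mul]

theorem momentFunctional_map {B : Type*} [CommRing B] [Algebra ℂ B] (f : A →ₐ[ℂ] B) (p : A[X]) :
    momentFunctional μ (p.map f.toRingHom) = f (momentFunctional μ p) := by
  induction p using Polynomial.induction_on' with
  | add p q hp hq => simp only [Polynomial.map_add, map_add, hp, hq]
  | monomial j c =>
    rw [map_monomial, ← C_mul_X_pow_eq_monomial, ← C_mul_X_pow_eq_monomial,
      momentFunctional_C_mul_X_pow, momentFunctional_C_mul_X_pow]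
    simp

theorem seriesFunctional_map {B : Type*} [CommRing B] [Algebra ℂ B] (f : A →ₐ[ℂ] B)
    (s : PowerSeries A[X]) :
    seriesFunctional μ (PowerSeries.map (mapRingHom f.toRingHom) s) =
      PowerSeries.map f.toRingHom (seriesFunctional μ s) := by
  ext n
  simp only [coeff_seriesFunctional, PowerSeries.coeff_map, coe_mapRingHom, momentFunctional_map]
  rfl

end SeriesFunctional

section Gaussian

variable {A : Type*} [CommRing A] [Algebra ℂ A]

variable (A) in
/-- The scalar `1 / 24`. -/
noncomputable def tw : A := algebraMap ℂ A (1 / 24)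

variable (A) in
theorem tw_spec : 24 * tw A = 1 := by
  have : (24 : A) = algebraMap ℂ A 24 := (map_ofNat _ 24).symm
  rw [tw, this, ← map_mul]
  norm_num

theorem algebraMap_three_halves : algebraMap ℂ A (3 / 2) = 36 * tw A := by
  have : (36 : A) = algebraMap ℂ A 36 := (map_ofNat _ 36).symm
  rw [tw, this, ← map_mul]
  norm_num

/-- The exponent `a z - z ^ 2 / 6`. -/
noncomputable def gaussExponent (a : A) : A[X] := C a * X - C (4 * tw A) * X ^ 2

variable [Module ℚ≥0 A] (μ : ℕ → ℂ)

/-- The series whose expansion is the moment functional applied to `(1 + X) ^ (a z - z ^ 2 / 6)`. -/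
noncomputable def gaussSeries (a : A) : PowerSeries A :=
  seriesFunctional μ (pw (gaussExponent a))

theorem gaussSeries_equation
    (hμ : ∀ j, ∑ i ∈ range (j + 1), (j.choose i : ℂ) *
      ((3 / 2) ^ (j - i) + (-(3 / 2)) ^ (j - i)) * μ i = 1 - (-1) ^ j) (a : A) :
    pw (36 * tw A * a + 9 * tw A) * gaussSeries μ a +
      pw (-(36 * tw A * a) - 27 * tw A) * gaussSeries μ (a + 1) =
      pw (a + 8 * tw A) - pw (-a - 16 * tw A) := by
  have ht := tw_spec A
  have htC : 24 * C (tw A) = 1 := by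
    rw [← C_1, ← ht, map_mul, map_ofNat]
  have comp1 : (gaussExponent (a + 12 * tw A)).comp (X + C (algebraMap ℂ A (3 / 2))) =
      C (36 * tw A * a + 9 * tw A) + gaussExponent a := by
    simp only [gaussExponent, algebraMap_three_halves, sub_comp, mul_comp, C_comp, X_comp, pow_comp]
    simp only [map_add, map_mul, map_ofNat]
    linear_combination (-12 * C (tw A) * X + 18 * C (tw A) -
      9 * C (tw A) * (24 * C (tw A) + 1)) * htC
  have comp2 : (gaussExponent (a + 12 * tw A)).comp (X + C (-algebraMap ℂ A (3 / 2))) =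
      C (-(36 * tw A * a) - 27 * tw A) + gaussExponent (a + 1) := by
    simp only [gaussExponent, algebraMap_three_halves, sub_comp, mul_comp, C_comp, X_comp, pow_comp]
    simp only [map_add, map_mul, map_ofNat, map_neg, map_sub, map_one]
    linear_combination ((12 * C (tw A) + 1) * X - 18 * C (tw A) -
      9 * C (tw A) * (24 * C (tw A) + 1)) * htC
  have ev1 : (gaussExponent (a + 12 * tw A)).eval 1 = a + 8 * tw A := by
    simp [gaussExponent]
    ring
  have ev2 : (gaussExponent (a + 12 * tw A)).eval (-1) = -a - 16 * tw A := by
    simp [gaussExponent]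
    ring
  have e1 : pw (36 * tw A * a + 9 * tw A) * gaussSeries μ a = seriesFunctional μ
      (PowerSeries.map (compRingHom (X + C (algebraMap ℂ A (3 / 2))))
        (pw (gaussExponent (a + 12 * tw A)))) := by
    rw [map_pw, coe_compRingHom_apply, comp1, pw_add (C _), ← map_pw C, seriesFunctional_map_C_mul,
      gaussSeries]
  have e2 : pw (-(36 * tw A * a) - 27 * tw A) * gaussSeries μ (a + 1) = seriesFunctional μ
      (PowerSeries.map (compRingHom (X + C (-algebraMap ℂ A (3 / 2))))
        (pw (gaussExponent (a + 12 * tw A)))) := by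
    rw [map_pw, coe_compRingHom_apply, comp2, pw_add (C _), ← map_pw C, seriesFunctional_map_C_mul,
      gaussSeries]
  have e3 : pw (a + 8 * tw A) = PowerSeries.map (evalRingHom 1)
      (pw (gaussExponent (a + 12 * tw A))) := by
    rw [map_pw, coe_evalRingHom, ev1]
  have e4 : pw (-a - 16 * tw A) = PowerSeries.map (evalRingHom (-1))
      (pw (gaussExponent (a + 12 * tw A))) := by
    rw [map_pw, coe_evalRingHom, ev2]
  rw [e1, e2, e3, e4]
  ext n
  simp only [map_add, map_sub, coeff_seriesFunctional, PowerSeries.coeff_map, coe_compRingHom_apply,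
    coe_evalRingHom, momentFunctional_add_comp μ hμ]

/-- The normalisation of `gaussSeries` satisfying the functional equation of the partial theta
series. -/
noncomputable def thetaMoment (a : A) : PowerSeries A :=
  pw (12 * tw A * a + tw A) * gaussSeries μ a

theorem thetaMoment_equation
    (hμ : ∀ j, ∑ i ∈ range (j + 1), (j.choose i : ℂ) *
      ((3 / 2) ^ (j - i) + (-(3 / 2)) ^ (j - i)) * μ i = 1 - (-1) ^ j) (a : A) :
    thetaMoment μ a + pw (-3 * a - 2) * thetaMoment μ (a + 1) = 1 - pw (-2 * a - 1) := by
  have ht := tw_spec A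
  have h := congrArg (pw (-a - 8 * tw A) * ·) (gaussSeries_equation μ hμ a)
  simp only [mul_add, mul_sub, ← mul_assoc, ← pw_add] at h
  rw [thetaMoment, thetaMoment, ← mul_assoc, ← pw_add, ← pw_zero]
  convert h using 4
  · linear_combination -a * ht
  · linear_combination (2 * a + 2) * ht
  · ring
  · linear_combination ht

theorem map_thetaMoment {B : Type*} [CommRing B] [Algebra ℂ B] [Module ℚ≥0 B] (f : A →ₐ[ℂ] B)
    (a : A) : PowerSeries.map f.toRingHom (thetaMoment μ a) = thetaMoment μ (f a) := by
  have htw : f (tw A) = tw B := by simp [tw]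
  have h : mapRingHom f.toRingHom (gaussExponent a) = gaussExponent (f a) := by
    simp only [gaussExponent, map_sub, map_mul, coe_mapRingHom, map_C, map_X, map_pow,
      AlgHom.toRingHom_eq_coe, RingHom.coe_coe, htw, map_ofNat]
  rw [thetaMoment, thetaMoment, map_mul, gaussSeries, gaussSeries, ← seriesFunctional_map, map_pw,
    map_pw, h]
  simp [htw, map_ofNat]

end Gaussian

section PartialTheta

variable {A : Type*} [CommRing A] [Module ℚ≥0 A]

/-- The product of the `1 - (1 + X) ^ (-(a + i))` over `1 ≤ i ≤ n`. -/
noncomputable def shiftedProd (n : ℕ) (a : A) : PowerSeries A :=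
  ∏ i ∈ range n, (1 - pw (-a - ((i : A) + 1)))

/-- A truncated partial theta series. -/
noncomputable def partialTheta (M : ℕ) (a : A) : PowerSeries A :=
  ∑ n ∈ range M, shiftedProd n a * pw (-a) ^ n

theorem X_pow_dvd_shiftedProd (n : ℕ) (a : A) : PowerSeries.X ^ n ∣ shiftedProd n a := by
  have := prod_dvd_prod_of_dvd (s := range n) (fun _ => (PowerSeries.X : PowerSeries A))
    (fun i => 1 - pw (-a - ((i : A) + 1))) fun i _ => X_dvd_one_sub_pw _
  rwa [prod_const, card_range] at this

theorem shiftedProd_add_one (n : ℕ) (a : A) :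
    (1 - pw (-(a + 1))) * shiftedProd n (a + 1) = shiftedProd (n + 1) a := by
  rw [shiftedProd, shiftedProd, prod_range_succ', mul_comm]
  congr 1
  · refine prod_congr rfl fun i _ => ?_
    congr 2
    push_cast
    ring
  · congr 2
    push_cast
    ring

theorem shiftedProd_succ_mul (n : ℕ) (a : A) :
    shiftedProd (n + 1) a * pw (-a - ((n + 1 : ℕ) + 1)) =
      shiftedProd (n + 1) a - shiftedProd (n + 2) a := by
  rw [shiftedProd, shiftedProd, prod_range_succ _ (n + 1)]
  ring

theorem partialTheta_equation (M : ℕ) (a : A) :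
    PowerSeries.X ^ M ∣ (1 - pw (-a)) * partialTheta M a +
      pw (-3 * a - 2) * ((1 - pw (-(a + 1))) * partialTheta M (a + 1)) -
        (1 - pw (-2 * a - 1)) := by
  set w : ℕ → PowerSeries A := fun n =>
    shiftedProd n a * pw (-a) ^ n + shiftedProd (n + 1) a * pw (-a) ^ (n + 1) -
      shiftedProd n a * pw (-a) ^ (n + 1) with hw
  have hsum : (1 - pw (-a)) * partialTheta M a +
      pw (-3 * a - 2) * ((1 - pw (-(a + 1))) * partialTheta M (a + 1)) =
      ∑ n ∈ range M, (w n - w (n + 1)) := by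
    rw [partialTheta, partialTheta, mul_sum, mul_sum, mul_sum, ← sum_add_distrib]
    refine sum_congr rfl fun n _ => ?_
    have h1 : pw (-3 * a - 2) * pw (-(a + 1)) ^ n =
        pw (-a - ((n + 1 : ℕ) + 1)) * pw (-a) ^ (n + 2) := by
      rw [← pw_nsmul, ← pw_nsmul, ← pw_add, ← pw_add]
      congr 1
      push_cast
      ring
    have h2 := shiftedProd_add_one n a
    have h3 := shiftedProd_succ_mul n a
    simp only [hw]
    linear_combination (1 - pw (-(a + 1))) * shiftedProd n (a + 1) * h1 +
      pw (-a - ((n + 1 : ℕ) + 1)) * pw (-a) ^ (n + 2) * h2 + pw (-a) ^ (n + 2) * h3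
  have h0 : w 0 = 1 - pw (-2 * a - 1) := by
    have : pw (-a - 1) * pw (-a) = pw (-2 * a - 1) := by
      rw [← pw_add]
      congr 1
      ring
    simp only [hw, shiftedProd, prod_range_zero, prod_range_succ, Nat.cast_zero, zero_add, ← this]
    ring
  rw [hsum, sum_range_sub', h0, sub_sub_cancel_left, dvd_neg]
  refine dvd_sub (dvd_add ?_ ?_) ?_
  · exact (X_pow_dvd_shiftedProd M a).mul_right _
  · exact ((pow_dvd_pow _ M.le_succ).trans (X_pow_dvd_shiftedProd (M + 1) a)).mul_right _
  · exact (X_pow_dvd_shiftedProd M a).mul_right _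

theorem map_partialTheta {B : Type*} [CommRing B] [Module ℚ≥0 B] (f : A →+* B) (M : ℕ) (a : A) :
    PowerSeries.map f (partialTheta M a) = partialTheta M (f a) := by
  simp [partialTheta, shiftedProd, map_pw]

end PartialTheta

theorem eq_zero_of_add_comp_eq_zero {p : ℂ[X]} (h : p + p.comp (X + 1) = 0) : p = 0 := by
  have h2 : (p.comp (X + 1)).leadingCoeff = p.leadingCoeff := by
    have : (X + 1 : ℂ[X]).natDegree = 1 := natDegree_X_add_C 1
    rw [leadingCoeff_comp (by rw [this]; simp)]
    have : (X + 1 : ℂ[X]).leadingCoeff = 1 := leadingCoeff_X_add_C 1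
    rw [this, one_pow, mul_one]
  rw [eq_neg_of_add_eq_zero_right h, leadingCoeff_neg] at h2
  exact leadingCoeff_eq_zero.1 (CharZero.eq_neg_self_iff.1 h2.symm)

theorem X_pow_dvd_of_shift_equation {M : ℕ} {E g : PowerSeries ℂ[X]}
    (hg : PowerSeries.constantCoeff g = 1)
    (h : PowerSeries.X ^ M ∣ E + g * PowerSeries.map (aeval (R := ℂ) (X + 1)).toRingHom E) :
    PowerSeries.X ^ M ∣ E := by
  rw [PowerSeries.X_pow_dvd_iff] at h ⊢
  intro n
  induction n using Nat.strong_induction_on with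
  | _ n ih =>
    intro hn
    refine eq_zero_of_add_comp_eq_zero ?_
    rw [← h n hn, map_add, PowerSeries.coeff_mul, sum_eq_single (0, n)]
    · simp [hg, comp_eq_aeval]
    · rintro ⟨i, j⟩ hij hne
      rw [HasAntidiagonal.mem_antidiagonal] at hij
      have hj : j < n := by
        rcases Nat.eq_zero_or_pos i with rfl | hi
        · exact absurd (by simpa using hij) (by simpa using hne)
        · simp only at hij
          omega
      rw [PowerSeries.coeff_map, ih j hj (hj.trans hn), map_zero, mul_zero]
    · simp

section Specialization

variable (μ : ℕ → ℂ)

theorem partialTheta_modEq_thetaMoment_X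
    (hμ : ∀ j, ∑ i ∈ range (j + 1), (j.choose i : ℂ) *
      ((3 / 2) ^ (j - i) + (-(3 / 2)) ^ (j - i)) * μ i = 1 - (-1) ^ j)
    (M : ℕ) :
    PowerSeries.X ^ M ∣ (1 - pw (-(X : ℂ[X]))) * partialTheta M X - thetaMoment μ (X : ℂ[X]) := by
  refine X_pow_dvd_of_shift_equation (constantCoeff_pw (-3 * X - 2)) ?_
  have h1 := partialTheta_equation M (X : ℂ[X])
  have h2 := thetaMoment_equation μ hμ (X : ℂ[X])
  rw [map_sub, map_thetaMoment, map_mul, map_sub, map_one, map_pw, map_neg, map_partialTheta,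
    AlgHom.toRingHom_eq_coe, RingHom.coe_coe, aeval_X]
  convert h1 using 1
  linear_combination -h2

theorem partialTheta_modEq_thetaMoment {A : Type*} [CommRing A] [Algebra ℂ A] [Module ℚ≥0 A]
    (hμ : ∀ j, ∑ i ∈ range (j + 1), (j.choose i : ℂ) *
      ((3 / 2) ^ (j - i) + (-(3 / 2)) ^ (j - i)) * μ i = 1 - (-1) ^ j)
    (M : ℕ) (a : A) :
    PowerSeries.X ^ M ∣ (1 - pw (-a)) * partialTheta M a - thetaMoment μ a := by
  have h := map_dvd (PowerSeries.map (aeval (R := ℂ) a).toRingHom)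
    (partialTheta_modEq_thetaMoment_X μ hμ M)
  rw [map_sub, map_thetaMoment, map_mul, map_sub, map_one, map_pw, map_neg, map_partialTheta,
    map_pow, PowerSeries.map_X] at h
  simpa using h

end Specialization

section FirstOrder

/-- The coefficients of the formal logarithm of `1 + X`. -/
noncomputable def logCoeff : ℕ → ℂ
  | 0 => 0
  | k + 1 => (∏ i ∈ range k, (-((i : ℂ) + 1))) / (k + 1).factorial

/-- The formal logarithm of `1 + X`. -/
noncomputable def logSeries : PowerSeries ℂ := PowerSeries.mk logCoeff

variable {A : Type*} [CommRing A] [Algebra ℂ A]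

theorem mul_prod_of_sq_eq_zero {e : A} (he : e * e = 0) (t : A) (k : ℕ) :
    e * ∏ i ∈ range k, (e * t - ((i : A) + 1)) =
      e * algebraMap ℂ A (∏ i ∈ range k, (-((i : ℂ) + 1))) := by
  induction k with
  | zero => simp
  | succ k ih =>
    rw [prod_range_succ, prod_range_succ, map_mul]
    simp only [map_neg, map_add, map_natCast, map_one]
    linear_combination (-((k : A) + 1)) * ih +
      t * (∏ i ∈ range k, (e * t - ((i : A) + 1))) * he

theorem pw_of_sq_eq_zero [Module ℚ≥0 A] {e : A} (he : e * e = 0) (t : A) :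
    pw (e * t) = 1 + PowerSeries.C (e * t) * PowerSeries.map (algebraMap ℂ A) logSeries := by
  ext n
  rw [map_add, PowerSeries.coeff_C_mul, PowerSeries.coeff_map, coeff_pw, logSeries,
    PowerSeries.coeff_mk, PowerSeries.coeff_one]
  cases n with
  | zero => simp [logCoeff]
  | succ k =>
    have hu : ((k + 1).factorial : ℂ) ≠ 0 := Nat.cast_ne_zero.2 (Nat.factorial_ne_zero _)
    have hu' : algebraMap ℂ A ((k + 1).factorial : ℂ)⁻¹ * ((k + 1).factorial : A) = 1 := by
      rw [← map_natCast (algebraMap ℂ A), ← map_mul, inv_mul_cancel₀ hu, map_one]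
    have h := factorial_mul_choose (e * t) (k + 1)
    rw [prod_range_succ'] at h
    simp only [Nat.cast_add, Nat.cast_one, Nat.cast_zero, sub_zero] at h
    have h' := mul_prod_of_sq_eq_zero he t k
    rw [if_neg k.succ_ne_zero, zero_add, logCoeff, div_eq_mul_inv, map_mul]
    linear_combination -Ring.choose (e * t) (k + 1) * hu' +
      algebraMap ℂ A ((k + 1).factorial : ℂ)⁻¹ * h +
      algebraMap ℂ A ((k + 1).factorial : ℂ)⁻¹ * t * h'

theorem momentFunctional_eq_zero_of_comp_neg {μ : ℕ → ℂ} (heven : ∀ i, μ (2 * i) = 0) {p : A[X]}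
    (hp : p.comp (-X) = p) : momentFunctional μ p = 0 := by
  have h : ∀ p : A[X], momentFunctional μ (p.comp (-X)) = -momentFunctional μ p := by
    intro p
    induction p using Polynomial.induction_on' with
    | add p q hp hq =>
      rw [add_comp, map_add, map_add, hp, hq]
      ring
    | monomial j c =>
      rw [← C_mul_X_pow_eq_monomial, mul_comp, C_comp, pow_comp, X_comp, neg_pow,
        momentFunctional_C_mul_X_pow]
      rcases Nat.even_or_odd' j with ⟨i, rfl | rfl⟩
      · simp [heven, momentFunctional_C_mul_X_pow]
      · rw [pow_succ, pow_mul]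
        simp only [neg_one_sq, one_pow, one_mul, neg_mul, mul_neg, map_neg,
          momentFunctional_C_mul_X_pow]
  have h2 := h p
  rw [hp] at h2
  have h3 : algebraMap ℂ A (1 / 2) * 2 = 1 := by
    rw [← map_ofNat (algebraMap ℂ A) 2, ← map_mul]
    norm_num
  linear_combination algebraMap ℂ A (1 / 2) * h2 - momentFunctional μ p * h3

theorem gaussSeries_zero [Module ℚ≥0 A] {μ : ℕ → ℂ} (heven : ∀ i, μ (2 * i) = 0) :
    gaussSeries μ (0 : A) = 0 := by
  ext n
  rw [gaussSeries, coeff_seriesFunctional, map_zero]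
  refine momentFunctional_eq_zero_of_comp_neg heven ?_
  have := congrArg (PowerSeries.coeff n)
    (map_pw (compRingHom (-X)) (gaussExponent (0 : A)))
  rw [PowerSeries.coeff_map, coe_compRingHom_apply, coe_compRingHom_apply] at this
  rw [this]
  simp [gaussExponent]

theorem gaussSeries_of_sq_eq_zero [Module ℚ≥0 A] {μ : ℕ → ℂ} (heven : ∀ i, μ (2 * i) = 0) {e : A}
    (he : e * e = 0) :
    gaussSeries μ e = PowerSeries.C e * PowerSeries.map (algebraMap ℂ A) logSeries *
      seriesFunctional μ (PowerSeries.C X * pw (gaussExponent 0)) := by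
  have h0 : gaussExponent e = C e * X + gaussExponent 0 := by
    simp [gaussExponent, sub_eq_add_neg]
  have heC : C e * C e = 0 := by rw [← C_mul, he, C_0]
  have halg : PowerSeries.map (algebraMap ℂ A[X]) logSeries =
      PowerSeries.map C (PowerSeries.map (algebraMap ℂ A) logSeries) := by
    ext n
    simp [Polynomial.algebraMap_apply]
  have h1 : pw (gaussExponent e) = pw (gaussExponent 0) +
      PowerSeries.map C (PowerSeries.C e * PowerSeries.map (algebraMap ℂ A) logSeries) *
        (PowerSeries.C X * pw (gaussExponent 0)) := by
    rw [h0, pw_add, pw_of_sq_eq_zero heC, halg, map_mul, map_mul, PowerSeries.map_C]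
    ring
  rw [gaussSeries, h1, seriesFunctional_add, seriesFunctional_map_C_mul, ← gaussSeries,
    gaussSeries_zero heven, zero_add]

end FirstOrder

section Identity

variable {μ : ℕ → ℂ}

theorem X_pow_dvd_map_fst {M : ℕ} {G : PowerSeries (DualNumber ℂ)}
    (h : PowerSeries.X ^ M ∣ PowerSeries.C DualNumber.eps * G) :
    PowerSeries.X ^ M ∣ PowerSeries.map (TrivSqZeroExt.fstHom ℂ ℂ ℂ).toRingHom G := by
  rw [PowerSeries.X_pow_dvd_iff] at h ⊢
  intro m hm
  have := congrArg TrivSqZeroExt.snd (h m hm)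
  rw [PowerSeries.coeff_C_mul] at this
  rw [PowerSeries.coeff_map]
  simpa using this

theorem not_X_dvd_of_constantCoeff {u : PowerSeries ℂ} (h : PowerSeries.constantCoeff u = 1) :
    ¬ PowerSeries.X ∣ u := by
  rw [PowerSeries.X_dvd_iff, h]
  exact one_ne_zero

theorem X_pow_dvd_log_mul
    (hμ : ∀ j, ∑ i ∈ range (j + 1), (j.choose i : ℂ) *
      ((3 / 2) ^ (j - i) + (-(3 / 2)) ^ (j - i)) * μ i = 1 - (-1) ^ j)
    (heven : ∀ i, μ (2 * i) = 0) (M : ℕ) :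
    PowerSeries.X ^ M ∣ logSeries * (partialTheta M (0 : ℂ) -
      pw (tw ℂ) * seriesFunctional μ (PowerSeries.C X * pw (gaussExponent 0))) := by
  have he : (DualNumber.eps : DualNumber ℂ) * DualNumber.eps = 0 := DualNumber.eps_mul_eps
  have h := partialTheta_modEq_thetaMoment μ hμ M (DualNumber.eps : DualNumber ℂ)
  have hy : pw (-(DualNumber.eps : DualNumber ℂ)) = 1 - PowerSeries.C DualNumber.eps *
      PowerSeries.map (algebraMap ℂ (DualNumber ℂ)) logSeries := by
    rw [← mul_neg_one, pw_of_sq_eq_zero he, mul_neg_one, map_neg]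
    ring
  rw [thetaMoment, gaussSeries_of_sq_eq_zero heven he, hy] at h
  have h2 := X_pow_dvd_map_fst (G := PowerSeries.map (algebraMap ℂ (DualNumber ℂ)) logSeries *
      (partialTheta M DualNumber.eps - pw (12 * tw _ * DualNumber.eps + tw _) *
        seriesFunctional μ (PowerSeries.C X * pw (gaussExponent 0)))) (by
    convert h using 1
    ring)
  have hlog : PowerSeries.map (TrivSqZeroExt.fstHom ℂ ℂ ℂ).toRingHom
      (PowerSeries.map (algebraMap ℂ (DualNumber ℂ)) logSeries) = logSeries := by
    ext n
    simp [TrivSqZeroExt.algebraMap_eq_inl]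
  have htw : TrivSqZeroExt.fstHom ℂ ℂ ℂ (tw (DualNumber ℂ)) = tw ℂ := AlgHom.commutes _ _
  have hg : mapRingHom (TrivSqZeroExt.fstHom ℂ ℂ ℂ).toRingHom
      (gaussExponent (0 : DualNumber ℂ)) = gaussExponent 0 := by
    simp only [gaussExponent, map_sub, map_mul, coe_mapRingHom, map_C, map_X, map_pow,
      AlgHom.toRingHom_eq_coe, RingHom.coe_coe, htw, map_ofNat, map_zero]
  rw [map_mul, hlog, map_sub, map_mul, map_pw, map_partialTheta, ← seriesFunctional_map, map_mul,
    map_pw, hg, PowerSeries.map_C] at h2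
  have hfst : TrivSqZeroExt.fst (tw (DualNumber ℂ)) = tw ℂ := htw
  simpa [hfst] using h2

theorem coeff_partialTheta
    (hμ : ∀ j, ∑ i ∈ range (j + 1), (j.choose i : ℂ) *
      ((3 / 2) ^ (j - i) + (-(3 / 2)) ^ (j - i)) * μ i = 1 - (-1) ^ j)
    (heven : ∀ i, μ (2 * i) = 0) (N : ℕ) :
    PowerSeries.coeff N (partialTheta (N + 2) (0 : ℂ)) =
      momentFunctional μ (X * Ring.choose (C (1 / 24) - C (1 / 6) * X ^ 2) N) := by
  have h := X_pow_dvd_log_mul hμ heven (N + 2)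
  have hlog : logSeries = PowerSeries.X * PowerSeries.mk fun n => logCoeff (n + 1) := by
    ext n
    cases n with
    | zero => simp [logSeries, logCoeff]
    | succ n => simp [logSeries, PowerSeries.coeff_succ_X_mul]
  rw [hlog, mul_assoc, pow_succ' _ (N + 1), mul_dvd_mul_iff_left PowerSeries.X_ne_zero] at h
  have h2 := PowerSeries.X_prime.pow_dvd_of_dvd_mul_left _
    (not_X_dvd_of_constantCoeff (by simp [logCoeff])) h
  have h3 := PowerSeries.X_pow_dvd_iff.1 h2 N N.lt_succ_self
  rw [map_sub, sub_eq_zero] at h3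
  rw [h3, ← seriesFunctional_map_C_mul, map_pw, coeff_seriesFunctional, mul_left_comm, ← pw_add,
    PowerSeries.coeff_C_mul, coeff_pw]
  congr 3
  simp only [gaussExponent, tw]
  rw [C_0, zero_mul, zero_sub, ← sub_eq_add_neg]
  congr 3
  norm_num

end Identity

/-- The elementary symmetric polynomials of `c, c - 1, …, c - n + 1`. -/
noncomputable def fallingEsymm (c : ℂ) : ℕ → ℕ → ℂ
  | 0, 0 => 1
  | 0, _ + 1 => 0
  | n + 1, 0 => fallingEsymm c n 0
  | n + 1, j + 1 => fallingEsymm c n (j + 1) + (c - n) * fallingEsymm c n j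

theorem fallingEsymm_zero_right (c : ℂ) (n : ℕ) : fallingEsymm c n 0 = 1 := by
  induction n with
  | zero => rfl
  | succ n ih => exact ih

theorem fallingEsymm_succ_succ (c : ℂ) (n j : ℕ) : fallingEsymm c (n + 1) (j + 1) =
    fallingEsymm c n (j + 1) + (c - n) * fallingEsymm c n j := rfl

theorem fallingEsymm_eq_zero (c : ℂ) {n j : ℕ} (h : n < j) : fallingEsymm c n j = 0 := by
  induction n generalizing j with
  | zero =>
    obtain ⟨j, rfl⟩ := Nat.exists_eq_succ_of_ne_zero h.ne'
    rfl
  | succ n ih =>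
    obtain ⟨j, rfl⟩ := Nat.exists_eq_succ_of_ne_zero (Nat.ne_zero_of_lt h)
    rw [Nat.succ_eq_add_one, fallingEsymm_succ_succ, ih (by omega), ih (by omega)]
    ring

theorem prod_add_falling {A : Type*} [CommRing A] [Algebra ℂ A] (c : ℂ) (Y : A) (n : ℕ) :
    ∏ i ∈ range n, (Y + algebraMap ℂ A (c - i)) =
      ∑ j ∈ range (n + 1), algebraMap ℂ A (fallingEsymm c n j) * Y ^ (n - j) := by
  induction n with
  | zero => simp [fallingEsymm_zero_right]
  | succ n ih =>
    have h1 : ∑ j ∈ range (n + 1), algebraMap ℂ A (fallingEsymm c n j) * Y ^ (n + 1 - j) =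
        (∑ j ∈ range (n + 1), algebraMap ℂ A (fallingEsymm c n j) * Y ^ (n - j)) * Y := by
      rw [sum_mul]
      refine sum_congr rfl fun j hj => ?_
      rw [Nat.succ_sub (Nat.lt_succ_iff.1 (mem_range.1 hj)), pow_succ, mul_assoc]
    have h2 : ∑ j ∈ range (n + 1), algebraMap ℂ A (fallingEsymm c n j) * Y ^ (n + 1 - j) =
        ∑ j ∈ range (n + 1), algebraMap ℂ A (fallingEsymm c n (j + 1)) * Y ^ (n - j) +
          Y ^ (n + 1) := by
      have h := sum_range_succ'
        (fun j => algebraMap ℂ A (fallingEsymm c n j) * Y ^ (n + 1 - j)) (n + 1)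
      rw [sum_range_succ, fallingEsymm_eq_zero c n.lt_succ_self, fallingEsymm_zero_right] at h
      simpa [Nat.add_sub_add_right] using h
    rw [prod_range_succ, ih, mul_add, ← h1, h2, sum_range_succ' _ (n + 1), fallingEsymm_zero_right]
    simp only [fallingEsymm_succ_succ, map_add, map_mul, add_mul, sum_add_distrib,
      Nat.add_sub_add_right]
    simp only [sum_mul, map_one, one_mul, Nat.sub_zero]
    have : ∀ j ∈ range (n + 1), algebraMap ℂ A (c - n) * algebraMap ℂ A (fallingEsymm c n j) *
        Y ^ (n - j) = algebraMap ℂ A (fallingEsymm c n j) * Y ^ (n - j) *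
          algebraMap ℂ A (c - n) := fun j _ => by ring
    rw [sum_congr rfl this]
    ring

theorem factorial_mul_card {μ : ℕ → ℂ}
    (hμ : ∀ j, ∑ i ∈ range (j + 1), (j.choose i : ℂ) *
      ((3 / 2) ^ (j - i) + (-(3 / 2)) ^ (j - i)) * μ i = 1 - (-1) ^ j)
    (heven : ∀ i, μ (2 * i) = 0) (N : ℕ) :
    (N.factorial : ℂ) *
      (Nat.card {S : Finset (ℕ × ℕ) // S.card = N ∧ ∃ m, IsFishburnSupport m S} : ℂ) =
      ∑ j ∈ range (N + 1), fallingEsymm (1 / 24) N j *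
        ((-(1 / 6)) ^ (N - j) * μ (2 * (N - j) + 1)) := by
  have hp : pw (-1 : ℂ) * (1 + PowerSeries.X) = 1 := by
    rw [← pw_one, ← pw_add, neg_add_cancel, pw_zero]
  have hcard : (Nat.card {S : Finset (ℕ × ℕ) // S.card = N ∧ ∃ m, IsFishburnSupport m S} : ℂ) =
      PowerSeries.coeff N (partialTheta (N + 2) (0 : ℂ)) := by
    have hd : PowerSeries.coeff N (shiftedProd (N + 1) (0 : ℂ)) = 0 :=
      PowerSeries.X_pow_dvd_iff.1 (X_pow_dvd_shiftedProd (N + 1) (0 : ℂ)) N N.lt_succ_self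
    rw [FishburnMatrix.card_eq_coeff_sum_prod hp, partialTheta, sum_range_succ _ (N + 1),
      neg_zero, pw_zero]
    simp only [one_pow, mul_one, map_add, hd, add_zero]
    congr 1
    refine sum_congr rfl fun k _ => prod_congr rfl fun i _ => ?_
    rw [← pw_nsmul]
    congr 2
    push_cast
    ring
  have hfac : (N.factorial : ℂ[X]) = C (N.factorial : ℂ) := by simp
  rw [hcard, coeff_partialTheta hμ heven, ← momentFunctional_C_mul, mul_left_comm, ← hfac,
    factorial_mul_choose]
  have h := prod_add_falling (1 / 24) (-(C (1 / 6) * X ^ 2) : ℂ[X]) N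
  have h' : ∏ i ∈ range N, (C (1 / 24) - C (1 / 6) * X ^ 2 - (i : ℂ[X])) =
      ∏ i ∈ range N, (-(C (1 / 6) * X ^ 2) + algebraMap ℂ ℂ[X] (1 / 24 - i)) := by
    refine prod_congr rfl fun i _ => ?_
    rw [Polynomial.algebraMap_apply, Algebra.algebraMap_self, RingHom.id_apply, C_sub, map_natCast]
    ring
  rw [h', h, mul_sum, map_sum]
  refine sum_congr rfl fun j _ => ?_
  have : (X : ℂ[X]) * (algebraMap ℂ ℂ[X] (fallingEsymm (1 / 24) N j) *
      (-(C (1 / 6) * X ^ 2)) ^ (N - j)) =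
      C (fallingEsymm (1 / 24) N j * (-(1 / 6)) ^ (N - j)) * X ^ (2 * (N - j) + 1) := by
    rw [← neg_mul, ← C_neg, mul_pow, ← pow_mul, pow_succ, C_mul, C_pow]
    rw [Polynomial.algebraMap_apply, Algebra.algebraMap_self, RingHom.id_apply]
    ring
  rw [this, momentFunctional_C_mul_X_pow, Algebra.algebraMap_self, RingHom.id_apply]
  ring

end BinomialPower

namespace HyperbolicMoments

open Finset Filter Topology Complex

/-- The generating function `sinh u / cosh (3 u / 2)` of the moments. -/
noncomputable def genFun (u : ℂ) : ℂ := sinh u / cosh (3 / 2 * u)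

/-- The moments: the Taylor derivatives of `genFun` at the origin. -/
noncomputable def moment (j : ℕ) : ℂ := iteratedDeriv j genFun 0

theorem contDiffAt_genFun (n : WithTop ℕ∞) : ContDiffAt ℂ n genFun 0 := by
  refine ContDiffAt.div contDiff_sinh.contDiffAt ?_ (by simp)
  exact (contDiff_cosh.comp (contDiff_const.mul contDiff_id)).contDiffAt

theorem moment_two_mul (i : ℕ) : moment (2 * i) = 0 := by
  have hodd : (fun u => genFun (-u)) = fun u => -genFun u := by
    ext u
    simp [genFun, neg_div]
  have h := iteratedDeriv_comp_neg (2 * i) genFun (0 : ℂ)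
  rw [hodd, iteratedDeriv_fun_neg, neg_zero, pow_mul, neg_one_sq, one_pow, one_smul] at h
  exact CharZero.eq_neg_self_iff.1 h.symm

theorem iteratedDeriv_exp_mul_zero (c : ℂ) (n : ℕ) :
    iteratedDeriv n (fun u => exp (c * u)) 0 = c ^ n := by
  simp [iteratedDeriv_cexp_const_mul]

theorem sum_choose_mul_moment (j : ℕ) : ∑ i ∈ range (j + 1), (j.choose i : ℂ) *
    ((3 / 2) ^ (j - i) + (-(3 / 2)) ^ (j - i)) * moment i = 1 - (-1) ^ j := by
  have hexp : ∀ c : ℂ, ContDiff ℂ (j : WithTop ℕ∞) fun u : ℂ => exp (c * u) := fun c =>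
    contDiff_exp.comp (contDiff_const.mul contDiff_id)
  have hc : ∀ᶠ u in 𝓝 (0 : ℂ), cosh (3 / 2 * u) ≠ 0 := by
    have : ContinuousAt (fun u : ℂ => cosh (3 / 2 * u)) 0 := by fun_prop
    exact this.eventually_ne (by simp)
  have heq : (genFun * fun u => exp (3 / 2 * u) + exp (-(3 / 2) * u)) =ᶠ[𝓝 0]
      ((fun u => exp (1 * u)) - fun u => exp (-1 * u)) := by
    filter_upwards [hc] with u hu
    have h1 : exp (3 / 2 * u) + exp (-(3 / 2) * u) = 2 * cosh (3 / 2 * u) := by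
      rw [cosh, neg_mul]
      ring
    rw [Pi.mul_apply, Pi.sub_apply, h1, genFun, div_mul_eq_mul_div, mul_left_comm,
      mul_div_assoc, mul_div_cancel_right₀ _ hu, sinh, one_mul, neg_one_mul]
    ring
  have h := heq.iteratedDeriv_eq j
  rw [iteratedDeriv_mul (contDiffAt_genFun _) ((hexp _).add (hexp _)).contDiffAt,
    iteratedDeriv_sub (hexp _).contDiffAt (hexp _).contDiffAt, iteratedDeriv_exp_mul_zero,
    iteratedDeriv_exp_mul_zero, one_pow] at h
  rw [← h]
  refine sum_congr rfl fun i hi => ?_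
  have hadd : iteratedDeriv (j - i) (fun u : ℂ => exp (3 / 2 * u) + exp (-(3 / 2) * u)) 0 =
      (3 / 2) ^ (j - i) + (-(3 / 2)) ^ (j - i) := by
    have hle : ((j - i : ℕ) : WithTop ℕ∞) ≤ j := by exact_mod_cast Nat.sub_le j i
    rw [← iteratedDeriv_exp_mul_zero, ← iteratedDeriv_exp_mul_zero]
    exact iteratedDeriv_add ((hexp _).of_le hle).contDiffAt ((hexp _).of_le hle).contDiffAt
  rw [hadd, moment]
  ring

/-- The entire function `sin w / w`. -/
noncomputable def sincFun : ℂ → ℂ := dslope sin 0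

theorem sincFun_mul (w : ℂ) : sincFun w * w = sin w := by
  have := sub_smul_dslope sin 0 w
  simpa [sincFun, mul_comm] using this

theorem differentiable_sincFun : Differentiable ℂ sincFun := by
  rw [← differentiableOn_univ, sincFun, differentiableOn_dslope univ_mem]
  exact differentiable_sin.differentiableOn

theorem sincFun_zero : sincFun 0 = 1 := by
  simp [sincFun]

theorem sincFun_ne_zero {w : ℂ} (hw : ‖w‖ < Real.pi) : sincFun w ≠ 0 := by
  rcases eq_or_ne w 0 with rfl | h0
  · simp [sincFun_zero]
  · intro h
    have hs := sincFun_mul w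
    rw [h, zero_mul, eq_comm, sin_eq_zero_iff] at hs
    obtain ⟨k, rfl⟩ := hs
    rw [norm_mul, norm_intCast, norm_real, Real.norm_of_nonneg Real.pi_pos.le] at hw
    have hk : (1 : ℝ) ≤ |(k : ℝ)| := by
      have : k ≠ 0 := by
        rintro rfl
        simp at h0
      exact_mod_cast Int.one_le_abs this
    nlinarith [Real.pi_pos]

/-- The generating function with its poles nearest to the origin removed. -/
noncomputable def regularFun (u : ℂ) : ℂ :=
  sinh u / (Real.pi ^ 2 / 8 * sincFun (Real.pi / 4 - 3 / 4 * (I * u)) *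
    sincFun (Real.pi / 4 + 3 / 4 * (I * u)))

theorem cosh_eq_mul_sincFun (u : ℂ) : cosh (3 / 2 * u) =
    (Real.pi ^ 2 / 8 * sincFun (Real.pi / 4 - 3 / 4 * (I * u)) *
      sincFun (Real.pi / 4 + 3 / 4 * (I * u))) * (1 + 9 / Real.pi ^ 2 * u ^ 2) := by
  have hpi : (Real.pi : ℂ) ≠ 0 := ofReal_ne_zero.2 Real.pi_ne_zero
  have h1 := sincFun_mul (Real.pi / 4 - 3 / 4 * (I * u))
  have h2 := sincFun_mul (Real.pi / 4 + 3 / 4 * (I * u))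
  have h3 : cosh (3 / 2 * u) = 2 * (sin (Real.pi / 4 - 3 / 4 * (I * u)) *
      sin (Real.pi / 4 + 3 / 4 * (I * u))) := by
    have hc := cos_sub_cos (3 / 2 * (I * u)) (Real.pi / 2)
    rw [cos_pi_div_two, sub_zero] at hc
    rw [← cos_mul_I, show 3 / 2 * u * I = 3 / 2 * (I * u) by ring, hc,
      show (3 / 2 * (I * u) + Real.pi / 2) / 2 = Real.pi / 4 + 3 / 4 * (I * u) by ring,
      show (3 / 2 * (I * u) - Real.pi / 2) / 2 = -(Real.pi / 4 - 3 / 4 * (I * u)) by ring, sin_neg]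
    ring
  rw [h3, ← h1, ← h2]
  field_simp
  ring_nf
  rw [I_sq]
  ring

theorem norm_lt_pi {u : ℂ} (hu : ‖u‖ < 2) :
    ‖Real.pi / 4 - 3 / 4 * (I * u)‖ < Real.pi ∧ ‖Real.pi / 4 + 3 / 4 * (I * u)‖ < Real.pi := by
  have h1 : ‖(Real.pi / 4 : ℂ)‖ = Real.pi / 4 := by
    rw [norm_div, norm_real, Real.norm_of_nonneg Real.pi_pos.le]
    simp
  have h2 : ‖(3 / 4 * (I * u) : ℂ)‖ = 3 / 4 * ‖u‖ := by
    simp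
  have h3 := norm_sub_le (Real.pi / 4 : ℂ) (3 / 4 * (I * u))
  have h4 := norm_add_le (Real.pi / 4 : ℂ) (3 / 4 * (I * u))
  rw [h1, h2] at h3 h4
  constructor <;> linarith [Real.pi_gt_three]

theorem differentiableOn_regularFun : DifferentiableOn ℂ regularFun (Metric.ball 0 2) := by
  intro u hu
  rw [mem_ball_zero_iff] at hu
  have h := norm_lt_pi hu
  refine DifferentiableAt.differentiableWithinAt ?_
  refine DifferentiableAt.div differentiableAt_sinh ?_ ?_
  · have h1 : Differentiable ℂ fun u : ℂ => sincFun (Real.pi / 4 - 3 / 4 * (I * u)) :=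
      differentiable_sincFun.comp (by fun_prop)
    have h2 : Differentiable ℂ fun u : ℂ => sincFun (Real.pi / 4 + 3 / 4 * (I * u)) :=
      differentiable_sincFun.comp (by fun_prop)
    exact (((differentiable_const _).mul h1).mul h2) u
  · have hpi : (Real.pi : ℂ) ≠ 0 := ofReal_ne_zero.2 Real.pi_ne_zero
    exact mul_ne_zero (mul_ne_zero (by simp [hpi]) (sincFun_ne_zero h.1)) (sincFun_ne_zero h.2)

theorem regularFun_eventuallyEq : regularFun =ᶠ[𝓝 0]
    (genFun + (fun u => u ^ 2) * fun u => 9 / Real.pi ^ 2 * genFun u) := by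
  have hc : ∀ᶠ u in 𝓝 (0 : ℂ), 1 + 9 / (Real.pi : ℂ) ^ 2 * u ^ 2 ≠ 0 := by
    have : ContinuousAt (fun u : ℂ => 1 + 9 / (Real.pi : ℂ) ^ 2 * u ^ 2) 0 := by fun_prop
    exact this.eventually_ne (by simp)
  filter_upwards [hc] with u hu
  rw [Pi.add_apply, Pi.mul_apply, genFun, regularFun, cosh_eq_mul_sincFun]
  refine (div_mul_cancel₀ (_ / _) hu).symm.trans ?_
  rw [div_div]
  ring

/-- The Taylor coefficients of `regularFun` at the origin. -/
noncomputable def regularCoeff (n : ℕ) : ℂ := iteratedDeriv n regularFun 0 / n.factorial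

theorem regularCoeff_add_two (n : ℕ) : regularCoeff (n + 2) =
    moment (n + 2) / (n + 2).factorial + 9 / Real.pi ^ 2 * (moment n / n.factorial) := by
  have hsq : ContDiff ℂ ((n + 2 : ℕ) : WithTop ℕ∞) fun u : ℂ => u ^ 2 := contDiff_id.pow 2
  have hg : ContDiffAt ℂ ((n + 2 : ℕ) : WithTop ℕ∞)
      (fun u => 9 / (Real.pi : ℂ) ^ 2 * genFun u) 0 :=
    contDiffAt_const.mul (contDiffAt_genFun _)
  have hm : ContDiffAt ℂ ((n + 2 : ℕ) : WithTop ℕ∞)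
      ((fun u : ℂ => u ^ 2) * fun u => 9 / (Real.pi : ℂ) ^ 2 * genFun u) 0 := hsq.contDiffAt.mul hg
  rw [regularCoeff, regularFun_eventuallyEq.iteratedDeriv_eq (n + 2),
    iteratedDeriv_add (contDiffAt_genFun _) hm,
    iteratedDeriv_mul hsq.contDiffAt hg, sum_eq_single 2]
  · rw [iteratedDeriv_fun_pow_zero, if_pos rfl, Nat.add_sub_cancel,
      iteratedDeriv_const_mul_field, ← moment, ← moment, Nat.cast_choose ℂ (by omega),
      Nat.add_sub_cancel]
    have h1 : ((n + 2).factorial : ℂ) ≠ 0 := Nat.cast_ne_zero.2 (Nat.factorial_ne_zero _)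
    have h2 : (n.factorial : ℂ) ≠ 0 := Nat.cast_ne_zero.2 (Nat.factorial_ne_zero _)
    have h3 : ((2).factorial : ℂ) ≠ 0 := Nat.cast_ne_zero.2 (Nat.factorial_ne_zero _)
    have hpi : (Real.pi : ℂ) ≠ 0 := ofReal_ne_zero.2 Real.pi_ne_zero
    field_simp
  · intro i _ hi
    rw [iteratedDeriv_fun_pow_zero, if_neg hi, Nat.cast_zero, mul_zero, zero_mul]
  · intro h
    simp at h

theorem regularCoeff_of_lt_two {n : ℕ} (hn : n < 2) : regularCoeff n = moment n / n.factorial := by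
  have hsq : ContDiff ℂ (n : WithTop ℕ∞) fun u : ℂ => u ^ 2 := contDiff_id.pow 2
  have hg : ContDiffAt ℂ (n : WithTop ℕ∞) (fun u => 9 / (Real.pi : ℂ) ^ 2 * genFun u) 0 :=
    contDiffAt_const.mul (contDiffAt_genFun _)
  have hm : ContDiffAt ℂ n
      ((fun u : ℂ => u ^ 2) * fun u => 9 / (Real.pi : ℂ) ^ 2 * genFun u) 0 := hsq.contDiffAt.mul hg
  rw [regularCoeff, regularFun_eventuallyEq.iteratedDeriv_eq n,
    iteratedDeriv_add (contDiffAt_genFun _) hm,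
    iteratedDeriv_mul hsq.contDiffAt hg, sum_eq_zero, add_zero, moment]
  intro i hi
  rw [iteratedDeriv_fun_pow_zero, if_neg, Nat.cast_zero, mul_zero, zero_mul]
  rw [mem_range] at hi
  omega

theorem regularCoeff_two_mul (i : ℕ) : regularCoeff (2 * i) = 0 := by
  cases i with
  | zero =>
    rw [mul_zero, regularCoeff_of_lt_two (by norm_num), show moment 0 = 0 from moment_two_mul 0,
      zero_div]
  | succ i =>
    rw [mul_add, mul_one, regularCoeff_add_two, moment_two_mul, show 2 * i + 2 = 2 * (i + 1) by ring,
      moment_two_mul, zero_div, zero_div, mul_zero, zero_add]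

/-- The pole of `genFun` nearest to the origin in the upper half plane. -/
noncomputable def pole : ℂ := Real.pi / 3 * I

theorem pole_sq : pole ^ 2 = -(Real.pi ^ 2 / 9) := by
  rw [pole, mul_pow, I_sq]
  ring

theorem moment_div_factorial_mul_pole_pow (k : ℕ) :
    moment (2 * k + 1) / (2 * k + 1).factorial * pole ^ (2 * k + 1) =
      ∑ n ∈ range (2 * k + 2), regularCoeff n * pole ^ n := by
  induction k with
  | zero =>
    have h0 := regularCoeff_two_mul 0
    rw [mul_zero] at h0
    simp [sum_range_succ, h0, regularCoeff_of_lt_two]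
  | succ k ih =>
    have hpi : (Real.pi : ℂ) ≠ 0 := ofReal_ne_zero.2 Real.pi_ne_zero
    have h9 : (9 / (Real.pi : ℂ) ^ 2) * pole ^ 2 = -1 := by
      rw [pole_sq]
      field_simp
    have h2 := regularCoeff_two_mul (k + 1)
    have h1 := regularCoeff_add_two (2 * k + 1)
    rw [show 2 * (k + 1) + 2 = 2 * k + 2 + 1 + 1 by ring, sum_range_succ, sum_range_succ, ← ih,
      show 2 * k + 2 = 2 * (k + 1) by ring, h2, show 2 * (k + 1) + 1 = 2 * k + 1 + 2 by ring, h1]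
    rw [pow_add _ (2 * k + 1) 2]
    linear_combination -(moment (2 * k + 1) / (2 * k + 1).factorial) * pole ^ (2 * k + 1) * h9

theorem regularFun_pole : regularFun pole = 2 * Real.sqrt 3 / Real.pi * I := by
  have hpi : (Real.pi : ℂ) ≠ 0 := ofReal_ne_zero.2 Real.pi_ne_zero
  have h1 : (Real.pi / 4 - 3 / 4 * (I * pole) : ℂ) = Real.pi / 2 := by
    rw [pole]
    linear_combination (-(Real.pi : ℂ) / 4) * I_sq
  have h2 : (Real.pi / 4 + 3 / 4 * (I * pole) : ℂ) = 0 := by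
    rw [pole]
    linear_combination ((Real.pi : ℂ) / 4) * I_sq
  have h3 : sincFun (Real.pi / 2) = 2 / Real.pi := by
    have := sincFun_mul (Real.pi / 2)
    rw [sin_pi_div_two] at this
    field_simp at this ⊢
    linear_combination this
  have h4 : sinh pole = Real.sqrt 3 / 2 * I := by
    rw [pole, sinh_mul_I]
    have := congrArg ((↑) : ℝ → ℂ) Real.sin_pi_div_three
    push_cast at this
    rw [this]
  rw [regularFun, h1, h2, h3, h4, sincFun_zero]
  field_simp
  ring

theorem tendsto_moment : Tendsto (fun k : ℕ => moment (2 * k + 1) / (2 * k + 1).factorial *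
    (-(Real.pi ^ 2 / 9)) ^ k) atTop (𝓝 (6 * Real.sqrt 3 / Real.pi ^ 2 : ℂ)) := by
  have hpi : (Real.pi : ℂ) ≠ 0 := ofReal_ne_zero.2 Real.pi_ne_zero
  have hp : pole ≠ 0 := by
    simp [pole, hpi]
  have hmem : pole ∈ Metric.ball (0 : ℂ) 2 := by
    rw [mem_ball_zero_iff, pole, norm_mul, norm_I, mul_one, norm_div, norm_real,
      Real.norm_of_nonneg Real.pi_pos.le]
    norm_num
    linarith [Real.pi_lt_four]
  have hs := (hasSum_taylorSeries_on_ball differentiableOn_regularFun hmem).tendsto_sum_nat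
  have hs' : Tendsto (fun k : ℕ => ∑ n ∈ range (2 * k + 2), regularCoeff n * pole ^ n) atTop
      (𝓝 (regularFun pole)) := by
    refine (hs.comp (tendsto_atTop_mono (fun k : ℕ => (by omega : k ≤ 2 * k + 2))
      tendsto_id)).congr fun k => ?_
    refine sum_congr rfl fun n _ => ?_
    rw [regularCoeff, smul_eq_mul, smul_eq_mul, sub_zero]
    ring
  have h := hs'.div_const pole
  have hlim : regularFun pole / pole = 6 * Real.sqrt 3 / Real.pi ^ 2 := by
    rw [regularFun_pole, pole]
    field_simp [I_ne_zero]
    ring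
  rw [hlim] at h
  refine h.congr fun k => ?_
  rw [← moment_div_factorial_mul_pole_pow, ← pole_sq, ← pow_mul, pow_succ]
  field_simp

end HyperbolicMoments

namespace BinomialPower

open Finset Filter Topology Asymptotics

theorem tendsto_succ_pow_sub_pow_div (m : ℕ) :
    Tendsto (fun i : ℕ => (((i : ℝ) + 1) ^ (m + 1) - (i : ℝ) ^ (m + 1)) / (i : ℝ) ^ m) atTop
      (𝓝 (m + 1)) := by
  have h := (hasDerivAt_pow (m + 1) (1 : ℝ)).tendsto_slope_zero
  have hi : Tendsto (fun i : ℕ => ((i : ℝ))⁻¹) atTop (𝓝[≠] 0) := by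
    refine tendsto_nhdsWithin_iff.2 ⟨tendsto_inv_atTop_nhds_zero_nat, ?_⟩
    filter_upwards [eventually_gt_atTop 0] with i hi
    exact inv_ne_zero (Nat.cast_ne_zero.2 hi.ne')
  have h' := h.comp hi
  simp only [one_pow, mul_one, Nat.cast_add, Nat.cast_one] at h'
  refine h'.congr' ?_
  filter_upwards [eventually_gt_atTop 0] with i hi
  have hi : (i : ℝ) ≠ 0 := Nat.cast_ne_zero.2 hi.ne'
  rw [Function.comp_apply, inv_inv, smul_eq_mul, eq_div_iff (pow_ne_zero _ hi),
    show (i : ℝ) + 1 = (1 + (i : ℝ)⁻¹) * i by field_simp, mul_pow]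
  ring

/-- A weighted Cesàro limit. -/
theorem tendsto_sum_range_div_pow {a : ℕ → ℂ} {m : ℕ} {L : ℂ}
    (h : Tendsto (fun i : ℕ => a i / (i : ℂ) ^ m) atTop (𝓝 L)) :
    Tendsto (fun n : ℕ => (∑ i ∈ range n, a i) / (n : ℂ) ^ (m + 1)) atTop
      (𝓝 (L / (m + 1))) := by
  set g : ℕ → ℝ := fun i => ((i : ℝ) + 1) ^ (m + 1) - (i : ℝ) ^ (m + 1) with hg
  have hm : ((m : ℂ) + 1) ≠ 0 := Nat.cast_add_one_ne_zero m
  have hpos : ∀ i, 0 < g i := fun i =>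
    sub_pos.2 (pow_lt_pow_left₀ (lt_add_one _) (Nat.cast_nonneg i) (Nat.succ_ne_zero m))
  have hsum : ∀ n, ∑ i ∈ range n, g i = (n : ℝ) ^ (m + 1) := fun n => by
    have := sum_range_sub (fun i : ℕ => (i : ℝ) ^ (m + 1)) n
    simpa [hg] using this
  have hlim : Tendsto (fun i => a i / (g i : ℂ)) atTop (𝓝 (L / (m + 1))) := by
    have h2 := (Complex.continuous_ofReal.tendsto _).comp (tendsto_succ_pow_sub_pow_div m)
    push_cast at h2
    refine (h.div h2 hm).congr' ?_
    filter_upwards [eventually_gt_atTop 0] with i hi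
    have hi : (i : ℂ) ≠ 0 := Nat.cast_ne_zero.2 hi.ne'
    rw [Pi.div_apply, Function.comp_apply, Complex.ofReal_div, Complex.ofReal_pow,
      Complex.ofReal_natCast, div_div_div_cancel_right₀ (pow_ne_zero _ hi)]
  have ho : (fun i => a i - L / (m + 1) * g i) =o[atTop] g := by
    rw [← Complex.isLittleO_ofReal_right,
      isLittleO_iff_tendsto fun i hi => absurd (Complex.ofReal_eq_zero.1 hi) (hpos i).ne']
    have h0 := hlim.sub_const (L / (m + 1))
    rw [sub_self] at h0
    refine h0.congr fun i => ?_
    rw [sub_div, mul_div_cancel_right₀ _ (Complex.ofReal_ne_zero.2 (hpos i).ne')]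
  have hs := ho.sum_range (fun i => (hpos i).le) (by
    simp_rw [hsum]
    exact (tendsto_pow_atTop (Nat.succ_ne_zero m)).comp tendsto_natCast_atTop_atTop)
  rw [← Complex.isLittleO_ofReal_right] at hs
  have h0 := hs.tendsto_div_nhds_zero.add_const (L / (m + 1))
  rw [zero_add] at h0
  refine h0.congr' ?_
  filter_upwards [eventually_gt_atTop 0] with n hn
  have hn : (n : ℂ) ^ (m + 1) ≠ 0 := pow_ne_zero _ (Nat.cast_ne_zero.2 hn.ne')
  rw [sum_sub_distrib, ← mul_sum, ← Complex.ofReal_sum, hsum, Complex.ofReal_pow,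
    Complex.ofReal_natCast, sub_div, mul_div_cancel_right₀ _ hn, sub_add_cancel]

theorem fallingEsymm_succ_right (c : ℂ) (n j : ℕ) :
    fallingEsymm c n (j + 1) = ∑ i ∈ range n, (c - i) * fallingEsymm c i j := by
  induction n with
  | zero => rw [fallingEsymm_eq_zero c (Nat.succ_pos j), range_zero, sum_empty]
  | succ n ih => rw [fallingEsymm_succ_succ, sum_range_succ, ih]

theorem tendsto_fallingEsymm (c : ℂ) (j : ℕ) :
    Tendsto (fun n : ℕ => fallingEsymm c n j / (n : ℂ) ^ (2 * j)) atTop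
      (𝓝 ((-(1 / 2)) ^ j / j.factorial)) := by
  induction j with
  | zero => simp [fallingEsymm_zero_right]
  | succ j ih =>
    have hc : Tendsto (fun i : ℕ => c * (i : ℂ)⁻¹ - 1) atTop (𝓝 (c * 0 - 1)) :=
      (tendsto_inv_atTop_nhds_zero_nat.const_mul c).sub_const 1
    have h : Tendsto (fun i : ℕ => (c - i) * fallingEsymm c i j / (i : ℂ) ^ (2 * j + 1)) atTop
        (𝓝 ((c * 0 - 1) * ((-(1 / 2)) ^ j / j.factorial))) := by
      refine (hc.mul ih).congr' ?_
      filter_upwards [eventually_gt_atTop 0] with i hi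
      have hi : (i : ℂ) ≠ 0 := Nat.cast_ne_zero.2 hi.ne'
      rw [pow_succ]
      field_simp
    have h' := tendsto_sum_range_div_pow h
    simp_rw [← fallingEsymm_succ_right] at h'
    rw [mul_add, mul_one]
    convert h' using 2
    have hj : (j : ℂ) + 1 ≠ 0 := Nat.cast_add_one_ne_zero j
    have hj' : 2 * (j : ℂ) + 1 + 1 ≠ 0 := by
      rw [show 2 * (j : ℂ) + 1 + 1 = 2 * (j + 1) by ring]
      exact mul_ne_zero two_ne_zero hj
    rw [Nat.factorial_succ]
    push_cast
    field_simp
    ring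

theorem pow_succ_add_mul_le_add_pow {s a : ℝ} (hs : 0 ≤ s) (ha : 0 ≤ a) (j : ℕ) :
    s ^ (j + 1) + (j + 1) * a * s ^ j ≤ (s + a) ^ (j + 1) := by
  induction j with
  | zero => simp
  | succ j ih =>
    calc s ^ (j + 1 + 1) + ((j + 1 : ℕ) + 1) * a * s ^ (j + 1)
        ≤ (s ^ (j + 1) + (j + 1) * a * s ^ j) * (s + a) := by
          have : 0 ≤ ((j : ℝ) + 1) * a * s ^ j * a := by positivity
          push_cast
          linear_combination this
      _ ≤ (s + a) ^ (j + 1) * (s + a) := by gcongr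
      _ = (s + a) ^ (j + 1 + 1) := (pow_succ _ _).symm

theorem norm_fallingEsymm_le {c : ℂ} (hc : ‖c‖ ≤ 1) (n j : ℕ) :
    ‖fallingEsymm c n j‖ ≤ (n : ℝ) ^ (2 * j) / j.factorial := by
  induction n generalizing j with
  | zero =>
    cases j with
    | zero => simp [fallingEsymm_zero_right]
    | succ j => simp [fallingEsymm_eq_zero c (Nat.succ_pos j)]
  | succ n ih =>
    cases j with
    | zero => simp [fallingEsymm_zero_right]
    | succ j =>
      have hn : ‖c - n‖ ≤ n + 1 := (norm_sub_le _ _).trans (by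
        rw [Complex.norm_natCast]
        linarith)
      have hf : (0 : ℝ) < j.factorial := Nat.cast_pos.2 j.factorial_pos
      calc ‖fallingEsymm c (n + 1) (j + 1)‖
          ≤ ‖fallingEsymm c n (j + 1)‖ + ‖c - n‖ * ‖fallingEsymm c n j‖ := by
            rw [fallingEsymm_succ_succ, ← norm_mul]
            exact norm_add_le _ _
        _ ≤ (n : ℝ) ^ (2 * (j + 1)) / (j + 1).factorial +
            (n + 1) * ((n : ℝ) ^ (2 * j) / j.factorial) := by
            gcongr
            · exact ih _
            · exact ih _
        _ = (((n : ℝ) ^ 2) ^ (j + 1) + (j + 1) * (n + 1) * ((n : ℝ) ^ 2) ^ j) /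
            (j + 1).factorial := by
            rw [Nat.factorial_succ, pow_mul, pow_mul]
            push_cast
            field_simp
        _ ≤ ((n : ℝ) ^ 2 + (n + 1)) ^ (j + 1) / (j + 1).factorial := by
            gcongr
            exact pow_succ_add_mul_le_add_pow (by positivity) (by positivity) j
        _ ≤ ((n + 1 : ℕ) : ℝ) ^ (2 * (j + 1)) / (j + 1).factorial := by
            rw [pow_mul]
            gcongr
            push_cast
            nlinarith [Nat.cast_nonneg (α := ℝ) n]

end BinomialPower

namespace FactorialAsymptotics

open Filter Topology

theorem add_pow_mul_factorial_le (m k : ℕ) :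
    ((m + k : ℕ) : ℝ) ^ k * m.factorial ≤ Real.exp 1 ^ k * (m + k).factorial := by
  induction k with
  | zero => simp
  | succ k ih =>
    have hstep : ((m + k + 1 : ℕ) : ℝ) ^ k ≤ Real.exp 1 * ((m + k : ℕ) : ℝ) ^ k := by
      rcases Nat.eq_zero_or_pos (m + k) with h | h
      · obtain ⟨rfl, rfl⟩ := Nat.add_eq_zero_iff.1 h
        simp
      · have hM : (0 : ℝ) < (m + k : ℕ) := Nat.cast_pos.2 h
        calc ((m + k + 1 : ℕ) : ℝ) ^ k
            = (((m + k : ℕ) : ℝ)⁻¹ + 1) ^ k * ((m + k : ℕ) : ℝ) ^ k := by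
              rw [← mul_pow, add_mul, inv_mul_cancel₀ hM.ne']
              push_cast
              ring
          _ ≤ Real.exp ((m + k : ℕ) : ℝ)⁻¹ ^ k * ((m + k : ℕ) : ℝ) ^ k := by
              gcongr
              exact Real.add_one_le_exp _
          _ ≤ Real.exp 1 * ((m + k : ℕ) : ℝ) ^ k := by
              rw [← Real.exp_nat_mul]
              gcongr
              rw [← div_eq_mul_inv, div_le_one hM]
              exact_mod_cast Nat.le_add_left k m
    calc ((m + (k + 1) : ℕ) : ℝ) ^ (k + 1) * m.factorial
        = (m + k + 1 : ℕ) * (((m + k + 1 : ℕ) : ℝ) ^ k * m.factorial) := by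
          rw [← add_assoc, pow_succ]
          ring
      _ ≤ (m + k + 1 : ℕ) * (Real.exp 1 * ((m + k : ℕ) : ℝ) ^ k * m.factorial) := by gcongr
      _ = (m + k + 1 : ℕ) * (Real.exp 1 * (((m + k : ℕ) : ℝ) ^ k * m.factorial)) := by ring
      _ ≤ (m + k + 1 : ℕ) * (Real.exp 1 * (Real.exp 1 ^ k * (m + k).factorial)) := by gcongr
      _ = Real.exp 1 ^ (k + 1) * (m + (k + 1)).factorial := by
          rw [← add_assoc, Nat.factorial_succ]
          push_cast
          ring

/-- The ratio of `(2 n - 2 j + 1)!` to `(2 n + 1)! / (2 n) ^ (2 j)`. -/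
noncomputable def oddFactorialRatio (n j : ℕ) : ℝ :=
  (4 * (n : ℝ) ^ 2) ^ j * (2 * (n - j) + 1).factorial / (2 * n + 1).factorial

theorem oddFactorialRatio_nonneg (n j : ℕ) : 0 ≤ oddFactorialRatio n j := by
  unfold oddFactorialRatio
  positivity

theorem oddFactorialRatio_le {n j : ℕ} (h : j ≤ n) : oddFactorialRatio n j ≤ Real.exp 2 ^ j := by
  obtain ⟨k, rfl⟩ := Nat.exists_eq_add_of_le' h
  have hle := add_pow_mul_factorial_le (2 * k + 1) (2 * j)
  have he : Real.exp 2 = Real.exp 1 ^ 2 := by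
    rw [← Real.exp_nat_mul]
    norm_num
  rw [oddFactorialRatio, Nat.add_sub_cancel, div_le_iff₀ (Nat.cast_pos.2 (Nat.factorial_pos _)), he,
    ← pow_mul, show 2 * (k + j) + 1 = 2 * k + 1 + 2 * j by ring]
  refine le_trans ?_ hle
  rw [pow_mul]
  gcongr
  push_cast
  nlinarith [Nat.cast_nonneg (α := ℝ) k, Nat.cast_nonneg (α := ℝ) j]

theorem tendsto_oddFactorialRatio (j : ℕ) :
    Tendsto (fun n => oddFactorialRatio n j) atTop (𝓝 1) := by
  induction j with
  | zero =>
    refine tendsto_const_nhds.congr fun n => ?_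
    rw [oddFactorialRatio, pow_zero, one_mul, Nat.sub_zero,
      div_self (Nat.cast_ne_zero.2 (Nat.factorial_ne_zero _))]
  | succ j ih =>
    have hinv : ∀ a : ℝ, Tendsto (fun n : ℕ => 1 - a * (n : ℝ)⁻¹) atTop (𝓝 1) := fun a => by
      simpa using (tendsto_inv_atTop_nhds_zero_nat.const_mul a).const_sub 1
    have h := ih.div ((hinv j).mul (hinv (j - 1 / 2))) (by norm_num)
    rw [one_mul, div_one] at h
    refine h.congr' ?_
    filter_upwards [eventually_ge_atTop (j + 1)] with n hn
    obtain ⟨k, rfl⟩ := Nat.exists_eq_add_of_le' hn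
    have hk : ((k + (j + 1) : ℕ) : ℝ) ≠ 0 := Nat.cast_ne_zero.2 (by omega)
    have hk1 : (k : ℝ) + 1 ≠ 0 := Nat.cast_add_one_ne_zero k
    have hk2 : 2 * (k : ℝ) + 3 ≠ 0 := by positivity
    have h1 : 1 - (j : ℝ) * ((k + (j + 1) : ℕ) : ℝ)⁻¹ = (k + 1) / (k + (j + 1) : ℕ) := by
      field_simp
      push_cast
      ring
    have h2 : 1 - ((j : ℝ) - 1 / 2) * ((k + (j + 1) : ℕ) : ℝ)⁻¹ =
        (2 * k + 3) / (2 * (k + (j + 1) : ℕ)) := by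
      field_simp
      push_cast
      ring
    have hf : (2 * (k + 1) + 1).factorial = (2 * k + 3) * ((2 * k + 2) * (2 * k + 1).factorial) := rfl
    rw [Pi.div_apply, h1, h2, oddFactorialRatio, oddFactorialRatio, Nat.add_sub_cancel,
      show k + (j + 1) - j = k + 1 by omega, hf, pow_succ]
    have hF : ((2 * (k + (j + 1)) + 1).factorial : ℝ) ≠ 0 :=
      Nat.cast_ne_zero.2 (Nat.factorial_ne_zero _)
    generalize ((2 * (k + (j + 1)) + 1).factorial : ℝ) = F at hF ⊢
    generalize ((k + (j + 1) : ℕ) : ℝ) = x at hk ⊢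
    push_cast
    field_simp
    ring

/-- The leading normalizing factor. -/
noncomputable def oddFactorialScale (n : ℕ) : ℝ :=
  (2 * n + 1).factorial / (4 ^ n * (n.factorial : ℝ) ^ 2 * Real.sqrt n)

theorem tendsto_oddFactorialScale :
    Tendsto oddFactorialScale atTop (𝓝 (2 / Real.sqrt Real.pi)) := by
  have h1 : Tendsto (fun n : ℕ => 2 + (n : ℝ)⁻¹) atTop (𝓝 2) := by
    simpa using tendsto_inv_atTop_nhds_zero_nat.const_add (2 : ℝ)
  have h := (h1.div Real.Wallis.tendsto_W_nhds_pi_div_two (by positivity)).sqrt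
  have hlim : Real.sqrt (2 / (Real.pi / 2)) = 2 / Real.sqrt Real.pi := by
    rw [div_div_eq_mul_div, Real.sqrt_div (by norm_num), Real.sqrt_mul_self zero_le_two]
  rw [hlim] at h
  refine h.congr' ?_
  filter_upwards [eventually_gt_atTop 0] with n hn
  have hn : (0 : ℝ) < n := Nat.cast_pos.2 hn
  have hs := Real.sq_sqrt hn.le
  have hs0 : Real.sqrt n ≠ 0 := (Real.sqrt_pos.2 hn).ne'
  have hf : (n.factorial : ℝ) ≠ 0 := Nat.cast_ne_zero.2 (Nat.factorial_ne_zero _)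
  have hf2 : ((2 * n).factorial : ℝ) ≠ 0 := Nat.cast_ne_zero.2 (Nat.factorial_ne_zero _)
  have hnn : 0 ≤ oddFactorialScale n := by
    unfold oddFactorialScale
    positivity
  rw [← Real.sqrt_sq hnn, Pi.div_apply, Real.Wallis.W_eq_factorial_ratio, oddFactorialScale,
    div_pow, mul_pow, hs, Nat.factorial_succ, pow_mul,
    show (2 : ℝ) ^ 4 = 4 ^ 2 by norm_num, pow_right_comm]
  congr 1
  push_cast
  field_simp

end FactorialAsymptotics

namespace RigidAsymptotics

open Finset Filter Topology BinomialPower HyperbolicMoments FactorialAsymptotics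

/-- The normalized moments. -/
noncomputable def scaledMoment (k : ℕ) : ℂ :=
  moment (2 * k + 1) / (2 * k + 1).factorial * (-(Real.pi ^ 2 / 9)) ^ k

/-- The normalized summands of the count. -/
noncomputable def scaledTerm (n j : ℕ) : ℂ :=
  scaledMoment (n - j) * (fallingEsymm (1 / 24) n j / (n : ℂ) ^ (2 * j)) *
    ((Real.pi ^ 2 / 6) ^ j * oddFactorialRatio n j : ℝ)

theorem tendsto_scaledTerm (j : ℕ) : Tendsto (fun n => scaledTerm n j) atTop
    (𝓝 (6 * Real.sqrt 3 / Real.pi ^ 2 * ((-(Real.pi ^ 2 / 12)) ^ j / j.factorial))) := by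
  have h1 := tendsto_moment.comp (tendsto_sub_atTop_nat j)
  have h2 := (tendsto_oddFactorialRatio j).const_mul ((Real.pi ^ 2 / 6) ^ j)
  have h := (h1.mul (tendsto_fallingEsymm (1 / 24) j)).mul h2.ofReal
  refine h.congr' (Eventually.of_forall fun n => rfl) |>.trans_eq ?_
  congr 1
  push_cast
  rw [show (-((Real.pi : ℂ) ^ 2 / 12)) = -(1 / 2) * (Real.pi ^ 2 / 6) by ring, mul_pow]
  ring

theorem norm_scaledTerm_le {B : ℝ} (hB : ∀ k, ‖scaledMoment k‖ ≤ B) (n j : ℕ) :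
    ‖scaledTerm n j‖ ≤ B * ((Real.pi ^ 2 / 6 * Real.exp 2) ^ j / j.factorial) := by
  have hB0 : 0 ≤ B := (norm_nonneg _).trans (hB 0)
  rcases lt_or_ge n j with h | h
  · rw [scaledTerm, fallingEsymm_eq_zero _ h, zero_div, mul_zero, zero_mul, norm_zero]
    positivity
  · have h1 : ‖fallingEsymm (1 / 24) n j / (n : ℂ) ^ (2 * j)‖ ≤ 1 / j.factorial := by
      rw [norm_div, norm_pow, Complex.norm_natCast]
      refine div_le_of_le_mul₀ (by positivity) (by positivity) ?_
      rw [div_mul_eq_mul_div, one_mul]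
      exact norm_fallingEsymm_le (by norm_num) n j
    have h2 : ‖(((Real.pi ^ 2 / 6) ^ j * oddFactorialRatio n j : ℝ) : ℂ)‖ ≤
        (Real.pi ^ 2 / 6 * Real.exp 2) ^ j := by
      rw [Complex.norm_real, Real.norm_of_nonneg
        (mul_nonneg (by positivity) (oddFactorialRatio_nonneg n j)), mul_pow]
      gcongr
      exact oddFactorialRatio_le h
    calc ‖scaledTerm n j‖ ≤ B * (1 / j.factorial) * (Real.pi ^ 2 / 6 * Real.exp 2) ^ j := by
          rw [scaledTerm, norm_mul, norm_mul]
          gcongr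
          exact hB _
      _ = B * ((Real.pi ^ 2 / 6 * Real.exp 2) ^ j / j.factorial) := by ring

theorem tendsto_tsum_scaledTerm : Tendsto (fun n => ∑' j, scaledTerm n j) atTop
    (𝓝 (6 * Real.sqrt 3 / Real.pi ^ 2 * Real.exp (-(Real.pi ^ 2 / 12)) : ℂ)) := by
  obtain ⟨B, hB⟩ := tendsto_moment.norm.bddAbove_range
  have hsum := (Real.summable_pow_div_factorial (Real.pi ^ 2 / 6 * Real.exp 2)).mul_left B
  have h := tendsto_tsum_of_dominated_convergence hsum tendsto_scaledTerm
    (Eventually.of_forall fun n j => norm_scaledTerm_le (fun k => hB ⟨k, rfl⟩) n j)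
  rw [tsum_mul_left] at h
  convert h using 3
  rw [Complex.ofReal_exp, Complex.exp_eq_exp_ℂ, NormedSpace.exp_eq_tsum_div]
  push_cast
  rfl

theorem fallingEsymm_mul_moment_eq {n j : ℕ} (hn : 0 < n) (h : j ≤ n) :
    fallingEsymm (1 / 24) n j * ((-(1 / 6)) ^ (n - j) * moment (2 * (n - j) + 1)) =
      (n.factorial : ℂ) ^ 2 * Real.sqrt n * (6 / Real.pi ^ 2) ^ n *
        (oddFactorialScale n * scaledTerm n j) := by
  obtain ⟨k, rfl⟩ := Nat.exists_eq_add_of_le' h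
  have hpi : (Real.pi : ℂ) ≠ 0 := Complex.ofReal_ne_zero.2 Real.pi_ne_zero
  have hs : ((Real.sqrt (k + j : ℕ) : ℝ) : ℂ) ≠ 0 :=
    Complex.ofReal_ne_zero.2 (Real.sqrt_pos.2 (Nat.cast_pos.2 hn)).ne'
  have hn0 : ((k + j : ℕ) : ℂ) ≠ 0 := Nat.cast_ne_zero.2 hn.ne'
  have hf : ∀ m : ℕ, (m.factorial : ℂ) ≠ 0 := fun m => Nat.cast_ne_zero.2 (Nat.factorial_ne_zero m)
  have h1 := hf (k + j)
  have h2 := hf (2 * (k + j) + 1)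
  have h3 := hf (2 * k + 1)
  have hpow : (-(1 / 6) : ℂ) ^ k = (6 / (Real.pi : ℂ) ^ 2) ^ (k + j) * ((Real.pi : ℂ) ^ 2 / 6) ^ j *
      (-((Real.pi : ℂ) ^ 2 / 9)) ^ k * 4 ^ j / 4 ^ (k + j) := by
    have h4 : (6 / (Real.pi : ℂ) ^ 2) ^ j * ((Real.pi : ℂ) ^ 2 / 6) ^ j = 1 := by
      rw [← mul_pow, div_mul_div_cancel₀ (pow_ne_zero 2 hpi), div_self (by norm_num), one_pow]
    have h6 : (-(1 / 6) : ℂ) = 6 / (Real.pi : ℂ) ^ 2 * (-((Real.pi : ℂ) ^ 2 / 9)) / 4 := by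
      field_simp
      norm_num
    rw [h6, div_pow (_ * _), mul_pow, div_eq_div_iff (pow_ne_zero _ (by norm_num))
      (pow_ne_zero _ (by norm_num)), pow_add, pow_add]
    linear_combination -((6 / (Real.pi : ℂ) ^ 2) ^ k * (-((Real.pi : ℂ) ^ 2 / 9)) ^ k *
      4 ^ k * 4 ^ j) * h4
  rw [scaledTerm, scaledMoment, oddFactorialScale, oddFactorialRatio, Nat.add_sub_cancel, hpow]
  push_cast at hs hn0 ⊢
  generalize (6 / (Real.pi : ℂ) ^ 2) ^ (k + j) = a
  generalize ((Real.pi : ℂ) ^ 2 / 6) ^ j = b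
  generalize (-((Real.pi : ℂ) ^ 2 / 9)) ^ k = c
  rw [mul_pow, pow_mul]
  field_simp

/-- The count is the normalizing factor times a convergent series. -/
theorem rigidIntervalOrderCount_div_eq {n : ℕ} (hn : 0 < n) :
    (((rigidIntervalOrderCount n : ℝ) /
      ((n.factorial : ℝ) * Real.sqrt n * (6 / Real.pi ^ 2) ^ n) : ℝ) : ℂ) =
      oddFactorialScale n * ∑' j, scaledTerm n j := by
  have hpi : (Real.pi : ℂ) ≠ 0 := Complex.ofReal_ne_zero.2 Real.pi_ne_zero
  have hs : ((Real.sqrt n : ℝ) : ℂ) ≠ 0 :=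
    Complex.ofReal_ne_zero.2 (Real.sqrt_pos.2 (Nat.cast_pos.2 hn)).ne'
  have hf : (n.factorial : ℂ) ≠ 0 := Nat.cast_ne_zero.2 (Nat.factorial_ne_zero n)
  have h := factorial_mul_card sum_choose_mul_moment moment_two_mul n
  rw [← rigidIntervalOrderCount_eq_card, Finset.sum_congr rfl fun j hj =>
    fallingEsymm_mul_moment_eq hn (Nat.lt_succ_iff.1 (Finset.mem_range.1 hj)),
    ← Finset.mul_sum, ← Finset.mul_sum] at h
  have ht : ∑' j, scaledTerm n j = ∑ j ∈ Finset.range (n + 1), scaledTerm n j := by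
    refine tsum_eq_sum fun j hj => ?_
    rw [Finset.mem_range, not_lt] at hj
    rw [scaledTerm, fallingEsymm_eq_zero _ hj, zero_div, mul_zero, zero_mul]
  rw [ht]
  push_cast
  rw [div_eq_iff (mul_ne_zero (mul_ne_zero hf hs)
    (pow_ne_zero _ (div_ne_zero (by norm_num) (pow_ne_zero 2 hpi))))]
  refine mul_left_cancel₀ hf (h.trans ?_)
  ring

end RigidAsymptotics

/-- `r n / (n! √n (6/π²)^n) → D₀ = 12√3 / (π^{5/2} e^{π²/12})`. -/
theorem rigid_asymptotics :
    Filter.Tendsto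
      (fun n : ℕ => (rigidIntervalOrderCount n : ℝ) /
        ((n.factorial : ℝ) * Real.sqrt n * (6 / Real.pi ^ 2) ^ n))
      Filter.atTop
      (nhds (12 * Real.sqrt 3 /
        (Real.pi ^ ((5 : ℝ) / 2) * Real.exp (Real.pi ^ 2 / 12)))) := by
  rw [← Filter.tendsto_ofReal_iff]
  have h := FactorialAsymptotics.tendsto_oddFactorialScale.ofReal.mul
    RigidAsymptotics.tendsto_tsum_scaledTerm
  refine (h.congr' ?_).trans_eq ?_
  · filter_upwards [Filter.eventually_gt_atTop 0] with n hn
    exact (RigidAsymptotics.rigidIntervalOrderCount_div_eq hn).symm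
  · have hs : Real.sqrt Real.pi ≠ 0 := (Real.sqrt_pos.2 Real.pi_pos).ne'
    have hp : Real.pi ^ ((5 : ℝ) / 2) = Real.pi ^ 2 * Real.sqrt Real.pi := by
      rw [show (5 : ℝ) / 2 = (2 : ℕ) + 1 / 2 by norm_num, Real.rpow_add Real.pi_pos,
        Real.rpow_natCast, Real.sqrt_eq_rpow]
    rw [hp, Real.exp_neg]
    push_cast
    congr 1
    field_simp
    norm_num
end
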